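/- Let N ≥ 1 and q > 1. There exists C = C(N,q) > 0 such that for every r, ρ > 0, every compact set K ⊆ B_r, every η ∈ 𝒯_{r,ρ}(K), and every positive solution u of ∂_t u − Δu + u^q = 0 in Q_∞ whose initial trace vanishes outside K: u(x,t) ≤ C (r+ρ) max{ (|x|−r−2ρ)^{−(N+1)}, ρ^{−1} t^{−N/2} } e^{−(|x|−r−3ρ)²/(4t)} ‖R[η]‖_{L^{q'}}^{q'} for every x with |x| ≥ r+3ρ and every t with 0 < t ≤ (r+2ρ)². -/

import Mathlib

open MeasureTheory Real Set Filter Metric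

noncomputable section

abbrev Euc (N : ℕ) := EuclideanSpace ℝ (Fin N)

/-- Spatial Laplacian of `f : ℝ^N → ℝ`. -/
def lapl {N : ℕ} (f : Euc N → ℝ) (x : Euc N) : ℝ :=
  ∑ i : Fin N,
    fderiv ℝ (fun y => fderiv ℝ f y (EuclideanSpace.single i 1)) x (EuclideanSpace.single i 1)

/-- The capacity `C_{2/q,q'}` of a set `A ⊆ ℝ^N`. -/
def capQ (N : ℕ) (q : ℝ) (A : Set (Euc N)) : ℝ :=
  sInf { c : ℝ | ∃ φ : Euc N → ℝ, ContDiff ℝ (⊤ : ℕ∞) φ ∧ HasCompactSupport φ ∧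
      (∃ U : Set (Euc N), IsOpen U ∧ A ⊆ U ∧ ∀ x ∈ U, 1 ≤ φ x) ∧
      c = (∫ x, φ x ^ (q / (q - 1))) +
          ∫ x, ∫ y, |φ x - φ y| ^ (q / (q - 1)) / ‖x - y‖ ^ ((N : ℝ) + 2 / (q - 1)) }

/-- The spherical shell piece `F_n` of `F` around `x` at time `t`. -/
def shell (N : ℕ) (F : Set (Euc N)) (x : Euc N) (t : ℝ) (n : ℕ) : Set (Euc N) :=
  {y | y ∈ F ∧ Real.sqrt ((n : ℝ) * t) ≤ dist x y ∧ dist x y ≤ Real.sqrt (((n : ℝ) + 1) * t)}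

/-- The parabolic capacitary potential `W_F`. -/
def Wpot (N : ℕ) (q : ℝ) (F : Set (Euc N)) (x : Euc N) (t : ℝ) : ℝ :=
  t ^ (-(N : ℝ) / 2) *
    ∑' n : ℕ,
      Real.sqrt (((n : ℝ) + 1) * t) ^ ((N : ℝ) - 2 / (q - 1)) * Real.exp (-(n : ℝ) / 4) *
        capQ N q ((fun y => (Real.sqrt (((n : ℝ) + 1) * t))⁻¹ • y) '' shell N F x t n)

/-- `u` is a positive solution of `∂ₜu - Δu + u^q = 0` in `Q_∞` whose initial
trace vanishes outside the closed set `F`. -/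
def IsSol (N : ℕ) (q : ℝ) (u : Euc N → ℝ → ℝ) (F : Set (Euc N)) : Prop :=
  ContDiffOn ℝ 2 (fun p : Euc N × ℝ => u p.1 p.2) (Set.univ ×ˢ Set.Ioi (0 : ℝ)) ∧
  (∀ x t, 0 < t → 0 < u x t) ∧
  (∀ x t, 0 < t → deriv (u x) t - lapl (fun y => u y t) x + u x t ^ q = 0) ∧
  (∀ E : Set (Euc N), IsCompact E → E ⊆ Fᶜ →
    Tendsto (fun t => sSup ((fun x => u x t) '' E)) (nhdsWithin 0 (Set.Ioi 0)) (nhds 0))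

/-- The heat potential of a function. -/
def heatPot (N : ℕ) (η : Euc N → ℝ) (x : Euc N) (t : ℝ) : ℝ :=
  ∫ y, (4 * π * t) ^ (-(N : ℝ) / 2) * Real.exp (-‖x - y‖ ^ 2 / (4 * t)) * η y

/-- The heat potential of a measure. -/
def heatPotM (N : ℕ) (μ : Measure (Euc N)) (x : Euc N) (t : ℝ) : ℝ :=
  ∫ y, (4 * π * t) ^ (-(N : ℝ) / 2) * Real.exp (-‖x - y‖ ^ 2 / (4 * t)) ∂μ

/-- The class `𝒯_{r,ρ}(K)` of test functions. -/
def TestFun (N : ℕ) (r ρ : ℝ) (K : Set (Euc N)) (η : Euc N → ℝ) : Prop :=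
  ContDiff ℝ (⊤ : ℕ∞) η ∧ HasCompactSupport η ∧ tsupport η ⊆ Metric.ball (0 : Euc N) (r + ρ) ∧
  (∀ x, 0 ≤ η x ∧ η x ≤ 1) ∧ (∀ x ∈ K, η x = 1)

/-- `‖R[η]‖_{L^{q'}}^{q'} = ∬_{Q_∞} (|∇ℍ[η]|² + |∂ₜℍ[η]|)^{q'} dx dt`. -/
def Rnorm (N : ℕ) (q : ℝ) (η : Euc N → ℝ) : ℝ :=
  ∫ t in Set.Ioi (0 : ℝ), ∫ x,
    (‖fderiv ℝ (fun y => heatPot N η y t) x‖ ^ 2 +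
      |deriv (fun τ => heatPot N η x τ) t|) ^ (q / (q - 1))

/-- partial derivative -/
def dd {N : ℕ} (i : Fin N) (f : Euc N → ℝ) (x : Euc N) : ℝ :=
  fderiv ℝ f x (EuclideanSpace.single i 1)

theorem lapl_eq {N : ℕ} (f : Euc N → ℝ) (x : Euc N) : lapl f x = ∑ i, dd i (dd i f) x := rfl

theorem dd_le {N : ℕ} (i : Fin N) (f : Euc N → ℝ) (x : Euc N) : |dd i f x| ≤ ‖fderiv ℝ f x‖ := by
  have := (fderiv ℝ f x).le_opNorm (EuclideanSpace.single i 1)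
  simpa [dd] using this

theorem dd_contDiffAt {N : ℕ} (i : Fin N) {f : Euc N → ℝ} {x : Euc N} {m n : WithTop ℕ∞}
    (h : ContDiffAt ℝ n f x) (hmn : m + 1 ≤ n) : ContDiffAt ℝ m (dd i f) x :=
  (h.fderiv_right hmn).clm_apply contDiffAt_const

theorem dd_diffAt {N : ℕ} (i : Fin N) {f : Euc N → ℝ} {x : Euc N}
    (h : ContDiffAt ℝ 2 f x) : DifferentiableAt ℝ (dd i f) x :=
  (dd_contDiffAt i h (m := 1) (by norm_num)).differentiableAt (by norm_num)

theorem ev_diff {N : ℕ} {f : Euc N → ℝ} {x : Euc N}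
    (h : ContDiffAt ℝ 2 f x) : ∀ᶠ y in nhds x, DifferentiableAt ℝ f y :=
  (h.eventually (by simp)).mono fun _ hy => hy.differentiableAt (by norm_num)

theorem dd_congr {N : ℕ} (i : Fin N) {f g : Euc N → ℝ} {x : Euc N} (h : f =ᶠ[nhds x] g) :
    dd i f x = dd i g x := by
  unfold dd; rw [h.fderiv_eq]

theorem dd_ev_congr {N : ℕ} (i : Fin N) {f g : Euc N → ℝ} {x : Euc N} (h : f =ᶠ[nhds x] g) :
    dd i f =ᶠ[nhds x] dd i g := by
  filter_upwards [h.eventuallyEq_nhds] with y hy using dd_congr i hy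

theorem lapl_congr {N : ℕ} {f g : Euc N → ℝ} {x : Euc N} (h : f =ᶠ[nhds x] g) :
    lapl f x = lapl g x := by
  simp only [lapl_eq]
  exact Finset.sum_congr rfl fun i _ => dd_congr i (dd_ev_congr i h)

theorem dd_mul {N : ℕ} (i : Fin N) {f g : Euc N → ℝ} {x : Euc N}
    (hf : DifferentiableAt ℝ f x) (hg : DifferentiableAt ℝ g x) :
    dd i (fun y => f y * g y) x = f x * dd i g x + g x * dd i f x := by
  unfold dd; rw [fderiv_fun_mul hf hg]; simp

theorem dd_add {N : ℕ} (i : Fin N) {f g : Euc N → ℝ} {x : Euc N}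
    (hf : DifferentiableAt ℝ f x) (hg : DifferentiableAt ℝ g x) :
    dd i (fun y => f y + g y) x = dd i f x + dd i g x := by
  unfold dd; rw [fderiv_fun_add hf hg]; simp

theorem lapl_add {N : ℕ} {f g : Euc N → ℝ} {x : Euc N}
    (hf : ContDiffAt ℝ 2 f x) (hg : ContDiffAt ℝ 2 g x) :
    lapl (fun y => f y + g y) x = lapl f x + lapl g x := by
  simp only [lapl_eq, ← Finset.sum_add_distrib]
  refine Finset.sum_congr rfl fun i _ => ?_
  rw [← dd_add i (dd_diffAt i hf) (dd_diffAt i hg)]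
  apply dd_congr
  filter_upwards [ev_diff hf, ev_diff hg] with y h1 h2 using dd_add i h1 h2

theorem lapl_mul {N : ℕ} {f g : Euc N → ℝ} {x : Euc N}
    (hf : ContDiffAt ℝ 2 f x) (hg : ContDiffAt ℝ 2 g x) :
    lapl (fun y => f y * g y) x = f x * lapl g x + g x * lapl f x
      + 2 * ∑ i, dd i f x * dd i g x := by
  simp only [lapl_eq, Finset.mul_sum, ← Finset.sum_add_distrib]
  refine Finset.sum_congr rfl fun i _ => ?_
  have h1 : dd i (fun y => f y * g y) =ᶠ[nhds x] fun y => f y * dd i g y + g y * dd i f y := by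
    filter_upwards [ev_diff hf, ev_diff hg] with y h1 h2 using dd_mul i h1 h2
  have df := hf.differentiableAt (by norm_num : (2 : WithTop ℕ∞) ≠ 0)
  have dg := hg.differentiableAt (by norm_num : (2 : WithTop ℕ∞) ≠ 0)
  rw [dd_congr i h1, dd_add i (f := fun y => f y * dd i g y) (g := fun y => g y * dd i f y)
    (df.mul (dd_diffAt i hg)) (dg.mul (dd_diffAt i hf)),
    dd_mul i df (dd_diffAt i hg), dd_mul i dg (dd_diffAt i hf)]
  ring

theorem dd_comp {N : ℕ} (i : Fin N) {f : Euc N → ℝ} {x : Euc N} {P : ℝ → ℝ} {p : ℝ}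
    (hf : DifferentiableAt ℝ f x) (hP : HasDerivAt P p (f x)) :
    dd i (fun y => P (f y)) x = p * dd i f x := by
  unfold dd
  have := (hP.comp_hasFDerivAt x hf.hasFDerivAt).fderiv
  simp only [Function.comp_def] at this
  rw [this]; simp

theorem lapl_comp {N : ℕ} {f : Euc N → ℝ} {x : Euc N} {P P1 : ℝ → ℝ} {p2 : ℝ}
    (hf : ContDiffAt ℝ 2 f x) (hP : ∀ᶠ w in nhds (f x), HasDerivAt P (P1 w) w)
    (hP1 : HasDerivAt P1 p2 (f x)) :
    lapl (fun y => P (f y)) x = p2 * ∑ i, dd i f x ^ 2 + P1 (f x) * lapl f x := by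
  simp only [lapl_eq, Finset.mul_sum, ← Finset.sum_add_distrib]
  refine Finset.sum_congr rfl fun i _ => ?_
  have df := hf.differentiableAt (by norm_num : (2 : WithTop ℕ∞) ≠ 0)
  have h1 : dd i (fun y => P (f y)) =ᶠ[nhds x] fun y => P1 (f y) * dd i f y := by
    filter_upwards [ev_diff hf, df.continuousAt.eventually hP] with y h1 h2 using dd_comp i h1 h2
  rw [dd_congr i h1, dd_mul i (f := fun y => P1 (f y))
    (hP1.comp_hasFDerivAt x df.hasFDerivAt).differentiableAt (dd_diffAt i hf),
    dd_comp i df hP1]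
  ring

theorem fderiv_nsq {N : ℕ} (x y v : Euc N) :
    fderiv ℝ (fun y : Euc N => ‖y - x‖ ^ 2) y v = 2 * inner ℝ (y - x) v := by
  have h := ((hasStrictFDerivAt_norm_sq (y - x)).hasFDerivAt.comp y
    ((hasFDerivAt_id y).sub_const x)).fderiv
  simp only [Function.comp_def, id] at h
  rw [h]; simp [inner_sub_left]

theorem dd_nsq {N : ℕ} (i : Fin N) (x y : Euc N) :
    dd i (fun y : Euc N => ‖y - x‖ ^ 2) y = 2 * (y i - x i) := by
  unfold dd; rw [fderiv_nsq]; simp [EuclideanSpace.inner_single_right]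

theorem contDiff_nsq {N : ℕ} (x : Euc N) {n} : ContDiff ℝ n (fun y : Euc N => ‖y - x‖ ^ 2) :=
  (contDiff_id.sub contDiff_const).norm_sq ℝ

theorem sum_sq_nsq {N : ℕ} (x y : Euc N) : 
    ∑ i, dd i (fun y : Euc N => ‖y - x‖ ^ 2) y ^ 2 = 4 * ‖y - x‖ ^ 2 := by
  simp only [dd_nsq]
  rw [EuclideanSpace.norm_sq_eq, Finset.mul_sum]
  refine Finset.sum_congr rfl fun i _ => ?_
  simp; ring

theorem lapl_nsq {N : ℕ} (x y : Euc N) :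
    lapl (fun y : Euc N => ‖y - x‖ ^ 2) y = 2 * N := by
  rw [lapl_eq]
  have : ∀ i : Fin N, dd i (dd i (fun y : Euc N => ‖y - x‖ ^ 2)) y = 2 := by
    intro i
    have : dd i (fun y : Euc N => ‖y - x‖ ^ 2) = fun y => 2 * (y i - x i) := by
      ext y; exact dd_nsq i x y
    rw [this]; unfold dd
    have h : HasFDerivAt (fun y : Euc N => 2 * (y i - x i))
      ((2:ℝ) • (EuclideanSpace.proj i : Euc N →L[ℝ] ℝ)) y := by
      have := ((EuclideanSpace.proj i : Euc N →L[ℝ] ℝ).hasFDerivAt (x := y)).sub_const (x i)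
      exact this.const_mul 2
    rw [h.fderiv]; simp
  simp [this, mul_comm]

theorem lapl_rad {N : ℕ} {P P1 : ℝ → ℝ} {p2 : ℝ} (x y : Euc N)
    (hP : ∀ᶠ w in nhds (‖y - x‖ ^ 2), HasDerivAt P (P1 w) w)
    (hP1 : HasDerivAt P1 p2 (‖y - x‖ ^ 2)) :
    lapl (fun y => P (‖y - x‖ ^ 2)) y
      = p2 * (4 * ‖y - x‖ ^ 2) + P1 (‖y - x‖ ^ 2) * (2 * N) := by
  rw [lapl_comp (contDiff_nsq x).contDiffAt hP hP1, sum_sq_nsq, lapl_nsq]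

theorem fderiv_rad {N : ℕ} {P : ℝ → ℝ} {p : ℝ} (x y v : Euc N)
    (hP : HasDerivAt P p (‖y - x‖ ^ 2)) :
    fderiv ℝ (fun y => P (‖y - x‖ ^ 2)) y v = p * (2 * inner ℝ (y - x) v) := by
  have df : DifferentiableAt ℝ (fun y : Euc N => ‖y - x‖ ^ 2) y :=
    (contDiff_nsq x).contDiffAt.differentiableAt (n := 1) (by norm_num)
  have := (hP.comp_hasFDerivAt y df.hasFDerivAt).fderiv
  simp only [Function.comp_def] at this
  rw [this]; simp [fderiv_nsq]

theorem dd_rad {N : ℕ} (i : Fin N) {P : ℝ → ℝ} {p : ℝ} (x y : Euc N)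
    (hP : HasDerivAt P p (‖y - x‖ ^ 2)) :
    dd i (fun y => P (‖y - x‖ ^ 2)) y = p * (2 * (y i - x i)) := by
  unfold dd; rw [fderiv_rad x y _ hP]; simp [EuclideanSpace.inner_single_right]

theorem deriv2_nonpos_of_max {f : ℝ → ℝ} {x : ℝ} (h : IsLocalMax f x) (hc : ContinuousAt f x) :
    deriv (deriv f) x ≤ 0 := by
  by_contra hlt
  push Not at hlt
  have hmin := isLocalMin_of_deriv_deriv_pos hlt h.deriv_eq_zero hc
  have hconst : f =ᶠ[nhds x] fun _ => f x := by
    filter_upwards [h, hmin] with y h1 h2 using le_antisymm h1 h2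
  have : deriv (deriv f) x = 0 := by
    have h1 : deriv f =ᶠ[nhds x] fun _ => 0 := by
      filter_upwards [hconst.eventuallyEq_nhds] with y hy
      rw [hy.deriv_eq]; simp
    rw [h1.deriv_eq]; simp
  linarith

theorem lapl_nonpos_of_max {N : ℕ} {f : Euc N → ℝ} {x : Euc N} (h : IsLocalMax f x)
    (hf : ContDiffAt ℝ 2 f x) : lapl f x ≤ 0 := by
  rw [lapl_eq]
  apply Finset.sum_nonpos
  intro i _
  set e : Euc N := EuclideanSpace.single i 1
  have hline : ∀ s : ℝ, HasDerivAt (fun s : ℝ => x + s • e) e s := fun s => by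
    simpa using ((hasDerivAt_id s).smul_const e).const_add x
  have hc : Tendsto (fun s : ℝ => x + s • e) (nhds 0) (nhds x) := by
    have := (hline 0).continuousAt.tendsto; simpa using this
  have hmax : IsLocalMax (fun s : ℝ => f (x + s • e)) 0 := by
    have := hc.eventually h
    simpa [IsLocalMax, IsMaxFilter] using this
  have h1 : deriv (fun s : ℝ => f (x + s • e)) =ᶠ[nhds 0] fun s => dd i f (x + s • e) := by
    filter_upwards [hc.eventually (ev_diff hf)] with s hs
    exact (hs.hasFDerivAt.comp_hasDerivAt s (hline s)).deriv
  have h2 : deriv (deriv (fun s : ℝ => f (x + s • e))) 0 = dd i (dd i f) x := by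
    rw [h1.deriv_eq]
    have hd : DifferentiableAt ℝ (dd i f) (x + (0:ℝ) • e) := by simpa using dd_diffAt i hf
    have := (hd.hasFDerivAt.comp_hasDerivAt (0:ℝ) (hline 0)).deriv
    simp only [Function.comp_def] at this
    rw [this]; simp [dd, e]
  rw [← h2]
  refine deriv2_nonpos_of_max hmax ?_
  have hcf : ContinuousAt f (x + (0:ℝ) • e) := by simpa using hf.continuousAt
  exact hcf.comp (f := fun s : ℝ => x + s • e) (hline 0).continuousAt

/-! slices -/

/-- spacetime version -/
theorem slice_x {N : ℕ} {f : Euc N → ℝ → ℝ} {x : Euc N} {t : ℝ} {n : WithTop ℕ∞}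
    (h : ContDiffAt ℝ n (fun p : Euc N × ℝ => f p.1 p.2) (x, t)) :
    ContDiffAt ℝ n (fun y => f y t) x :=
  h.comp (f := fun y : Euc N => (y, t)) x (contDiffAt_id.prodMk contDiffAt_const)

theorem slice_t {N : ℕ} {f : Euc N → ℝ → ℝ} {x : Euc N} {t : ℝ} {n : WithTop ℕ∞}
    (h : ContDiffAt ℝ n (fun p : Euc N × ℝ => f p.1 p.2) (x, t)) :
    ContDiffAt ℝ n (fun s => f x s) t :=
  h.comp (f := fun s : ℝ => (x, s)) t (contDiffAt_const.prodMk contDiffAt_id)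

theorem slice_fderiv {N : ℕ} {f : Euc N → ℝ → ℝ} {x : Euc N} {t : ℝ}
    (h : DifferentiableAt ℝ (fun p : Euc N × ℝ => f p.1 p.2) (x, t)) (v : Euc N) :
    fderiv ℝ (fun y => f y t) x v = fderiv ℝ (fun p : Euc N × ℝ => f p.1 p.2) (x, t) (v, 0) := by
  have := (h.hasFDerivAt.comp (f := fun y : Euc N => (y, t)) x
    ((hasFDerivAt_id x).prodMk (hasFDerivAt_const t x))).fderiv
  simp only [Function.comp_def] at this
  rw [this]; simp

theorem slice_deriv {N : ℕ} {f : Euc N → ℝ → ℝ} {x : Euc N} {t : ℝ}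
    (h : DifferentiableAt ℝ (fun p : Euc N × ℝ => f p.1 p.2) (x, t)) :
    deriv (f x) t = fderiv ℝ (fun p : Euc N × ℝ => f p.1 p.2) (x, t) (0, 1) := by
  have := (h.hasFDerivAt.comp_hasDerivAt (f := fun s : ℝ => (x, s)) t
    ((hasDerivAt_const t x).prodMk (hasDerivAt_id t))).deriv
  simpa only [Function.comp_def] using this

theorem slice_contDiff_dd {N : ℕ} {f : Euc N → ℝ → ℝ} {p : Euc N × ℝ} {m n : WithTop ℕ∞}
    (h : ContDiffAt ℝ n (fun p : Euc N × ℝ => f p.1 p.2) p) (hn : n ≠ ⊤) (hn' : n ≠ (⊤ : ℕ∞)) (hmn : m + 1 ≤ n) (i : Fin N) :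
    ContDiffAt ℝ m (fun p : Euc N × ℝ => dd i (fun y => f y p.2) p.1) p := by
  have h1 : ContDiffAt ℝ m (fun p : Euc N × ℝ => fderiv ℝ (fun p : Euc N × ℝ => f p.1 p.2) p
      (EuclideanSpace.single i 1, 0)) p := (h.fderiv_right hmn).clm_apply contDiffAt_const
  refine h1.congr_of_eventuallyEq ?_
  filter_upwards [h.eventually (by simpa using hn')] with p' hp'
  have h0 : n ≠ 0 := by rintro rfl; simp at hmn
  exact slice_fderiv (hp'.differentiableAt h0) _

theorem slice_cont_deriv {N : ℕ} {f : Euc N → ℝ → ℝ} {p : Euc N × ℝ}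
    (h : ContDiffAt ℝ 2 (fun p : Euc N × ℝ => f p.1 p.2) p) :
    ContinuousAt (fun p : Euc N × ℝ => deriv (f p.1) p.2) p := by
  have h1 : ContDiffAt ℝ 1 (fun p : Euc N × ℝ => fderiv ℝ (fun p : Euc N × ℝ => f p.1 p.2) p
      (0, 1)) p := (h.fderiv_right (by norm_num)).clm_apply contDiffAt_const
  refine h1.continuousAt.congr ?_
  filter_upwards [h.eventually (by simp)] with p' hp'
  exact (slice_deriv (hp'.differentiableAt (by norm_num))).symm

theorem slice_cont_dd {N : ℕ} {f : Euc N → ℝ → ℝ} {p : Euc N × ℝ}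
    (h : ContDiffAt ℝ 2 (fun p : Euc N × ℝ => f p.1 p.2) p) (i : Fin N) :
    ContinuousAt (fun p : Euc N × ℝ => dd i (fun y => f y p.2) p.1) p :=
  (slice_contDiff_dd h (m := 1) (by simp) (by simp) (by norm_num) i).continuousAt

theorem slice_cont_lapl {N : ℕ} {f : Euc N → ℝ → ℝ} {p : Euc N × ℝ}
    (h : ContDiffAt ℝ 2 (fun p : Euc N × ℝ => f p.1 p.2) p) :
    ContinuousAt (fun p : Euc N × ℝ => lapl (fun y => f y p.2) p.1) p := by
  simp only [lapl_eq]
  refine tendsto_finsetSum _ fun i _ => ?_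
  have h1 := slice_contDiff_dd h (m := 1) (by simp) (by simp) (by norm_num) i
  exact (slice_contDiff_dd (f := fun y s => dd i (fun y => f y s) y) h1 (m := 0)
    (by simp) (by simp) (by norm_num) i).continuousAt

theorem lapl_rad0 {N : ℕ} {P P1 : ℝ → ℝ} {p2 : ℝ} (y : Euc N)
    (hP : ∀ᶠ w in nhds (‖y‖ ^ 2), HasDerivAt P (P1 w) w)
    (hP1 : HasDerivAt P1 p2 (‖y‖ ^ 2)) :
    lapl (fun y => P (‖y‖ ^ 2)) y
      = p2 * (4 * ‖y‖ ^ 2) + P1 (‖y‖ ^ 2) * (2 * N) := by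
  have := lapl_rad (0 : Euc N) y (P := P) (P1 := P1) (p2 := p2) (by simpa using hP) (by simpa using hP1)
  simpa using this

theorem dd_rad0 {N : ℕ} (i : Fin N) {P : ℝ → ℝ} {p : ℝ} (y : Euc N)
    (hP : HasDerivAt P p (‖y‖ ^ 2)) :
    dd i (fun y => P (‖y‖ ^ 2)) y = p * (2 * y i) := by
  have := dd_rad i (0 : Euc N) y (P := P) (by simpa using hP)
  simpa using this

theorem sol_cda {N : ℕ} {q : ℝ} {u : Euc N → ℝ → ℝ} {K : Set (Euc N)} (h : IsSol N q u K)
    (y : Euc N) {s : ℝ} (hs : 0 < s) :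
    ContDiffAt ℝ 2 (fun p : Euc N × ℝ => u p.1 p.2) (y, s) :=
  h.1.contDiffAt ((isOpen_univ.prod isOpen_Ioi).mem_nhds ⟨mem_univ _, hs⟩)

theorem sol_small {N : ℕ} {q : ℝ} {u : Euc N → ℝ → ℝ} {K : Set (Euc N)} (h : IsSol N q u K)
    {E : Set (Euc N)} (hE : IsCompact E) (hEK : E ⊆ Kᶜ) {ε : ℝ} (hε : 0 < ε) :
    ∃ τ > 0, ∀ t, 0 < t → t < τ → ∀ x ∈ E, u x t < ε := by
  have h1 := (h.2.2.2 E hE hEK).eventually (gt_mem_nhds hε)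
  rw [eventually_nhdsWithin_iff, Metric.eventually_nhds_iff] at h1
  obtain ⟨τ, hτ, h2⟩ := h1
  refine ⟨τ, hτ, fun t ht htτ x hx => ?_⟩
  refine lt_of_le_of_lt ?_ (h2 (by simpa [abs_of_pos ht] using htτ) ht)
  apply le_csSup _ (mem_image_of_mem _ hx)
  apply (hE.image_of_continuousOn _).bddAbove
  intro y _
  exact (slice_x (sol_cda h y ht)).continuousAt.continuousWithinAt

theorem sol_bdd {N : ℕ} {q : ℝ} {u : Euc N → ℝ → ℝ} {K : Set (Euc N)} (h : IsSol N q u K)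
    {E : Set (Euc N)} (hE : IsCompact E) {τ T : ℝ} (hτ : 0 < τ) :
    ∃ A > 0, ∀ y ∈ E, ∀ s ∈ Icc τ T, u y s ≤ A := by
  have hc : IsCompact (E ×ˢ Icc τ T) := hE.prod isCompact_Icc
  obtain ⟨A, hA⟩ := (hc.image_of_continuousOn (f := fun p : Euc N × ℝ => u p.1 p.2)
    (fun p hp => (sol_cda h p.1 (lt_of_lt_of_le hτ hp.2.1)).continuousAt.continuousWithinAt)).bddAbove
  refine ⟨max A 1, by positivity, fun y hy s hs => ?_⟩
  exact le_max_of_le_left (hA ⟨(y, s), ⟨hy, hs⟩, rfl⟩)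

theorem sol_bdd' {N : ℕ} {q : ℝ} {u : Euc N → ℝ → ℝ} {K : Set (Euc N)} (h : IsSol N q u K)
    {E : Set (Euc N)} (hE : IsCompact E) (hEK : E ⊆ Kᶜ) (T : ℝ) :
    ∃ A > 0, ∀ y ∈ E, ∀ s, 0 < s → s ≤ T → u y s ≤ A := by
  obtain ⟨τ, hτ, h1⟩ := sol_small h hE hEK one_pos
  obtain ⟨A, hA, h2⟩ := sol_bdd h hE (T := T) hτ
  refine ⟨max A 1, by positivity, fun y hy s hs hsT => ?_⟩
  rcases lt_or_ge s τ with hlt | hge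
  · exact le_max_of_le_right (h1 s hs hlt y hy).le
  · exact le_max_of_le_left (h2 y hy s ⟨hge, hsT⟩)

theorem deriv_nonneg_left {f : ℝ → ℝ} {d t τ : ℝ} (hd : HasDerivAt f d t) (hτ : τ < t)
    (h : ∀ s ∈ Icc τ t, f s ≤ f t) : 0 ≤ d := by
  have h1 := hd.hasDerivWithinAt (s := Iio t)
  rw [hasDerivWithinAt_iff_tendsto_slope' (by simp)] at h1
  refine ge_of_tendsto h1 ?_
  filter_upwards [Ioo_mem_nhdsLT hτ] with s hs
  rw [slope_def_field]
  exact div_nonneg_of_nonpos (by linarith [h s ⟨hs.1.le, hs.2.le⟩]) (by linarith [hs.2])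

theorem hasDeriv_g (m w : ℝ) (hw : -1 < w) :
    HasDerivAt (fun w : ℝ => (1 + w) ^ (-m)) (-m * (1 + w) ^ (-m - 1)) w := by
  have := ((hasDerivAt_id w).const_add 1).rpow_const (p := -m) (Or.inl (by simp; linarith))
  simpa using this

theorem hasDeriv_k (a b w : ℝ) (hw : w < b) :
    HasDerivAt (fun w : ℝ => (b - w) ^ (-a)) (a * (b - w) ^ (-a - 1)) w := by
  have := ((hasDerivAt_id w).const_sub b).rpow_const (p := -a) (Or.inl (by simp; linarith))
  simpa using this

theorem lapl_g {N : ℕ} (m : ℝ) (hm : 0 < m) (y : Euc N) :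
    lapl (fun y : Euc N => (1 + ‖y‖ ^ 2) ^ (-m)) y ≤ 4 * m * (m + 1) * (1 + ‖y‖ ^ 2) ^ (-m) := by
  have hp : 0 < 1 + ‖y‖ ^ 2 := by positivity
  have h2 : HasDerivAt (fun w : ℝ => -m * (1 + w) ^ (-m - 1))
      (m * (m + 1) * (1 + ‖y‖ ^ 2) ^ (-m - 2)) (‖y‖ ^ 2) := by
    have := (hasDeriv_g (m + 1) (‖y‖ ^ 2) (by linarith)).const_mul (-m)
    rw [show -(m + 1) - 1 = -m - 2 by ring, show -(m + 1) = -m - 1 by ring] at this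
    exact this.congr_deriv (by ring)
  rw [lapl_rad0 (P := fun w => (1 + w) ^ (-m)) (P1 := fun w => -m * (1 + w) ^ (-m - 1)) y ?_ h2]
  · have e1 : (1 + ‖y‖ ^ 2) ^ (-m - 1) = (1 + ‖y‖ ^ 2) ^ (-m - 2) * (1 + ‖y‖ ^ 2) := by
      rw [← rpow_add_one hp.ne']; congr 1; ring
    have e2 : (1 + ‖y‖ ^ 2) ^ (-m) = (1 + ‖y‖ ^ 2) ^ (-m - 2) * (1 + ‖y‖ ^ 2) ^ 2 := by
      rw [← rpow_add_natCast hp.ne']; congr 1; push_cast; ring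
    rw [e1, e2]
    have hX : 0 < (1 + ‖y‖ ^ 2) ^ (-m - 2) := by positivity
    set X := (1 + ‖y‖ ^ 2) ^ (-m - 2)
    have : 0 ≤ m * X * (1 + ‖y‖ ^ 2) * (2 * N) := by positivity
    have h4 : 0 ≤ m * (m + 1) * X * (4 * (1 + ‖y‖ ^ 2 + ‖y‖ ^ 4)) := by positivity
    nlinarith
  · filter_upwards [lt_mem_nhds (show -1 < ‖y‖ ^ 2 by nlinarith [sq_nonneg ‖y‖])] with w hw
    exact hasDeriv_g m w hw

theorem lapl_k {N : ℕ} (a n : ℝ) (ha : 0 < a) (y : Euc N) (hy : ‖y‖ ^ 2 < n ^ 2) :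
    lapl (fun y : Euc N => (n ^ 2 - ‖y‖ ^ 2) ^ (-a)) y
      ≤ (2 * a * N + 4 * a * (a + 1)) * n ^ 2 * (n ^ 2 - ‖y‖ ^ 2) ^ (-a - 2) := by
  have hp : 0 < n ^ 2 - ‖y‖ ^ 2 := by linarith
  have h2 : HasDerivAt (fun w : ℝ => a * (n ^ 2 - w) ^ (-a - 1))
      (a * (a + 1) * (n ^ 2 - ‖y‖ ^ 2) ^ (-a - 2)) (‖y‖ ^ 2) := by
    have := (hasDeriv_k (a + 1) (n ^ 2) (‖y‖ ^ 2) hy).const_mul a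
    rw [show -(a + 1) - 1 = -a - 2 by ring, show -(a + 1) = -a - 1 by ring] at this
    exact this.congr_deriv (by ring)
  rw [lapl_rad0 (P := fun w => (n ^ 2 - w) ^ (-a)) (P1 := fun w => a * (n ^ 2 - w) ^ (-a - 1)) y ?_ h2]
  · have e1 : (n ^ 2 - ‖y‖ ^ 2) ^ (-a - 1) = (n ^ 2 - ‖y‖ ^ 2) ^ (-a - 2) * (n ^ 2 - ‖y‖ ^ 2) := by
      rw [← rpow_add_one hp.ne']; congr 1; ring
    simp only [e1]
    have hX : 0 < (n ^ 2 - ‖y‖ ^ 2) ^ (-a - 2) := by positivity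
    set X := (n ^ 2 - ‖y‖ ^ 2) ^ (-a - 2)
    have h3 : 0 ≤ a * (a + 1) * X * (n ^ 2 - ‖y‖ ^ 2) := by positivity
    have h4 : 0 ≤ a * X * N * ‖y‖ ^ 2 := by positivity
    nlinarith
  · filter_upwards [gt_mem_nhds hy] with w hw
    exact hasDeriv_k a (n ^ 2) w hw

set_option maxHeartbeats 1000000 in
theorem barrier {N : ℕ} {q : ℝ} (hq : 1 < q) {u : Euc N → ℝ → ℝ} {K : Set (Euc N)} (h : IsSol N q u K)
    {r : ℝ} (hr : 0 < r) (hK : K ⊆ ball 0 r) {T : ℝ} {A0 : ℝ} (hA0 : 0 < A0)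
    (hA : ∀ y ∈ sphere (0 : Euc N) r, ∀ s, 0 < s → s ≤ T → u y s ≤ A0)
    {m : ℝ} (hm : 0 < m) {c a : ℝ} (hc : 0 < c) (ha : a = 2 / (q - 1))
    (hcB : 2 * a * N + 4 * a * (a + 1) ≤ c ^ (q - 1)) {n : ℝ} (hn : r < n)
    {y0 : Euc N} {t0 : ℝ} (hy0 : r ≤ ‖y0‖) (hy0' : ‖y0‖ < n) (ht0 : 0 < t0) (ht0T : t0 ≤ T) :
    u y0 t0 ≤ A0 * (1 + r ^ 2) ^ m * exp (4 * m * (m + 1) * t0) * (1 + ‖y0‖ ^ 2) ^ (-m)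
      + c * n ^ a * (n ^ 2 - ‖y0‖ ^ 2) ^ (-a) := by
  have hq1 : 0 < q - 1 := by linarith
  have ha0 : 0 < a := by rw [ha]; positivity
  have hn0 : 0 < n := by linarith
  set B := A0 * (1 + r ^ 2) ^ m with hB
  have hB0 : 0 < B := by positivity
  set μ := 4 * m * (m + 1) with hμ
  have hμ0 : 0 < μ := by positivity
  set κ := c * n ^ a with hκ
  have hκ0 : 0 < κ := by positivity
  by_contra hcon
  push Not at hcon
  set W : Euc N × ℝ → ℝ := fun p => B * exp (μ * p.2) * (1 + ‖p.1‖ ^ 2) ^ (-m)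
      + κ * (n ^ 2 - ‖p.1‖ ^ 2) ^ (-a) with hW
  have hWnn : ∀ p : Euc N × ℝ, ‖p.1‖ ^ 2 < n ^ 2 → 0 < W p := by
    intro p hp
    have : 0 < n ^ 2 - ‖p.1‖ ^ 2 := by linarith
    simp only [hW]; positivity
  have hy0sq : ‖y0‖ ^ 2 < n ^ 2 := by gcongr
  set m0 := u y0 t0 - W (y0, t0) with hm0
  have hm0p : 0 < m0 := by simp only [hm0, hW]; linarith
  have hEc : IsCompact (closedBall (0 : Euc N) n \ ball 0 r) := (isCompact_closedBall 0 n).diff isOpen_ball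
  obtain ⟨τ, hτ, hsm⟩ := sol_small h hEc (fun y hy hyK => hy.2 (hK hyK)) hm0p
  set τ' := min τ t0 / 2 with hτ'
  have hτ'0 : 0 < τ' := by positivity
  have hτ'1 : τ' < τ := by have := min_le_left τ t0; linarith
  have hτ'2 : τ' < t0 := by have := min_le_right τ t0; linarith
  obtain ⟨U0, hU0, hU⟩ := sol_bdd h hEc (T := T) hτ'0
  set γ := min ((n ^ 2 - ‖y0‖ ^ 2) / 2) ((κ / U0) ^ (1 / a)) with hγ
  have hγ0 : 0 < γ := lt_min (by linarith) (by positivity)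
  have hγ1 : γ < n ^ 2 - ‖y0‖ ^ 2 := lt_of_le_of_lt (min_le_left _ _) (by linarith)
  have hγ2 : U0 ≤ κ * γ ^ (-a) := by
    have : γ ^ a ≤ κ / U0 := by
      calc γ ^ a ≤ ((κ / U0) ^ (1 / a)) ^ a := by gcongr; exact min_le_right _ _
        _ = κ / U0 := by rw [← rpow_mul (by positivity), one_div, inv_mul_cancel₀ ha0.ne', rpow_one]
    rw [rpow_neg hγ0.le, ← div_eq_mul_inv, le_div_iff₀ (by positivity)]
    rw [le_div_iff₀ hU0] at this; linarith
  set S : Set (Euc N) := {y | r ≤ ‖y‖ ∧ ‖y‖ ^ 2 ≤ n ^ 2 - γ} with hS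
  have hSE : S ⊆ closedBall (0 : Euc N) n \ ball 0 r := by
    intro y hy
    refine ⟨?_, by simpa using hy.1⟩
    simp only [mem_closedBall, dist_zero_right]
    exact le_of_sq_le_sq (by linarith [hy.2]) hn0.le
  have hScl : IsClosed S := by
    apply IsClosed.inter
    · exact isClosed_le continuous_const continuous_norm
    · exact isClosed_le (continuous_norm.pow 2) continuous_const
  have hSc : IsCompact S := hEc.of_isClosed_subset hScl hSE
  have hCc : IsCompact (S ×ˢ Icc τ' T) := hSc.prod isCompact_Icc
  have hSlt : ∀ y ∈ S, ‖y‖ ^ 2 < n ^ 2 := fun y hy => by linarith [hy.2]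
  have hcont : ContinuousOn (fun p : Euc N × ℝ => u p.1 p.2 - W p) (S ×ˢ Icc τ' T) := by
    apply ContinuousOn.sub
    · exact fun p hp => (sol_cda h p.1 (lt_of_lt_of_le hτ'0 hp.2.1)).continuousAt.continuousWithinAt
    · simp only [hW]
      apply ContinuousOn.add
      · apply Continuous.continuousOn
        apply Continuous.mul (by fun_prop)
        refine Continuous.rpow_const (by fun_prop) fun p => Or.inl (by positivity)
      · apply ContinuousOn.mul continuousOn_const
        refine ContinuousOn.rpow_const (by fun_prop) fun p hp => Or.inl ?_
        have := hSlt p.1 hp.1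
        linarith
  have hmem0 : (y0, t0) ∈ S ×ˢ Icc τ' T := ⟨⟨hy0, by linarith⟩, hτ'2.le, ht0T⟩
  obtain ⟨⟨y1, t1⟩, hp1, hmax⟩ := hCc.exists_isMaxOn ⟨_, hmem0⟩ hcont
  have hge : m0 ≤ u y1 t1 - W (y1, t1) := hmax hmem0
  have hy1 : y1 ∈ S := hp1.1
  have ht1 : t1 ∈ Icc τ' T := hp1.2
  have ht10 : 0 < t1 := lt_of_lt_of_le hτ'0 ht1.1
  have hy1lt := hSlt y1 hy1
  have hWp := hWnn (y1, t1) hy1lt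
  have hne1 : r < ‖y1‖ := by
    refine lt_of_le_of_ne hy1.1 fun he => ?_
    have h1 := hA y1 (by simp [he]) t1 ht10 ht1.2
    have hk : 0 ≤ κ * (n ^ 2 - ‖y1‖ ^ 2) ^ (-a) := by
      have : 0 < n ^ 2 - ‖y1‖ ^ 2 := by linarith
      positivity
    have h2 : A0 ≤ B * exp (μ * t1) * (1 + ‖y1‖ ^ 2) ^ (-m) := by
      rw [← he, hB, rpow_neg (by positivity)]
      have : 1 ≤ exp (μ * t1) := one_le_exp (by positivity)
      field_simp
      nlinarith
    simp only [hW] at hge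
    linarith
  have hne2 : ‖y1‖ ^ 2 < n ^ 2 - γ := by
    refine lt_of_le_of_ne hy1.2 fun he => ?_
    have h1 := hU y1 (hSE hy1) t1 ht1
    have h2 : 0 ≤ B * exp (μ * t1) * (1 + ‖y1‖ ^ 2) ^ (-m) := by positivity
    have : n ^ 2 - ‖y1‖ ^ 2 = γ := by linarith
    simp only [hW, this] at hge
    linarith
  have hne3 : τ' < t1 := by
    refine lt_of_le_of_ne ht1.1 fun he => ?_
    have := hsm t1 ht10 (by linarith) y1 (hSE hy1)
    linarith
  -- derivatives
  have hX : 0 < n ^ 2 - ‖y1‖ ^ 2 := by linarith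
  have hdt : HasDerivAt (fun s => W (y1, s)) (B * (exp (μ * t1) * μ) * (1 + ‖y1‖ ^ 2) ^ (-m)) t1 := by
    simp only [hW]
    have := (((hasDerivAt_id t1).const_mul μ).exp.const_mul B).mul_const ((1 + ‖y1‖ ^ 2) ^ (-m))
    have := this.add_const (κ * (n ^ 2 - ‖y1‖ ^ 2) ^ (-a))
    simpa using this
  have hut : HasDerivAt (u y1) (deriv (u y1) t1) t1 :=
    ((slice_t (sol_cda h y1 ht10)).differentiableAt (by norm_num)).hasDerivAt
  have hT := deriv_nonneg_left (hut.sub hdt) hne3 (fun s hs => by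
    exact hmax (show (y1, s) ∈ S ×ˢ Icc τ' T from ⟨hy1, hs.1, hs.2.trans ht1.2⟩))
  have hcg : ContDiffAt ℝ 2 (fun y : Euc N => (1 + ‖y‖ ^ 2) ^ (-m)) y1 :=
    (contDiffAt_const.add (contDiff_norm_sq ℝ).contDiffAt).rpow_const_of_ne
      (by positivity)
  have hck : ContDiffAt ℝ 2 (fun y : Euc N => (n ^ 2 - ‖y‖ ^ 2) ^ (-a)) y1 :=
    (contDiffAt_const.sub (contDiff_norm_sq ℝ).contDiffAt).rpow_const_of_ne hX.ne'
  have hcu := slice_x (sol_cda h y1 ht10)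
  set f1 : Euc N → ℝ := fun y => (-(B * exp (μ * t1))) * (1 + ‖y‖ ^ 2) ^ (-m) with hf1
  set f2 : Euc N → ℝ := fun y => (-κ) * (n ^ 2 - ‖y‖ ^ 2) ^ (-a) with hf2
  have hcf1 : ContDiffAt ℝ 2 f1 y1 := contDiffAt_const.mul hcg
  have hcf2 : ContDiffAt ℝ 2 f2 y1 := contDiffAt_const.mul hck
  have hlm : IsLocalMax (fun y => u y t1 + (f1 y + f2 y)) y1 := by
    have o1 : ∀ᶠ y in nhds y1, r < ‖y‖ := continuous_norm.continuousAt.eventually (lt_mem_nhds hne1)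
    have o2 : ∀ᶠ y in nhds y1, ‖y‖ ^ 2 < n ^ 2 - γ :=
      (continuous_norm.pow 2).continuousAt.eventually (gt_mem_nhds hne2)
    filter_upwards [o1, o2] with y h1 h2
    have := hmax (show (y, t1) ∈ S ×ˢ Icc τ' T from ⟨⟨h1.le, h2.le⟩, ht1⟩)
    simp only [hW, hf1, hf2] at this ⊢
    simp only [mem_ofPred_eq] at this
    linarith
  have hlap := lapl_nonpos_of_max hlm (hcu.add (hcf1.add hcf2))
  have hcm : ∀ (k : ℝ) (f : Euc N → ℝ), ContDiffAt ℝ 2 f y1 → lapl (fun y => k * f y) y1 = k * lapl f y1 := by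
    intro k f hf
    rw [lapl_mul contDiffAt_const hf]
    have : lapl (fun _ : Euc N => k) y1 = 0 := by simp [lapl]
    simp [this, dd]
  rw [lapl_add hcu (hcf1.add hcf2), lapl_add hcf1 hcf2, hf1, hf2, hcm _ _ hcg, hcm _ _ hck] at hlap
  have e1 := lapl_g (N := N) m hm y1
  have e2 := lapl_k (N := N) a n ha0 y1 hy1lt
  have heq := h.2.2.1 y1 t1 ht10
  have hBe : 0 < B * exp (μ * t1) := by positivity
  have e1' := mul_le_mul_of_nonneg_left e1 hBe.le
  have e2' := mul_le_mul_of_nonneg_left e2 hκ0.le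
  set Y := (n ^ 2 - ‖y1‖ ^ 2) with hY
  have e3 : κ * ((2 * a * N + 4 * a * (a + 1)) * n ^ 2 * Y ^ (-a - 2)) ≤ (κ * Y ^ (-a)) ^ q := by
    rw [mul_rpow hκ0.le (by positivity), ← rpow_mul hX.le, hκ, mul_rpow hc.le (by positivity), ← rpow_mul hn0.le]
    have haq : a * q = a + 2 := by rw [ha]; field_simp; ring
    rw [show -a * q = -a - 2 by linarith, haq]
    have : n ^ (a + 2) = n ^ a * n ^ 2 := by rw [← rpow_natCast n 2, ← rpow_add hn0]; norm_num
    rw [this]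
    have : c ^ q = c * c ^ (q - 1) := by
      rw [mul_comm, ← rpow_add_one hc.ne']; congr 1; ring
    rw [this]
    have hpos : 0 < c * n ^ a * n ^ 2 * Y ^ (-a - 2) := by positivity
    have := mul_le_mul_of_nonneg_left hcB hpos.le
    linarith
  have e4 : (κ * Y ^ (-a)) ^ q ≤ W (y1, t1) ^ q := by
    apply rpow_le_rpow (by positivity) _ (by linarith)
    simp only [hW]
    have : 0 ≤ B * exp (μ * t1) * (1 + ‖y1‖ ^ 2) ^ (-m) := by positivity
    linarith
  have e5 : W (y1, t1) ^ q < u y1 t1 ^ q := rpow_lt_rpow hWp.le (by linarith) (by linarith)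
  have e6 : κ * (n ^ 2 - ‖y1‖ ^ 2) ^ (-a) = κ * Y ^ (-a) := rfl
  have e7 : B * (exp (μ * t1) * μ) * (1 + ‖y1‖ ^ 2) ^ (-m) = B * exp (μ * t1) * (μ * (1 + ‖y1‖ ^ 2) ^ (-m)) := by ring
  linarith

theorem decay {N : ℕ} {q : ℝ} (hq : 1 < q) {u : Euc N → ℝ → ℝ} {K : Set (Euc N)} (h : IsSol N q u K)
    {r : ℝ} (hr : 0 < r) (hK : K ⊆ ball 0 r) (T : ℝ) :
    ∃ A > 0, ∀ y : Euc N, r ≤ ‖y‖ → ∀ t, 0 < t → t ≤ T → u y t ≤ A * (1 + ‖y‖ ^ 2) ^ (-((N : ℝ) + 1) / 2) := by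
  obtain ⟨A0, hA0, hA⟩ := sol_bdd' h (isCompact_sphere (0 : Euc N) r)
    (fun y hy hyK => by have := hK hyK; simp at this hy; linarith) T
  have hq1 : 0 < q - 1 := by linarith
  set a := 2 / (q - 1) with ha
  have ha0 : 0 < a := by positivity
  set D := 2 * a * N + 4 * a * (a + 1) with hD
  have hD0 : 0 < D := by positivity
  set c := D ^ (1 / (q - 1)) with hc
  have hc0 : 0 < c := by positivity
  have hcD : D ≤ c ^ (q - 1) := by
    rw [hc, ← rpow_mul hD0.le, one_div, inv_mul_cancel₀ hq1.ne', rpow_one]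
  set m := ((N : ℝ) + 1) / 2 with hm
  have hm0 : 0 < m := by positivity
  refine ⟨A0 * (1 + r ^ 2) ^ m * exp (4 * m * (m + 1) * T), by positivity, fun y hy t ht htT => ?_⟩
  rw [show -((N : ℝ) + 1) / 2 = -m by rw [hm]; ring]
  have hlim : Tendsto (fun n : ℝ => A0 * (1 + r ^ 2) ^ m * exp (4 * m * (m + 1) * T) * (1 + ‖y‖ ^ 2) ^ (-m)
     + c * 2 ^ a * n ^ (-a)) atTop (nhds (A0 * (1 + r ^ 2) ^ m * exp (4 * m * (m + 1) * T) * (1 + ‖y‖ ^ 2) ^ (-m) + c * 2 ^ a * 0)) :=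
    tendsto_const_nhds.add ((tendsto_rpow_neg_atTop ha0).const_mul _)
  rw [mul_zero, add_zero] at hlim
  refine ge_of_tendsto hlim ?_
  filter_upwards [eventually_gt_atTop (2 * ‖y‖)] with n hn
  have hy0 : 0 < ‖y‖ := by linarith
  have hn0 : 0 < n := by linarith
  refine (barrier hq h hr hK hA0 hA hm0 hc0 ha hcD (n := n) (by linarith) hy (by linarith) ht htT).trans ?_
  gcongr ?_ + ?_
  · gcongr
  · have h1 : n ^ 2 / 2 ≤ n ^ 2 - ‖y‖ ^ 2 := by nlinarith
    have h2 : (n ^ 2 - ‖y‖ ^ 2) ^ (-a) ≤ (n ^ 2 / 2) ^ (-a) :=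
      rpow_le_rpow_of_nonpos (by positivity) h1 (by linarith)
    calc c * n ^ a * (n ^ 2 - ‖y‖ ^ 2) ^ (-a) ≤ c * n ^ a * (n ^ 2 / 2) ^ (-a) := by gcongr
      _ = c * 2 ^ a * n ^ (-a) := by
        rw [rpow_neg (by positivity), div_rpow (by positivity) (by norm_num), rpow_neg hn0.le, ← rpow_natCast n 2, ← rpow_mul hn0.le, show ((2:ℕ):ℝ) * a = a + a by push_cast; ring, rpow_add hn0]
        field_simp

/-- decay weight -/
def gw (N : ℕ) (y : Euc N) : ℝ := (1 + ‖y‖ ^ 2) ^ (-((N : ℝ) + 1) / 2)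

theorem gw_pos {N : ℕ} (y : Euc N) : 0 < gw N y := by unfold gw; positivity

theorem gw_le_one {N : ℕ} (y : Euc N) : gw N y ≤ 1 := by
  unfold gw
  apply rpow_le_one_of_one_le_of_nonpos
  · nlinarith [sq_nonneg ‖y‖]
  · have : (0:ℝ) ≤ N := by positivity
    linarith

theorem gw_int (N : ℕ) : Integrable (gw N) := by
  unfold gw
  exact integrable_rpow_neg_one_add_norm_sq (E := Euc N) (r := (N : ℝ) + 1) (by simp)

theorem gw_cont (N : ℕ) : Continuous (gw N) := by
  unfold gw
  exact Continuous.rpow_const (by fun_prop) fun y => Or.inl (by positivity)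

theorem decay_all {N : ℕ} {q : ℝ} (hq : 1 < q) {u : Euc N → ℝ → ℝ} {K : Set (Euc N)} (h : IsSol N q u K)
    {r : ℝ} (hr : 0 < r) (hK : K ⊆ ball 0 r) {τ T : ℝ} (hτ : 0 < τ) :
    ∃ A > 0, ∀ y : Euc N, ∀ t ∈ Icc τ T, u y t ≤ A * gw N y := by
  obtain ⟨A1, hA1, h1⟩ := decay hq h hr hK T
  obtain ⟨A2, hA2, h2⟩ := sol_bdd h (isCompact_closedBall (0 : Euc N) r) (T := T) hτ
  set b := (1 + r ^ 2) ^ (-((N : ℝ) + 1) / 2) with hb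
  have hb0 : 0 < b := by positivity
  refine ⟨max A1 (A2 / b), by positivity, fun y t ht => ?_⟩
  rcases le_or_gt r ‖y‖ with hy | hy
  · refine (h1 y hy t (lt_of_lt_of_le hτ ht.1) ht.2).trans ?_
    exact mul_le_mul_of_nonneg_right (le_max_left _ _) (gw_pos y).le
  · have hg : b ≤ gw N y := by
      unfold gw
      apply rpow_le_rpow_of_nonpos (by positivity) (by gcongr)
      have : (0:ℝ) ≤ N := by positivity
      linarith
    calc u y t ≤ A2 := h2 y (by simpa using hy.le) t ht
      _ = A2 / b * b := by field_simp
      _ ≤ max A1 (A2 / b) * gw N y := by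
        apply mul_le_mul (le_max_right _ _) hg hb0.le (by positivity)

theorem strans_facts : ∃ (S1 S2 : ℝ → ℝ) (C : ℝ), 0 < C ∧ (∀ z, HasDerivAt smoothTransition (S1 z) z) ∧
    (∀ z, HasDerivAt S1 (S2 z) z) ∧ (∀ z, |S1 z| ≤ C ∧ |S2 z| ≤ C) ∧
    (∀ z, z ∉ Icc (0:ℝ) 1 → S1 z = 0 ∧ S2 z = 0) ∧ Continuous S1 ∧ Continuous S2 := by
  have hc : ContDiff ℝ 2 smoothTransition := smoothTransition.contDiff
  have hc1 : ContDiff ℝ 1 (deriv smoothTransition) := ((contDiff_succ_iff_deriv (n := 1)).1 (by rw [one_add_one_eq_two]; exact hc)).2.2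
  have hc2 : Continuous (deriv (deriv smoothTransition)) := hc1.continuous_deriv (by norm_num)
  have hz : ∀ z, z ∉ Icc (0:ℝ) 1 → deriv smoothTransition z = 0 := by
    intro z hz
    rcases lt_or_ge z 0 with h0 | h0
    · have : smoothTransition =ᶠ[nhds z] fun _ => 0 := by
        filter_upwards [gt_mem_nhds h0] with w hw using smoothTransition.zero_of_nonpos hw.le
      rw [this.deriv_eq]; simp
    · have h1 : 1 < z := by by_contra hh; exact hz ⟨h0, by linarith⟩
      have : smoothTransition =ᶠ[nhds z] fun _ => 1 := by
        filter_upwards [lt_mem_nhds h1] with w hw using smoothTransition.one_of_one_le hw.le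
      rw [this.deriv_eq]; simp
  have hz2 : ∀ z, z ∉ Icc (0:ℝ) 1 → deriv (deriv smoothTransition) z = 0 := by
    intro z hzz
    have : deriv smoothTransition =ᶠ[nhds z] fun _ => 0 := by
      filter_upwards [isClosed_Icc.isOpen_compl.mem_nhds hzz] with w hw using hz w hw
    rw [this.deriv_eq]; simp
  obtain ⟨C1, hC1⟩ := isCompact_Icc.exists_bound_of_continuousOn (s := Icc (0:ℝ) 1) hc1.continuous.continuousOn
  obtain ⟨C2, hC2⟩ := isCompact_Icc.exists_bound_of_continuousOn (s := Icc (0:ℝ) 1) hc2.continuousOn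
  refine ⟨deriv smoothTransition, deriv (deriv smoothTransition), max 1 (max C1 C2), by positivity,
    fun z => (hc.differentiable (by norm_num) z).hasDerivAt, fun z => (hc1.differentiable (by norm_num) z).hasDerivAt, ?_, fun z h => ⟨hz z h, hz2 z h⟩, hc1.continuous, hc2⟩
  intro z
  by_cases h : z ∈ Icc (0:ℝ) 1
  · exact ⟨(hC1 z h).trans (by simp), (hC2 z h).trans (by simp)⟩
  · rw [hz z h, hz2 z h]; simp

theorem cutoff_facts (N : ℕ) : ∃ C > 0, ∀ n : ℝ, 1 ≤ n → ∃ ξ : Euc N → ℝ, ContDiff ℝ 2 ξ ∧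
    (∀ y, 0 ≤ ξ y ∧ ξ y ≤ 1) ∧ (∀ y, ‖y‖ < n → ξ y = 1 ∧ lapl ξ y = 0 ∧ ∀ i, dd i ξ y = 0) ∧
    (∀ y, 2 * n ≤ ‖y‖ → ξ y = 0) ∧ (∀ y, |lapl ξ y| ≤ C ∧ ∀ i, |dd i ξ y| ≤ C) := by
  obtain ⟨S1, S2, C, hC, h1, h2, hb, hz, -, -⟩ := strans_facts
  refine ⟨8 * C + 2 * N * C, by positivity, fun n hn => ?_⟩
  have hn0 : 0 < n := by linarith
  have hP : ∀ w : ℝ, HasDerivAt (fun w => 1 - smoothTransition (w / n ^ 2 - 1)) (-(S1 (w / n ^ 2 - 1) * (1 / n ^ 2))) w := fun w => by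
    have := ((h1 (w / n ^ 2 - 1)).comp w (((hasDerivAt_id w).div_const (n ^ 2)).sub_const 1)).const_sub 1
    simpa [Function.comp_def] using this
  have hP1 : ∀ w : ℝ, HasDerivAt (fun w => -(S1 (w / n ^ 2 - 1) * (1 / n ^ 2))) (-(S2 (w / n ^ 2 - 1) * (1 / n ^ 2) * (1 / n ^ 2))) w := fun w => by
    have := (((h2 (w / n ^ 2 - 1)).comp w (((hasDerivAt_id w).div_const (n ^ 2)).sub_const 1)).mul_const (1 / n ^ 2)).fun_neg
    simpa [Function.comp_def] using this
  have hlap : ∀ y : Euc N, lapl (fun y : Euc N => 1 - smoothTransition (‖y‖ ^ 2 / n ^ 2 - 1)) y = _ := fun y =>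
    lapl_rad0 y (Eventually.of_forall hP) (hP1 _)
  have hdd : ∀ (i : Fin N) (y : Euc N), dd i (fun y : Euc N => 1 - smoothTransition (‖y‖ ^ 2 / n ^ 2 - 1)) y = _ := fun i y =>
    dd_rad0 i y (hP _)
  refine ⟨fun y => 1 - smoothTransition (‖y‖ ^ 2 / n ^ 2 - 1), ?_, ?_, ?_, ?_, ?_⟩
  · exact contDiff_const.sub (smoothTransition.contDiff.comp (((contDiff_norm_sq ℝ).div_const _).sub contDiff_const))
  · intro y
    have := smoothTransition.nonneg (‖y‖ ^ 2 / n ^ 2 - 1)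
    have := smoothTransition.le_one (‖y‖ ^ 2 / n ^ 2 - 1)
    constructor <;> linarith
  · intro y hy
    have hlt : ‖y‖ ^ 2 / n ^ 2 - 1 < 0 := by
      rw [sub_neg, div_lt_one (by positivity)]; gcongr
    have hni : ‖y‖ ^ 2 / n ^ 2 - 1 ∉ Icc (0:ℝ) 1 := fun h => by linarith [h.1]
    refine ⟨?_, ?_, fun i => ?_⟩
    · simp [smoothTransition.zero_of_nonpos hlt.le]
    · rw [hlap, (hz _ hni).1, (hz _ hni).2]; simp
    · rw [hdd, (hz _ hni).1]; simp
  · intro y hy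
    have : 1 ≤ ‖y‖ ^ 2 / n ^ 2 - 1 := by
      have : 2 ≤ ‖y‖ ^ 2 / n ^ 2 := by rw [le_div_iff₀ (by positivity)]; nlinarith
      linarith
    simp [smoothTransition.one_of_one_le this]
  · intro y
    have hCN : 0 ≤ 8 * C + 2 * N * C := by positivity
    by_cases hin : ‖y‖ ^ 2 / n ^ 2 - 1 ∈ Icc (0:ℝ) 1
    · have hle : ‖y‖ ^ 2 / n ^ 2 ≤ 2 := by linarith [hin.2]
      obtain ⟨b1, b2⟩ := hb (‖y‖ ^ 2 / n ^ 2 - 1)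
      have hinv : 1 / n ^ 2 ≤ 1 := by rw [div_le_one (by positivity)]; nlinarith
      have hinv0 : 0 ≤ 1 / n ^ 2 := by positivity
      constructor
      · rw [hlap]
        calc _ ≤ |S2 (‖y‖ ^ 2 / n ^ 2 - 1)| * (1 / n ^ 2) * (4 * (‖y‖ ^ 2 / n ^ 2)) + |S1 (‖y‖ ^ 2 / n ^ 2 - 1)| * (1 / n ^ 2) * (2 * N) := by
              refine (abs_add_le _ _).trans (le_of_eq ?_)
              simp only [abs_mul, abs_neg, abs_of_nonneg hinv0, Nat.abs_ofNat, Nat.abs_cast, abs_pow, abs_norm]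
              ring
          _ ≤ C * 1 * (4 * 2) + C * 1 * (2 * N) := by gcongr
          _ = _ := by ring
      · intro i
        rw [hdd]
        have hyi : |y i| ≤ ‖y‖ := by simpa using PiLp.norm_apply_le y i
        have hyn : ‖y‖ ≤ 2 * n := by
          have : ‖y‖ ^ 2 ≤ 2 * n ^ 2 := by rwa [div_le_iff₀ (by positivity)] at hle
          nlinarith [norm_nonneg y]
        calc _ = |S1 (‖y‖ ^ 2 / n ^ 2 - 1)| * (1 / n ^ 2 * (2 * |y i|)) := by
              simp only [abs_mul, abs_neg, abs_of_nonneg hinv0, Nat.abs_ofNat]; ring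
          _ ≤ C * (1 / n ^ 2 * (2 * (2 * n))) := by gcongr; linarith
          _ = C * (4 / n) := by field_simp; ring
          _ ≤ C * 4 := by gcongr; rw [div_le_iff₀ hn0]; linarith
          _ ≤ _ := by have : 0 ≤ (N:ℝ) * C := by positivity
                      linarith
    · rw [hlap]
      simp only [hdd, (hz _ hin).1, (hz _ hin).2]
      simp [hCN]

/-- slab measure -/
def slab (N : ℕ) (τ T : ℝ) : Measure (Euc N × ℝ) := (volume : Measure (Euc N)).prod (volume.restrict (Ioc τ T))

theorem slab_eq (N : ℕ) (τ T : ℝ) : slab N τ T = volume.restrict (univ ×ˢ Ioc τ T) := by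
  unfold slab
  rw [Measure.volume_eq_prod, ← Measure.prod_restrict, Measure.restrict_univ]

theorem slab_ae {N : ℕ} {τ T : ℝ} : ∀ᵐ p ∂(slab N τ T), p.2 ∈ Ioc τ T := by
  rw [slab_eq]
  filter_upwards [ae_restrict_mem (MeasurableSet.univ.prod measurableSet_Ioc)] with p hp using hp.2

theorem slab_aesm {N : ℕ} {τ T : ℝ} {G : Euc N × ℝ → ℝ}
    (hG : ∀ p : Euc N × ℝ, p.2 ∈ Icc τ T → ContinuousAt G p) : AEStronglyMeasurable G (slab N τ T) := by
  rw [slab_eq]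
  apply ContinuousOn.aestronglyMeasurable _ (MeasurableSet.univ.prod measurableSet_Ioc)
  intro p hp
  exact (hG p (Ioc_subset_Icc_self hp.2)).continuousWithinAt

theorem slab_fst_int {N : ℕ} {τ T : ℝ} {g : Euc N → ℝ} (hg : Integrable g) :
    Integrable (fun p : Euc N × ℝ => g p.1) (slab N τ T) := by
  unfold slab
  have := hg.mul_prod (ν := volume.restrict (Ioc τ T)) (g := fun _ => (1:ℝ)) (integrable_const _)
  simpa using this

theorem slab_int {N : ℕ} {τ T : ℝ} {G : Euc N × ℝ → ℝ}
    (hG : ∀ p : Euc N × ℝ, p.2 ∈ Icc τ T → ContinuousAt G p) {g : Euc N → ℝ} (hg : Integrable g)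
    (hb : ∀ p : Euc N × ℝ, p.2 ∈ Icc τ T → |G p| ≤ g p.1) : Integrable G (slab N τ T) := by
  refine (slab_fst_int hg).mono' (slab_aesm hG) ?_
  filter_upwards [slab_ae] with p hp using hb p (Ioc_subset_Icc_self hp)

theorem slab_int_cpt {N : ℕ} {τ T : ℝ} {G : Euc N × ℝ → ℝ}
    (hG : ∀ p : Euc N × ℝ, p.2 ∈ Icc τ T → ContinuousAt G p) {n : ℝ}
    (hb : ∀ p : Euc N × ℝ, n < ‖p.1‖ → G p = 0) : Integrable G (slab N τ T) := by
  have hc : IsCompact (closedBall (0:Euc N) n ×ˢ Icc τ T) := (isCompact_closedBall _ _).prod isCompact_Icc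
  obtain ⟨B, hB⟩ := hc.exists_bound_of_continuousOn (f := G)
    (fun p hp => (hG p hp.2).continuousWithinAt)
  refine slab_int hG (g := (closedBall (0:Euc N) n).indicator fun _ => B) ?_ ?_
  · exact (integrable_indicator_iff measurableSet_closedBall).2
      (integrableOn_const (isCompact_closedBall _ _).measure_lt_top.ne)
  · intro p hp
    by_cases h : p.1 ∈ closedBall (0:Euc N) n
    · rw [indicator_of_mem h]; exact hB p ⟨h, hp⟩
    · rw [indicator_of_notMem h, hb p (by simpa using h)]; simp

theorem green {N : ℕ} {f g : Euc N → ℝ} (hf : ContDiff ℝ 2 f) (hg : ContDiff ℝ 2 g) (hs : HasCompactSupport g) :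
    Integrable (fun y => lapl f y * g y) ∧ Integrable (fun y => f y * lapl g y) ∧
    ∫ y, lapl f y * g y = ∫ y, f y * lapl g y := by
  have c1 : ∀ {h : Euc N → ℝ} (i : Fin N), ContDiff ℝ 2 h → ContDiff ℝ 1 (dd i h) := fun i h =>
    contDiff_iff_contDiffAt.2 fun x => dd_contDiffAt i h.contDiffAt (by norm_num)
  have c2 : ∀ {h : Euc N → ℝ} (i : Fin N), ContDiff ℝ 1 h → Continuous (dd i h) := fun i h =>
    (contDiff_iff_contDiffAt.2 fun x => dd_contDiffAt (m := 0) i h.contDiffAt (by norm_num)).continuous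
  have s1 : ∀ {h : Euc N → ℝ} (i : Fin N), HasCompactSupport h → HasCompactSupport (dd i h) := fun i h =>
    h.fderiv_apply (𝕜 := ℝ) _
  have I : ∀ {a b : Euc N → ℝ}, Continuous a → Continuous b → HasCompactSupport b → Integrable fun y => a y * b y :=
    fun ha hb hc => (ha.mul hb).integrable_of_hasCompactSupport hc.mul_left
  have I' : ∀ {a b : Euc N → ℝ}, Continuous a → Continuous b → HasCompactSupport b → Integrable fun y => b y * a y :=
    fun ha hb hc => (hb.mul ha).integrable_of_hasCompactSupport hc.mul_right
  have e1 : ∀ i : Fin N, ∫ y, dd i (dd i f) y * g y = - ∫ y, dd i f y * dd i g y := fun i => by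
    have := integral_mul_fderiv_eq_neg_fderiv_mul_of_integrable (𝕜 := ℝ) (μ := (volume : Measure (Euc N))) (f := dd i f) (g := g) (v := EuclideanSpace.single i 1)
      (I (c2 i (c1 i hf)) hg.continuous hs) (I (c1 i hf).continuous (c1 i hg).continuous (s1 i hs))
      (I (c1 i hf).continuous hg.continuous hs)
      (fun x _ => (c1 i hf).differentiable (by norm_num) x) (fun x _ => hg.differentiable (by norm_num) x)
    rw [eq_neg_iff_add_eq_zero, add_comm, ← eq_neg_iff_add_eq_zero]
    exact this
  have e2 : ∀ i : Fin N, ∫ y, f y * dd i (dd i g) y = - ∫ y, dd i f y * dd i g y := fun i => by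
    have := integral_mul_fderiv_eq_neg_fderiv_mul_of_integrable (𝕜 := ℝ) (μ := (volume : Measure (Euc N))) (f := f) (g := dd i g) (v := EuclideanSpace.single i 1)
      (I (c1 i hf).continuous (c1 i hg).continuous (s1 i hs))
      (I hf.continuous (c2 i (c1 i hg)) (s1 i (s1 i hs))) 
      (I hf.continuous (c1 i hg).continuous (s1 i hs))
      (fun x _ => hf.differentiable (by norm_num) x) (fun x _ => (c1 i hg).differentiable (by norm_num) x)
    exact this
  have i1 : ∀ i : Fin N, Integrable fun y => dd i (dd i f) y * g y := fun i => I (c2 i (c1 i hf)) hg.continuous hs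
  have i2 : ∀ i : Fin N, Integrable fun y => f y * dd i (dd i g) y := fun i =>
    I hf.continuous (c2 i (c1 i hg)) (s1 i (s1 i hs))
  simp only [lapl_eq, Finset.sum_mul, Finset.mul_sum]
  refine ⟨integrable_finsetSum _ fun i _ => i1 i, integrable_finsetSum _ fun i _ => i2 i, ?_⟩
  rw [integral_finsetSum _ fun i _ => i1 i, integral_finsetSum _ fun i _ => i2 i]
  exact Finset.sum_congr rfl fun i _ => by rw [e1, e2]

theorem weak_cpt {N : ℕ} {q : ℝ} (hq : 1 < q) {u : Euc N → ℝ → ℝ} {K : Set (Euc N)} (h : IsSol N q u K)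
    {τ T : ℝ} (hτ : 0 < τ) (hT : τ ≤ T) {V : Euc N → ℝ → ℝ}
    (hV : ∀ y, ∀ s ∈ Icc τ T, ContDiffAt ℝ 2 (fun p : Euc N × ℝ => V p.1 p.2) (y, s)) {n : ℝ}
    (hn : ∀ y s, n ≤ ‖y‖ → V y s = 0) :
    (∫ y, u y T * V y T) - ∫ y, u y τ * V y τ =
      ∫ p, (u p.1 p.2 * (deriv (V p.1) p.2 + lapl (fun y => V y p.2) p.1) - u p.1 p.2 ^ q * V p.1 p.2) ∂(slab N τ T) := by
  have hu : ∀ y, ∀ s ∈ Icc τ T, ContDiffAt ℝ 2 (fun p : Euc N × ℝ => u p.1 p.2) (y, s) :=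
    fun y s hs => sol_cda h y (hτ.trans_le hs.1)
  have hV0 : ∀ p : Euc N × ℝ, n < ‖p.1‖ → V p.1 p.2 = 0 := fun p hp => hn _ _ hp.le
  have hVd : ∀ p : Euc N × ℝ, n < ‖p.1‖ → deriv (V p.1) p.2 = 0 := fun p hp => by
    have : V p.1 = fun _ => 0 := funext fun s => hn _ _ hp.le
    rw [this]; simp
  have hVl : ∀ p : Euc N × ℝ, n < ‖p.1‖ → lapl (fun y => V y p.2) p.1 = 0 := fun p hp => by
    have : (fun y => V y p.2) =ᶠ[nhds p.1] fun _ => 0 := by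
      filter_upwards [(isOpen_lt continuous_const continuous_norm).mem_nhds hp] with y hy using hn _ _ (le_of_lt hy)
    rw [lapl_congr this]; simp [lapl]
  have cu : ∀ p : Euc N × ℝ, p.2 ∈ Icc τ T → ContinuousAt (fun p : Euc N × ℝ => u p.1 p.2) p :=
    fun p hp => (hu p.1 p.2 hp).continuousAt
  have cV : ∀ p : Euc N × ℝ, p.2 ∈ Icc τ T → ContinuousAt (fun p : Euc N × ℝ => V p.1 p.2) p :=
    fun p hp => (hV p.1 p.2 hp).continuousAt
  have cuq : ∀ p : Euc N × ℝ, p.2 ∈ Icc τ T → ContinuousAt (fun p : Euc N × ℝ => u p.1 p.2 ^ q) p :=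
    fun p hp => (cu p hp).rpow_const (Or.inr (by linarith))
  have cdu : ∀ p : Euc N × ℝ, p.2 ∈ Icc τ T → ContinuousAt (fun p : Euc N × ℝ => deriv (u p.1) p.2) p :=
    fun p hp => slice_cont_deriv (hu p.1 p.2 hp)
  have clu : ∀ p : Euc N × ℝ, p.2 ∈ Icc τ T → ContinuousAt (fun p : Euc N × ℝ => lapl (fun y => u y p.2) p.1) p :=
    fun p hp => slice_cont_lapl (hu p.1 p.2 hp)
  have cdV : ∀ p : Euc N × ℝ, p.2 ∈ Icc τ T → ContinuousAt (fun p : Euc N × ℝ => deriv (V p.1) p.2) p :=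
    fun p hp => slice_cont_deriv (hV p.1 p.2 hp)
  have clV : ∀ p : Euc N × ℝ, p.2 ∈ Icc τ T → ContinuousAt (fun p : Euc N × ℝ => lapl (fun y => V y p.2) p.1) p :=
    fun p hp => slice_cont_lapl (hV p.1 p.2 hp)
  have J1 : Integrable (fun p : Euc N × ℝ => deriv (u p.1) p.2 * V p.1 p.2 + u p.1 p.2 * deriv (V p.1) p.2) (slab N τ T) :=
    slab_int_cpt (n := n) (fun p hp => ((cdu p hp).mul (cV p hp)).add ((cu p hp).mul (cdV p hp)))
      fun p hp => by simp [hV0 p hp, hVd p hp]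
  have J2 : Integrable (fun p : Euc N × ℝ => lapl (fun y => u y p.2) p.1 * V p.1 p.2) (slab N τ T) :=
    slab_int_cpt (n := n) (fun p hp => ((clu p hp).mul (cV p hp)))
      fun p hp => by simp [hV0 p hp]
  have J3 : Integrable (fun p : Euc N × ℝ => u p.1 p.2 * lapl (fun y => V y p.2) p.1) (slab N τ T) :=
    slab_int_cpt (n := n) (fun p hp => ((cu p hp).mul (clV p hp)))
      fun p hp => by simp [hVl p hp]
  have J4 : Integrable (fun p : Euc N × ℝ => u p.1 p.2 * deriv (V p.1) p.2 - u p.1 p.2 ^ q * V p.1 p.2) (slab N τ T) :=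
    slab_int_cpt (n := n) (fun p hp => ((cu p hp).mul (cdV p hp)).sub ((cuq p hp).mul (cV p hp)))
      fun p hp => by simp [hV0 p hp, hVd p hp]
  have cpt : ∀ s, HasCompactSupport fun y => V y s := fun s =>
    HasCompactSupport.intro (isCompact_closedBall (0:Euc N) n) fun y hy => hn y s (by simp at hy; exact hy.le)
  have Cu : ∀ s ∈ Icc τ T, ContDiff ℝ 2 fun y => u y s := fun s hs =>
    contDiff_iff_contDiffAt.2 fun y => slice_x (hu y s hs)
  have CV : ∀ s ∈ Icc τ T, ContDiff ℝ 2 fun y => V y s := fun s hs =>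
    contDiff_iff_contDiffAt.2 fun y => slice_x (hV y s hs)
  have Iuv : ∀ s ∈ Icc τ T, Integrable fun y => u y s * V y s := fun s hs =>
    ((Cu s hs).continuous.mul (CV s hs).continuous).integrable_of_hasCompactSupport (cpt s).mul_left
  have ftc : ∀ y, u y T * V y T - u y τ * V y τ = ∫ s in Ioc τ T, (deriv (u y) s * V y s + u y s * deriv (V y) s) := by
    intro y
    rw [← intervalIntegral.integral_of_le hT]
    symm
    apply intervalIntegral.integral_eq_sub_of_hasDerivAt (f := fun s => u y s * V y s)
    · intro s hs
      rw [uIcc_of_le hT] at hs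
      exact ((slice_t (hu y s hs)).differentiableAt (by norm_num)).hasDerivAt.mul
        ((slice_t (hV y s hs)).differentiableAt (by norm_num)).hasDerivAt
    · apply ContinuousOn.intervalIntegrable
      intro s hs
      rw [uIcc_of_le hT] at hs
      have cc := ((cdu (y, s) hs).mul (cV (y, s) hs)).add ((cu (y, s) hs).mul (cdV (y, s) hs))
      exact (cc.comp (f := fun s : ℝ => (y, s)) (by fun_prop)).continuousWithinAt
  rw [← integral_sub (Iuv T ⟨hT, le_rfl⟩) (Iuv τ ⟨le_rfl, hT⟩)]
  simp_rw [ftc]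
  have E1 : (∫ y, ∫ s in Ioc τ T, (deriv (u y) s * V y s + u y s * deriv (V y) s)) =
      ∫ p, (deriv (u p.1) p.2 * V p.1 p.2 + u p.1 p.2 * deriv (V p.1) p.2) ∂(slab N τ T) := by
    unfold slab; rw [integral_prod _ J1]
  have E2 : (∫ p, lapl (fun y => u y p.2) p.1 * V p.1 p.2 ∂(slab N τ T)) = 
      ∫ p, u p.1 p.2 * lapl (fun y => V y p.2) p.1 ∂(slab N τ T) := by
    unfold slab
    rw [integral_prod_symm _ J2, integral_prod_symm _ J3]
    apply setIntegral_congr_fun measurableSet_Ioc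
    intro s hs
    exact (green (Cu s (Ioc_subset_Icc_self hs)) (CV s (Ioc_subset_Icc_self hs)) (cpt s)).2.2
  rw [E1]
  calc _ = ∫ p, (lapl (fun y => u y p.2) p.1 * V p.1 p.2 + (u p.1 p.2 * deriv (V p.1) p.2 - u p.1 p.2 ^ q * V p.1 p.2)) ∂(slab N τ T) := by
        apply integral_congr_ae
        filter_upwards [slab_ae] with p hp
        have := h.2.2.1 p.1 p.2 (hτ.trans hp.1)
        have e : deriv (u p.1) p.2 = lapl (fun y => u y p.2) p.1 - u p.1 p.2 ^ q := by linarith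
        rw [e]; ring
    _ = (∫ p, lapl (fun y => u y p.2) p.1 * V p.1 p.2 ∂(slab N τ T)) + ∫ p, (u p.1 p.2 * deriv (V p.1) p.2 - u p.1 p.2 ^ q * V p.1 p.2) ∂(slab N τ T) := integral_add J2 J4
    _ = _ := by
      rw [E2, ← integral_add J3 J4]
      congr 1; ext p; ring

theorem gw_rpow_le {N : ℕ} {q A : ℝ} (hq : 1 < q) (hA : 0 < A) {v : ℝ} (hv : 0 ≤ v) (y : Euc N) (h : v ≤ A * gw N y) :
    v ^ q ≤ A ^ q * gw N y := by
  calc v ^ q ≤ (A * gw N y) ^ q := rpow_le_rpow hv h (by linarith)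
    _ = A ^ q * gw N y ^ q := mul_rpow hA.le (gw_pos y).le
    _ ≤ A ^ q * gw N y := by
      gcongr
      calc gw N y ^ q ≤ gw N y ^ (1:ℝ) := rpow_le_rpow_of_exponent_ge (gw_pos y) (gw_le_one y) hq.le
        _ = _ := rpow_one _

section
variable {N : ℕ} {q : ℝ} {u : Euc N → ℝ → ℝ} {K : Set (Euc N)} {r τ T : ℝ}

theorem sol_cont (h : IsSol N q u K) {p : Euc N × ℝ} (hp : 0 < p.2) : ContinuousAt (fun p : Euc N × ℝ => u p.1 p.2) p :=
  (sol_cda h p.1 hp).continuousAt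

theorem u_int (hq : 1 < q) (h : IsSol N q u K) (hr : 0 < r) (hK : K ⊆ ball 0 r) (hτ : 0 < τ)
    {G : Euc N × ℝ → ℝ} {B : ℝ} (hG : ∀ p : Euc N × ℝ, p.2 ∈ Icc τ T → ContinuousAt G p)
    (hB : ∀ p : Euc N × ℝ, p.2 ∈ Icc τ T → |G p| ≤ B) :
    Integrable (fun p => u p.1 p.2 * G p) (slab N τ T) ∧ Integrable (fun p => u p.1 p.2 ^ q * G p) (slab N τ T) := by
  obtain ⟨A, hA, hd⟩ := decay_all hq h hr hK (T := T) hτ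
  have pos : ∀ p : Euc N × ℝ, p.2 ∈ Icc τ T → 0 < p.2 := fun p hp => hτ.trans_le hp.1
  constructor
  · refine slab_int (g := fun y => (A * gw N y) * B) (fun p hp => (sol_cont h (pos p hp)).mul (hG p hp)) (((gw_int N).const_mul _).mul_const _) fun p hp => ?_
    have hu := h.2.1 p.1 p.2 (pos p hp)
    rw [abs_mul, abs_of_pos hu]
    exact mul_le_mul (hd _ _ hp) (hB p hp) (abs_nonneg _) (by have := gw_pos p.1; positivity)
  · refine slab_int (g := fun y => (A ^ q * gw N y) * B) (fun p hp => ((sol_cont h (pos p hp)).rpow_const (Or.inr (by linarith))).mul (hG p hp)) (((gw_int N).const_mul _).mul_const _) fun p hp => ?_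
    have hu := h.2.1 p.1 p.2 (pos p hp)
    rw [abs_mul, abs_of_pos (by positivity)]
    exact mul_le_mul (gw_rpow_le hq hA hu.le _ (hd _ _ hp)) (hB p hp) (abs_nonneg _) (by have := gw_pos p.1; positivity)

theorem u_int_slice (hq : 1 < q) (h : IsSol N q u K) (hr : 0 < r) (hK : K ⊆ ball 0 r) {s : ℝ} (hs : 0 < s)
    {G : Euc N → ℝ} {B : ℝ} (hG : Continuous G)
    (hB : ∀ y, |G y| ≤ B) :
    Integrable (fun y => u y s * G y) := by
  obtain ⟨A, hA, hd⟩ := decay_all hq h hr hK (T := s) hs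
  have cu : Continuous fun y => u y s := continuous_iff_continuousAt.2 fun y => (slice_x (sol_cda h y hs)).continuousAt
  refine (((gw_int N).const_mul A).mul_const B).mono' (cu.mul hG).aestronglyMeasurable (Eventually.of_forall fun y => ?_)
  have hu := h.2.1 y s hs
  rw [norm_eq_abs, abs_mul, abs_of_pos hu]
  exact mul_le_mul (hd _ _ ⟨le_rfl, le_rfl⟩) (hB y) (abs_nonneg _) (by have := gw_pos y; positivity)

theorem weak (hq : 1 < q) (h : IsSol N q u K) (hr : 0 < r) (hK : K ⊆ ball 0 r)
    (hτ : 0 < τ) (hT : τ ≤ T) {Φ : Euc N → ℝ → ℝ} {B : ℝ}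
    (hV : ∀ y, ∀ s ∈ Icc τ T, ContDiffAt ℝ 2 (fun p : Euc N × ℝ => Φ p.1 p.2) (y, s))
    (hB : ∀ y, ∀ s ∈ Icc τ T, |Φ y s| ≤ B) (hB1 : ∀ y, ∀ s ∈ Icc τ T, ∀ i, |dd i (fun y => Φ y s) y| ≤ B)
    (hB2 : ∀ y, ∀ s ∈ Icc τ T, |deriv (Φ y) s + lapl (fun y => Φ y s) y| ≤ B) :
    (∫ y, u y T * Φ y T) - ∫ y, u y τ * Φ y τ =
      ∫ p, (u p.1 p.2 * (deriv (Φ p.1) p.2 + lapl (fun y => Φ y p.2) p.1) - u p.1 p.2 ^ q * Φ p.1 p.2) ∂(slab N τ T) := by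
  obtain ⟨A, hA, hd⟩ := decay_all hq h hr hK (T := T) hτ
  obtain ⟨C, hC, hcut⟩ := cutoff_facts N
  have hB0 : 0 ≤ B := (abs_nonneg _).trans (hB 0 τ ⟨le_rfl, hT⟩)
  choose! ξ hξc hξ01 hξ1 hξ0 hξb using hcut
  have hn1 : ∀ n : ℕ, (1:ℝ) ≤ (n:ℝ) + 1 := fun n => by simp
  set V : ℕ → Euc N → ℝ → ℝ := fun n y s => Φ y s * ξ ((n:ℝ) + 1) y with hVdef
  have hVc : ∀ n y, ∀ s ∈ Icc τ T, ContDiffAt ℝ 2 (fun p : Euc N × ℝ => V n p.1 p.2) (y, s) := fun n y s hs =>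
    (hV y s hs).mul ((hξc _ (hn1 n)).contDiffAt.comp (y, s) contDiffAt_fst)
  have hd1 : ∀ n y, ∀ s ∈ Icc τ T, deriv (V n y) s + lapl (fun y => V n y s) y = 
      ξ ((n:ℝ)+1) y * (deriv (Φ y) s + lapl (fun y => Φ y s) y) + Φ y s * lapl (ξ ((n:ℝ)+1)) y + 2 * ∑ i, dd i (fun y => Φ y s) y * dd i (ξ ((n:ℝ)+1)) y := by
    intro n y s hs
    have e1 : deriv (V n y) s = deriv (Φ y) s * ξ ((n:ℝ)+1) y :=
      (((slice_t (hV y s hs)).differentiableAt (by norm_num)).hasDerivAt.mul_const _).deriv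
    rw [e1, hVdef]
    simp only
    rw [lapl_mul (f := fun y => Φ y s) (slice_x (hV y s hs)) (hξc _ (hn1 n)).contDiffAt]
    ring
  have hid := fun n : ℕ => weak_cpt hq h hτ hT (hVc n) (n := 2 * ((n:ℝ) + 1)) (fun y s hy => by
    simp [hVdef, hξ0 _ (hn1 n) y hy])
  -- slices
  have hu0 : ∀ y, ∀ s ∈ Icc τ T, 0 < u y s := fun y s hs => h.2.1 y s (hτ.trans_le hs.1)
  have hev : ∀ y : Euc N, ∀ᶠ n : ℕ in atTop, ‖y‖ < (n:ℝ) + 1 := fun y => by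
    have := tendsto_natCast_atTop_atTop (R := ℝ)
    filter_upwards [this.eventually (eventually_gt_atTop ‖y‖)] with n hn
    linarith
  have slc : ∀ s ∈ Icc τ T, Tendsto (fun n => ∫ y, u y s * V n y s) atTop (nhds (∫ y, u y s * Φ y s)) := by
    intro s hs
    have cu : Continuous fun y => u y s := continuous_iff_continuousAt.2 fun y => (slice_x (sol_cda h y (hτ.trans_le hs.1))).continuousAt
    have cΦ : Continuous fun y => Φ y s := continuous_iff_continuousAt.2 fun y => (slice_x (hV y s hs)).continuousAt
    apply tendsto_integral_of_dominated_convergence (fun y => A * gw N y * B)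
    · intro n
      exact (cu.mul (cΦ.mul (hξc _ (hn1 n)).continuous)).aestronglyMeasurable
    · exact ((gw_int N).const_mul _).mul_const _
    · intro n
      refine Eventually.of_forall fun y => ?_
      rw [norm_eq_abs, abs_mul, abs_of_pos (hu0 y s hs)]
      refine mul_le_mul (hd _ _ hs) ?_ (abs_nonneg _) (by have := gw_pos y; positivity)
      simp only [hVdef]
      rw [abs_mul, abs_of_nonneg (hξ01 _ (hn1 n) y).1]
      calc _ ≤ B * 1 := mul_le_mul (hB y s hs) (hξ01 _ (hn1 n) y).2 (hξ01 _ (hn1 n) y).1 hB0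
        _ = B := mul_one B
    · refine Eventually.of_forall fun y => ?_
      apply tendsto_const_nhds.congr'
      filter_upwards [hev y] with n hn
      simp [hVdef, (hξ1 _ (hn1 n) y hn).1]
  have main : Tendsto (fun n => ∫ p, (u p.1 p.2 * (deriv (V n p.1) p.2 + lapl (fun y => V n y p.2) p.1) - u p.1 p.2 ^ q * V n p.1 p.2) ∂(slab N τ T)) atTop
      (nhds (∫ p, (u p.1 p.2 * (deriv (Φ p.1) p.2 + lapl (fun y => Φ y p.2) p.1) - u p.1 p.2 ^ q * Φ p.1 p.2) ∂(slab N τ T))) := by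
    apply tendsto_integral_of_dominated_convergence (fun p : Euc N × ℝ => A * gw N p.1 * (B + B * C + 2 * (N * (B * C))) + A ^ q * gw N p.1 * B)
    · intro n
      apply slab_aesm
      intro p hp
      have c := hVc n p.1 p.2 hp
      have hp0 : 0 < p.2 := hτ.trans_le hp.1
      exact ((sol_cont h hp0).mul ((slice_cont_deriv c).add (slice_cont_lapl c))).sub
        (((sol_cont h hp0).rpow_const (Or.inr (by linarith))).mul c.continuousAt)
    · exact slab_fst_int (g := fun y => A * gw N y * (B + B * C + 2 * (N * (B * C))) + A ^ q * gw N y * B)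
        ((((gw_int N).const_mul _).mul_const _).add (((gw_int N).const_mul _).mul_const _))
    · intro n
      filter_upwards [slab_ae] with p hp'
      have hp := Ioc_subset_Icc_self hp'
      have hup := hu0 p.1 p.2 hp
      have hg := gw_pos p.1
      obtain ⟨z0, z1⟩ := hξ01 _ (hn1 n) p.1
      obtain ⟨b1, b2⟩ := hξb _ (hn1 n) p.1
      rw [norm_eq_abs]
      refine (abs_sub _ _).trans ?_
      rw [abs_mul, abs_mul, abs_of_pos hup, abs_of_pos (by positivity : 0 < u p.1 p.2 ^ q)]
      refine add_le_add ?_ ?_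
      · refine mul_le_mul (hd _ _ hp) ?_ (abs_nonneg _) (by positivity)
        rw [hd1 n p.1 p.2 hp]
        refine (abs_add_le _ _).trans (add_le_add ((abs_add_le _ _).trans (add_le_add ?_ ?_)) ?_)
        · rw [abs_mul, abs_of_nonneg z0]
          calc _ ≤ 1 * B := mul_le_mul z1 (hB2 _ _ hp) (abs_nonneg _) zero_le_one
            _ = B := one_mul B
        · rw [abs_mul]; exact mul_le_mul (hB _ _ hp) b1 (abs_nonneg _) hB0
        · rw [abs_mul, abs_two]
          gcongr
          refine (Finset.abs_sum_le_sum_abs _ _).trans ?_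
          calc _ ≤ ∑ i : Fin N, B * C := Finset.sum_le_sum fun i _ => by
                rw [abs_mul]; exact mul_le_mul (hB1 _ _ hp i) (b2 i) (abs_nonneg _) hB0
            _ = _ := by simp
      · refine mul_le_mul (gw_rpow_le hq hA hup.le _ (hd _ _ hp)) ?_ (abs_nonneg _) (by positivity)
        simp only [hVdef]
        rw [abs_mul, abs_of_nonneg z0]
        calc _ ≤ B * 1 := mul_le_mul (hB _ _ hp) z1 z0 hB0
          _ = B := mul_one B
    · filter_upwards [slab_ae] with p hp'
      have hp := Ioc_subset_Icc_self hp'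
      apply tendsto_const_nhds.congr'
      filter_upwards [hev p.1] with n hn
      obtain ⟨x1, x2, x3⟩ := hξ1 _ (hn1 n) p.1 hn
      rw [hd1 n p.1 p.2 hp]
      simp [hVdef, x1, x2, x3]
  have L := (slc T ⟨hT, le_rfl⟩).sub (slc τ ⟨le_rfl, hT⟩)
  exact tendsto_nhds_unique (L.congr hid) main
end

theorem init_lim {N : ℕ} {q : ℝ} {u : Euc N → ℝ → ℝ} {K : Set (Euc N)} {r : ℝ} 
    (hq : 1 < q) (h : IsSol N q u K) (hr : 0 < r) (hK : K ⊆ ball 0 r) {U : Set (Euc N)} (hU : IsOpen U) (hKU : K ⊆ U)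
    {Ψ : Euc N → ℝ → ℝ} {τ B : ℝ} (hτ : 0 < τ) (hc : ∀ s ∈ Ioo 0 τ, Continuous fun y => Ψ y s)
    (hB : ∀ s ∈ Ioo 0 τ, ∀ y, |Ψ y s| ≤ B) (h0 : ∀ s ∈ Ioo 0 τ, ∀ y ∈ U, Ψ y s = 0) :
    Tendsto (fun s => ∫ y, u y s * Ψ y s) (nhdsWithin 0 (Ioi 0)) (nhds 0) := by
  obtain ⟨A1, hA1, h1⟩ := decay hq h hr hK τ
  obtain ⟨A2, hA2, h2⟩ := sol_bdd' h ((isCompact_closedBall (0 : Euc N) r).diff hU) (fun y hy hyK => hy.2 (hKU hyK)) τ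
  set b := (1 + r ^ 2) ^ (-((N : ℝ) + 1) / 2) with hb
  have hb0 : 0 < b := by positivity
  have hmem : Ioo 0 τ ∈ nhdsWithin (0:ℝ) (Ioi 0) := Ioo_mem_nhdsGT hτ
  have hB0 : 0 ≤ B := (abs_nonneg _).trans (hB (τ/2) ⟨by positivity, by linarith⟩ 0)
  have key : ∀ s ∈ Ioo 0 τ, ∀ y, y ∉ U → u y s ≤ max A1 (A2 / b) * gw N y := by
    intro s hs y hy
    rcases le_or_gt r ‖y‖ with hyr | hyr
    · exact (h1 y hyr s hs.1 hs.2.le).trans (mul_le_mul_of_nonneg_right (le_max_left _ _) (gw_pos y).le)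
    · have hg : b ≤ gw N y := by
        unfold gw
        apply rpow_le_rpow_of_nonpos (by positivity) (by gcongr)
        have : (0:ℝ) ≤ N := by positivity
        linarith
      calc u y s ≤ A2 := h2 y ⟨by simpa using hyr.le, hy⟩ s hs.1 hs.2.le
        _ = A2 / b * b := by field_simp
        _ ≤ max A1 (A2 / b) * gw N y := mul_le_mul (le_max_right _ _) hg hb0.le (by positivity)
  rw [show (0:ℝ) = ∫ y : Euc N, (0:ℝ) by simp]
  have e0 : nhdsWithin (∫ y : Euc N, (0:ℝ)) (Ioi (∫ y : Euc N, (0:ℝ))) = nhdsWithin (0:ℝ) (Ioi 0) := by simp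
  rw [e0]
  apply tendsto_integral_filter_of_dominated_convergence (fun y => max A1 (A2 / b) * gw N y * B)
  · filter_upwards [hmem] with s hs
    have cu : Continuous fun y => u y s := continuous_iff_continuousAt.2 fun y => (slice_x (sol_cda h y hs.1)).continuousAt
    exact (cu.mul (hc s hs)).aestronglyMeasurable
  · filter_upwards [hmem] with s hs
    refine Eventually.of_forall fun y => ?_
    have hg := gw_pos y
    have hA : 0 < max A1 (A2 / b) := by positivity
    by_cases hy : y ∈ U
    · rw [h0 s hs y hy]; simp; positivity
    · rw [norm_eq_abs, abs_mul, abs_of_pos (h.2.1 y s hs.1)]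
      exact mul_le_mul (key s hs y hy) (hB s hs y) (abs_nonneg _) (by positivity)
  · exact ((gw_int N).const_mul _).mul_const _
  · refine Eventually.of_forall fun y => ?_
    by_cases hy : y ∈ U
    · apply tendsto_const_nhds.congr'
      filter_upwards [hmem] with s hs
      rw [h0 s hs y hy]; simp
    · have t1 : Tendsto (fun s => u y s) (nhdsWithin 0 (Ioi 0)) (nhds 0) := by
        rw [Metric.tendsto_nhds]
        intro ε hε
        obtain ⟨τ', hτ', hs⟩ := sol_small h (isCompact_singleton (x := y)) (by intro z hz hzK; rw [mem_singleton_iff] at hz; exact hy (hz ▸ hKU hzK)) hε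
        filter_upwards [Ioo_mem_nhdsGT hτ'] with s hs'
        rw [dist_zero_right, norm_eq_abs, abs_of_pos (h.2.1 y s hs'.1)]
        exact hs s hs'.1 hs'.2 y rfl
      refine squeeze_zero_norm' (a := fun s => u y s * B) ?_ (by simpa using t1.mul_const B)
      filter_upwards [hmem] with s hs
      rw [norm_eq_abs, abs_mul, abs_of_pos (h.2.1 y s hs.1)]
      exact mul_le_mul_of_nonneg_left (hB s hs y) (h.2.1 y s hs.1).le

/-- heat kernel -/
def kk (N : ℕ) (z : Euc N) (t : ℝ) : ℝ := (4 * π * t) ^ (-(N : ℝ) / 2) * Real.exp (-‖z‖ ^ 2 / (4 * t))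

section
variable {N : ℕ} {t : ℝ}

theorem kk_pos (z : Euc N) (ht : 0 < t) : 0 < kk N z t := by unfold kk; positivity

theorem kk_neg (z : Euc N) (t : ℝ) : kk N (-z) t = kk N z t := by simp [kk]

theorem kk_symm (x y : Euc N) (t : ℝ) : kk N (x - y) t = kk N (y - x) t := by
  rw [← kk_neg, neg_sub]

theorem heatPot_eq (η : Euc N → ℝ) (x : Euc N) (t : ℝ) : heatPot N η x t = ∫ y, kk N (x - y) t * η y := rfl

theorem kk_cda (x y : Euc N) (ht : 0 < t) {n : WithTop ℕ∞} :
    ContDiffAt ℝ n (fun p : Euc N × ℝ => kk N (p.1 - x) p.2) (y, t) := by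
  unfold kk
  refine ContDiffAt.mul ?_ ?_
  · exact ContDiffAt.rpow_const_of_ne (contDiffAt_const.mul contDiffAt_snd) (by simp; positivity)
  · apply ContDiffAt.exp
    apply ContDiffAt.div
    · exact (((contDiffAt_fst.sub contDiffAt_const).norm_sq ℝ)).neg
    · exact contDiffAt_const.mul contDiffAt_snd
    · simp; positivity

theorem kk_cont (x : Euc N) (ht : 0 < t) : Continuous fun y => kk N (y - x) t :=
  continuous_iff_continuousAt.2 fun y => (slice_x (f := fun y t => kk N (y - x) t) (kk_cda x y ht (n := 0))).continuousAt

theorem kk_int (ht : 0 < t) : Integrable (fun y : Euc N => kk N y t) ∧ ∫ y : Euc N, kk N y t = 1 := by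
  have hb : 0 < 1 / (4 * t) := by positivity
  have e : ∀ y : Euc N, rexp (-‖y‖ ^ 2 / (4 * t)) = rexp (-(1 / (4 * t)) * ‖y‖ ^ 2) := fun y => by
    congr 1; ring
  have h1 := GaussianFourier.integral_rexp_neg_mul_sq_norm (V := Euc N) hb
  have h2 : Integrable fun y : Euc N => rexp (-(1 / (4 * t)) * ‖y‖ ^ 2) := by
    by_contra hh
    rw [integral_undef hh] at h1
    have : 0 < (π / (1 / (4 * t))) ^ ((Module.finrank ℝ (Euc N) : ℝ) / 2) := by positivity
    linarith
  unfold kk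
  simp only [e]
  refine ⟨h2.const_mul _, ?_⟩
  rw [integral_const_mul, h1]
  have : π / (1 / (4 * t)) = 4 * π * t := by field_simp
  rw [this, ← rpow_add (by positivity)]
  simp [neg_div]

theorem kk_int' (x : Euc N) (ht : 0 < t) : Integrable (fun y : Euc N => kk N (y - x) t) ∧ ∫ y : Euc N, kk N (y - x) t = 1 :=
  ⟨(kk_int ht).1.comp_sub_right x, by rw [integral_sub_right_eq_self (fun y => kk N y t) x, (kk_int ht).2]⟩

theorem kk_deriv (z : Euc N) (ht : 0 < t) :
    HasDerivAt (fun s => kk N z s) (kk N z t * (‖z‖ ^ 2 / (4 * t ^ 2) - N / (2 * t))) t := by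
  have h1 : HasDerivAt (fun s : ℝ => (4 * π * s) ^ (-(N : ℝ) / 2)) ((4 * π * 1) * (-(N : ℝ) / 2) * (4 * π * t) ^ (-(N : ℝ) / 2 - 1)) t :=
    ((hasDerivAt_id t).const_mul (4 * π)).rpow_const (Or.inl (by simp; positivity))
  have h2 : HasDerivAt (fun s : ℝ => rexp (-‖z‖ ^ 2 / (4 * s))) (rexp (-‖z‖ ^ 2 / (4 * t)) * ((0 * (4 * t) - -‖z‖ ^ 2 * (4 * 1)) / (4 * t) ^ 2)) t :=
    ((hasDerivAt_const t _).div ((hasDerivAt_id t).const_mul 4) (by simp; positivity)).exp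
  refine (h1.mul h2).congr_deriv ?_
  unfold kk
  rw [rpow_sub_one (by positivity)]
  field_simp
  ring

theorem kk_P (t : ℝ) (w : ℝ) : HasDerivAt (fun w => (4 * π * t) ^ (-(N : ℝ) / 2) * rexp (-w / (4 * t)))
    ((4 * π * t) ^ (-(N : ℝ) / 2) * rexp (-w / (4 * t)) * (-1 / (4 * t))) w := by
  have := (((hasDerivAt_id w).neg.div_const (4 * t)).exp).const_mul ((4 * π * t) ^ (-(N : ℝ) / 2))
  refine this.congr_deriv ?_
  simp; ring

theorem kk_fderiv (x y v : Euc N) (t : ℝ) :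
    fderiv ℝ (fun y => kk N (y - x) t) y v = -(kk N (y - x) t / (2 * t)) * inner ℝ (y - x) v := by
  have := fderiv_rad x y v (kk_P (N := N) t (‖y - x‖ ^ 2))
  unfold kk
  rw [this]
  rcases eq_or_ne t 0 with rfl | h
  · simp
  · field_simp; ring

theorem kk_lapl (x y : Euc N) (ht : 0 < t) :
    lapl (fun y => kk N (y - x) t) y = kk N (y - x) t * (‖y - x‖ ^ 2 / (4 * t ^ 2) - N / (2 * t)) := by
  have := lapl_rad x y (Eventually.of_forall (kk_P (N := N) t)) ((kk_P (N := N) t (‖y - x‖ ^ 2)).mul_const (-1 / (4 * t)))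
  unfold kk
  rw [this]
  field_simp; ring

/-- moment constant -/
def cm (N : ℕ) : ℝ := 9 * 2 ^ ((N : ℝ) / 2)

theorem cm_pos (N : ℕ) : 0 < cm N := by unfold cm; positivity

theorem kk_double (z : Euc N) (ht : 0 < t) :
    kk N z t = 2 ^ ((N : ℝ) / 2) * (rexp (-(‖z‖ ^ 2 / (8 * t))) * kk N z (2 * t)) := by
  unfold kk
  have e : rexp (-‖z‖ ^ 2 / (4 * t)) = rexp (-(‖z‖ ^ 2 / (8 * t))) * rexp (-‖z‖ ^ 2 / (4 * (2 * t))) := by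
    rw [← exp_add]; congr 1; field_simp; ring
  have e2 : (4 * π * (2 * t)) ^ (-(N : ℝ) / 2) = 2 ^ (-(N : ℝ) / 2) * (4 * π * t) ^ (-(N : ℝ) / 2) := by
    rw [← mul_rpow (by positivity) (by positivity)]; congr 1; ring
  have e3 : (2:ℝ) ^ ((N : ℝ) / 2) * 2 ^ (-(N : ℝ) / 2) = 1 := by
    rw [← rpow_add (by norm_num)]; simp [neg_div]
  rw [e, e2]
  linear_combination (-(rexp (-(‖z‖ ^ 2 / (8 * t))) * rexp (-‖z‖ ^ 2 / (4 * (2 * t))) * (4 * π * t) ^ (-(N : ℝ) / 2))) * e3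

theorem exp_mul_le (w : ℝ) : w * rexp (-w) ≤ 1 := by
  have := add_one_le_exp w
  rw [exp_neg, ← div_eq_mul_inv, div_le_one (exp_pos w)]; linarith

theorem kk_m0 (z : Euc N) (ht : 0 < t) : kk N z t ≤ 2 ^ ((N : ℝ) / 2) * kk N z (2 * t) := by
  rw [kk_double z ht]
  have := kk_pos z (by positivity : 0 < 2 * t)
  have : rexp (-(‖z‖ ^ 2 / (8 * t))) ≤ 1 := exp_le_one_iff.2 (by simp; positivity)
  have : rexp (-(‖z‖ ^ 2 / (8 * t))) * kk N z (2 * t) ≤ 1 * kk N z (2 * t) := by gcongr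
  rw [one_mul] at this
  gcongr

theorem kk_m2' (z : Euc N) (ht : 0 < t) : ‖z‖ ^ 2 * kk N z t ≤ 8 * t * (2 ^ ((N : ℝ) / 2) * kk N z (2 * t)) := by
  rw [kk_double z ht]
  have h1 := kk_pos z (by positivity : 0 < 2 * t)
  have h2 := exp_mul_le (‖z‖ ^ 2 / (8 * t))
  calc _ = 8 * t * (2 ^ ((N : ℝ) / 2) * ((‖z‖ ^ 2 / (8 * t) * rexp (-(‖z‖ ^ 2 / (8 * t)))) * kk N z (2 * t))) := by
        field_simp
    _ ≤ 8 * t * (2 ^ ((N : ℝ) / 2) * (1 * kk N z (2 * t))) := by gcongr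
    _ = _ := by ring

theorem kk_m2 (z : Euc N) (ht : 0 < t) : ‖z‖ ^ 2 * kk N z t ≤ cm N * t * kk N z (2 * t) := by
  have h1 := kk_pos z (by positivity : 0 < 2 * t)
  refine (kk_m2' z ht).trans ?_
  unfold cm
  have : 0 ≤ t * 2 ^ ((N : ℝ) / 2) * kk N z (2 * t) := by positivity
  linarith

theorem kk_m1 (z : Euc N) (ht : 0 < t) : ‖z‖ * kk N z t ≤ cm N * √t * kk N z (2 * t) := by
  have h1 := kk_pos z (by positivity : 0 < 2 * t)
  have h0 := kk_pos z ht
  have hs : 0 < √t := sqrt_pos.2 ht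
  have hss : √t * √t = t := mul_self_sqrt ht.le
  have : ‖z‖ ≤ √t + ‖z‖ ^ 2 / √t := by
    rw [← sub_le_iff_le_add', le_div_iff₀ hs]
    nlinarith [sq_nonneg (‖z‖ - √t), norm_nonneg z]
  calc ‖z‖ * kk N z t ≤ (√t + ‖z‖ ^ 2 / √t) * kk N z t := by gcongr
    _ = √t * kk N z t + ‖z‖ ^ 2 * kk N z t / √t := by ring
    _ ≤ √t * (2 ^ ((N : ℝ) / 2) * kk N z (2 * t)) + 8 * t * (2 ^ ((N : ℝ) / 2) * kk N z (2 * t)) / √t := by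
      gcongr ?_ + ?_ / _
      · exact mul_le_mul_of_nonneg_left (kk_m0 z ht) hs.le
      · exact kk_m2' z ht
    _ = _ := by
      have : 8 * t * (2 ^ ((N : ℝ) / 2) * kk N z (2 * t)) / √t = 8 * √t * (2 ^ ((N : ℝ) / 2) * kk N z (2 * t)) := by
        rw [div_eq_iff hs.ne', ← hss]
        rw [hss]
        linear_combination (-8 * (2 ^ ((N : ℝ) / 2) * kk N z (2 * t))) * hss
      rw [this]; unfold cm; ring

theorem kk_fd_le (x y v : Euc N) (ht : 0 < t) :
    |fderiv ℝ (fun y => kk N (y - x) t) y v| ≤ cm N / √t * kk N (y - x) (2 * t) * ‖v‖ := by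
  rw [kk_fderiv]
  have h0 := kk_pos (y - x) ht
  have h2 := kk_pos (y - x) (by positivity : 0 < 2 * t)
  have hs : 0 < √t := sqrt_pos.2 ht
  have hc := cm_pos N
  have hss : √t * √t = t := mul_self_sqrt ht.le
  rw [abs_mul, abs_neg, abs_of_pos (by positivity)]
  calc _ ≤ kk N (y - x) t / (2 * t) * (‖y - x‖ * ‖v‖) := by gcongr; exact abs_real_inner_le_norm _ _
    _ = (‖y - x‖ * kk N (y - x) t) / (2 * t) * ‖v‖ := by ring
    _ ≤ (cm N * √t * kk N (y - x) (2 * t)) / (2 * t) * ‖v‖ := by gcongr ?_ / _ * _; exact kk_m1 _ ht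
    _ = (cm N / √t * kk N (y - x) (2 * t) * ‖v‖) / 2 := by
      have : √t / t = 1 / √t := by rw [div_eq_div_iff ht.ne' hs.ne']; linarith
      linear_combination (cm N * kk N (y - x) (2 * t) / 2 * ‖v‖) * this
    _ ≤ _ := by
      have : 0 ≤ cm N / √t * kk N (y - x) (2 * t) * ‖v‖ := by positivity
      linarith

theorem kk_td_le (z : Euc N) (ht : 0 < t) :
    |kk N z t * (‖z‖ ^ 2 / (4 * t ^ 2) - N / (2 * t))| ≤ cm N * (N + 1) / t * kk N z (2 * t) := by
  have h0 := kk_pos z ht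
  have h2 := kk_pos z (by positivity : 0 < 2 * t)
  have hc := cm_pos N
  have a1 : kk N z t ≤ cm N * kk N z (2 * t) := (kk_m0 z ht).trans (by
    unfold cm
    have : 0 ≤ 2 ^ ((N : ℝ) / 2) * kk N z (2 * t) := by positivity
    linarith)
  rw [abs_mul, abs_of_pos h0]
  calc _ ≤ kk N z t * (‖z‖ ^ 2 / (4 * t ^ 2) + N / (2 * t)) := by
        gcongr
        refine (abs_sub _ _).trans (le_of_eq ?_)
        rw [abs_of_nonneg (by positivity), abs_of_nonneg (by positivity)]
    _ = (‖z‖ ^ 2 * kk N z t) / (4 * t ^ 2) + kk N z t * (N / (2 * t)) := by ring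
    _ ≤ (cm N * t * kk N z (2 * t)) / (4 * t ^ 2) + (cm N * kk N z (2 * t)) * (N / (2 * t)) := by
        gcongr ?_ / _ + ?_ * _
        exact kk_m2 z ht
    _ = cm N * (N / 2 + 1 / 4) / t * kk N z (2 * t) := by field_simp; ring
    _ ≤ _ := by
      gcongr
      · have : (0:ℝ) ≤ N := by positivity
        linarith
      · norm_num

theorem kk_le_sup (z : Euc N) (ht : 0 < t) : kk N z t ≤ (4 * π * t) ^ (-(N : ℝ) / 2) := by
  unfold kk
  have : rexp (-‖z‖ ^ 2 / (4 * t)) ≤ 1 := exp_le_one_iff.2 (by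
    rw [neg_div]; simp; positivity)
  have h : 0 ≤ (4 * π * t) ^ (-(N : ℝ) / 2) := by positivity
  nlinarith
end

section
variable {N : ℕ} {t : ℝ} {η : Euc N → ℝ}

theorem h_cda (hη : ContDiff ℝ (⊤ : ℕ∞) η) (hs : HasCompactSupport η) (x : Euc N) (ht : 0 < t) :
    ContDiffAt ℝ 2 (fun p : Euc N × ℝ => heatPot N η p.1 p.2) (x, t) := by
  have hk : IsCompact ((fun z : Euc N => -z) '' tsupport η) := hs.isCompact.image continuous_neg
  have main := contDiffOn_convolution_right_with_param (𝕜 := ℝ) (μ := (volume : Measure (Euc N))) (n := 2)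
    (f := fun _ : Euc N => (1:ℝ)) (ContinuousLinearMap.mul ℝ ℝ)
    (g := fun (p : Euc N × ℝ) (z : Euc N) => kk N (p.1 + z) p.2 * η (-z))
    (s := univ ×ˢ Ioi (0:ℝ)) (isOpen_univ.prod isOpen_Ioi) hk
    (fun p z hp hz => by
      have : η (-z) = 0 := by
        by_contra hne
        exact hz ⟨-z, subset_tsupport _ hne, neg_neg z⟩
      simp [this])
    (continuous_const.locallyIntegrable)
    (by
      rintro ⟨p, z⟩ ⟨hp, -⟩
      apply ContDiffAt.contDiffWithinAt
      have h1 : ContDiffAt ℝ 2 (fun w : (Euc N × ℝ) × Euc N => kk N (w.1.1 + w.2) w.1.2) (p, z) := by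
        have := (kk_cda (N := N) 0 (p.1 + z) (hp.2 : 0 < p.2) (n := 2))
        simp only [sub_zero] at this
        exact this.comp (p, z) (f := fun w : (Euc N × ℝ) × Euc N => (w.1.1 + w.2, w.1.2)) (by fun_prop)
      have h2 : ContDiffAt ℝ 2 (fun w : (Euc N × ℝ) × Euc N => η (-w.2)) (p, z) :=
        ((hη.of_le (WithTop.coe_le_coe.2 (le_top : (2:ℕ∞) ≤ ⊤))).comp (contDiff_snd.neg)).contDiffAt
      exact h1.mul h2)
  have e : (fun p : Euc N × ℝ => heatPot N η p.1 p.2) = (fun q : (Euc N × ℝ) × Euc N => 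
      (MeasureTheory.convolution (fun _ : Euc N => (1:ℝ)) ((fun (p : Euc N × ℝ) (z : Euc N) => kk N (p.1 + z) p.2 * η (-z)) q.1) (ContinuousLinearMap.mul ℝ ℝ) volume) q.2) ∘ (fun p => (p, 0)) := by
    ext p
    simp [MeasureTheory.convolution, heatPot_eq, sub_eq_add_neg]
  rw [e]
  apply ContDiffAt.comp
  · exact main.contDiffAt (((isOpen_univ.prod isOpen_Ioi).prod isOpen_univ).mem_nhds ⟨⟨mem_univ _, ht⟩, mem_univ _⟩)
  · fun_prop

theorem diff_int {w : Euc N → ℝ} (hw : Integrable w) (F F' : ℝ → Euc N → ℝ) {s0 ε B : ℝ} (hε : 0 < ε)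
    (hF : ∀ s, |s - s0| < ε → ∀ y, HasDerivAt (fun s => F s y) (F' s y) s)
    (hB : ∀ s, |s - s0| < ε → ∀ y, |F s y| ≤ B ∧ |F' s y| ≤ B)
    (hc : ∀ s, |s - s0| < ε → Continuous (F s)) (hc' : Continuous (F' s0)) :
    HasDerivAt (fun s => ∫ y, F s y * w y) (∫ y, F' s0 y * w y) s0 := by
  have h0 : |s0 - s0| < ε := by simpa using hε
  refine (hasDerivAt_integral_of_dominated_loc_of_deriv_le (F := fun s y => F s y * w y) (F' := fun s y => F' s y * w y) (bound := fun y => B * |w y|)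
    (ball_mem_nhds s0 hε) ?_ ?_ ?_ ?_ ?_ ?_).2
  · filter_upwards [ball_mem_nhds s0 hε] with s hs
    exact (hc s hs).aestronglyMeasurable.mul hw.aestronglyMeasurable
  · exact hw.bdd_mul (hc s0 h0).aestronglyMeasurable (Eventually.of_forall fun y => (hB s0 h0 y).1)
  · exact hc'.aestronglyMeasurable.mul hw.aestronglyMeasurable
  · refine Eventually.of_forall fun y s hs => ?_
    rw [norm_mul]
    exact mul_le_mul_of_nonneg_right (hB s hs y).2 (norm_nonneg _)
  · exact hw.abs.const_mul B
  · exact Eventually.of_forall fun y s hs => (hF s hs y).mul_const _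

theorem heatPot_eq' (η : Euc N → ℝ) (x : Euc N) (t : ℝ) : heatPot N η x t = ∫ y, η (x - y) * kk N y t := by
  rw [heatPot_eq, ← integral_sub_left_eq_self _ _ x]
  simp [mul_comm]

theorem h_fderiv (hη : ContDiff ℝ (⊤ : ℕ∞) η) (hs : HasCompactSupport η) (x v : Euc N) (ht : 0 < t) :
    fderiv ℝ (fun y => heatPot N η y t) x v = heatPot N (fun y => fderiv ℝ η y v) x t := by
  have hd : DifferentiableAt ℝ (fun y => heatPot N η y t) x :=
    (slice_x (f := heatPot N η) (h_cda hη hs x ht)).differentiableAt (by norm_num)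
  have hl : HasDerivAt (fun s : ℝ => x + s • v) v 0 := by
    simpa using ((hasDerivAt_id (0:ℝ)).smul_const v).const_add x
  have h1 : HasDerivAt (fun s : ℝ => heatPot N η (x + s • v) t) (fderiv ℝ (fun y => heatPot N η y t) x v) 0 := by
    have hd' : HasFDerivAt (fun y => heatPot N η y t) (fderiv ℝ (fun y => heatPot N η y t) x) (x + (0:ℝ) • v) := by
      simpa using hd.hasFDerivAt
    exact hd'.comp_hasDerivAt (0:ℝ) hl
  have c1 : Continuous fun y => fderiv ℝ η y v := (hη.continuous_fderiv (by simp)).clm_apply continuous_const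
  have s1 : HasCompactSupport fun y => fderiv ℝ η y v := hs.fderiv_apply (𝕜 := ℝ) v
  obtain ⟨B1, hB1⟩ := hη.continuous.bounded_above_of_compact_support hs
  obtain ⟨B2, hB2⟩ := c1.bounded_above_of_compact_support s1
  have h2 : HasDerivAt (fun s : ℝ => ∫ y, η (x + s • v - y) * kk N y t) (∫ y, fderiv ℝ η (x + (0:ℝ) • v - y) v * kk N y t) 0 := by
    apply diff_int (kk_int ht).1 (fun s y => η (x + s • v - y)) (fun s y => fderiv ℝ η (x + s • v - y) v) one_pos (B := max B1 B2)
    · intro s _ y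
      have e := (hη.differentiable (by simp) (x + s • v - y)).hasFDerivAt
      have hl : HasDerivAt (fun s : ℝ => x + s • v - y) v s := by
        simpa using (((hasDerivAt_id s).smul_const v).const_add x).sub_const y
      exact e.comp_hasDerivAt s hl
    · exact fun s _ y => ⟨(hB1 _).trans (le_max_left _ _), (hB2 _).trans (le_max_right _ _)⟩
    · exact fun s _ => hη.continuous.comp (by fun_prop)
    · exact c1.comp (by fun_prop)
  simp only [← heatPot_eq' η] at h2
  rw [h1.unique h2, heatPot_eq']
  simp

theorem h_deriv (hη : Integrable η) (x : Euc N) (ht : 0 < t) :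
    HasDerivAt (heatPot N η x) (∫ y, kk N (x - y) t * (‖x - y‖ ^ 2 / (4 * t ^ 2) - N / (2 * t)) * η y) t := by
  have hm : ∀ s : ℝ, |s - t| < t / 2 → t / 2 < s := fun s hs => by have := (abs_lt.1 hs).1; linarith
  have mono : ∀ s z, t / 2 < s → kk N z s ≤ (4 * π * (t / 2)) ^ (-(N : ℝ) / 2) := fun s z hs => by
    refine (kk_le_sup z (by linarith)).trans ?_
    apply rpow_le_rpow_of_nonpos (by positivity) (by gcongr)
    have : (0:ℝ) ≤ N := by positivity
    linarith
  have cc : ∀ s, 0 < s → Continuous fun y : Euc N => kk N (x - y) s := fun s hs => by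
    simp only [kk_symm x]; exact kk_cont x hs
  apply diff_int hη (fun s y => kk N (x - y) s) (fun s y => kk N (x - y) s * (‖x - y‖ ^ 2 / (4 * s ^ 2) - N / (2 * s))) 
    (B := max ((4 * π * (t / 2)) ^ (-(N : ℝ) / 2)) (cm N * (N + 1) / (t / 2) * (4 * π * (t / 2)) ^ (-(N : ℝ) / 2))) (half_pos ht)
  · intro s hs y
    exact kk_deriv _ (by linarith [hm s hs])
  · intro s hs y
    have h1 := hm s hs
    have h0 : 0 < s := by linarith
    constructor
    · rw [abs_of_pos (kk_pos _ h0)]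
      exact (mono s _ h1).trans (le_max_left _ _)
    · refine (kk_td_le _ h0).trans (le_trans ?_ (le_max_right _ _))
      have := cm_pos N
      have := kk_pos (x - y) (by positivity : 0 < 2 * s)
      gcongr
      exact mono _ _ (by linarith)
  · exact fun s hs => cc s (by linarith [hm s hs])
  · exact (cc t ht).mul (by fun_prop)

theorem cd2 (hη : ContDiff ℝ (⊤ : ℕ∞) η) : ContDiff ℝ 2 η := hη.of_le (WithTop.coe_le_coe.2 (le_top : (2:ℕ∞) ≤ ⊤))

theorem cdd (hη : ContDiff ℝ (⊤ : ℕ∞) η) (i : Fin N) : ContDiff ℝ (⊤ : ℕ∞) (dd i η) :=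
  contDiff_iff_contDiffAt.2 fun x => dd_contDiffAt i hη.contDiffAt (by simp)

theorem h_t_lapl (hη : ContDiff ℝ (⊤ : ℕ∞) η) (hs : HasCompactSupport η) (x : Euc N) (ht : 0 < t) :
    deriv (heatPot N η x) t = heatPot N (lapl η) x t := by
  rw [(h_deriv (hη.continuous.integrable_of_hasCompactSupport hs) x ht).deriv, heatPot_eq]
  have hk : ContDiff ℝ 2 fun y : Euc N => kk N (y - x) t := contDiff_iff_contDiffAt.2 fun y => slice_x (f := fun y t => kk N (y - x) t) (kk_cda x y ht)
  have := (green hk (cd2 hη) hs).2.2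
  simp only [kk_lapl x _ ht] at this
  simp only [kk_symm x, norm_sub_rev x]
  exact this

theorem heatPot_sum {ι : Type*} (s : Finset ι) (f : ι → Euc N → ℝ) (hf : ∀ i ∈ s, Integrable (f i)) (x : Euc N) (ht : 0 < t) :
    heatPot N (fun y => ∑ i ∈ s, f i y) x t = ∑ i ∈ s, heatPot N (f i) x t := by
  simp only [heatPot_eq, Finset.mul_sum]
  apply integral_finsetSum
  intro i hi
  refine (hf i hi).bdd_mul (c := (4 * π * t) ^ (-(N : ℝ) / 2)) ?_ (Eventually.of_forall fun y => ?_)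
  · simp only [kk_symm x]; exact (kk_cont x ht).aestronglyMeasurable
  · rw [norm_eq_abs, abs_of_pos (kk_pos _ ht)]; exact kk_le_sup _ ht

theorem h_lapl (hη : ContDiff ℝ (⊤ : ℕ∞) η) (hs : HasCompactSupport η) (x : Euc N) (ht : 0 < t) :
    lapl (fun y => heatPot N η y t) x = heatPot N (lapl η) x t := by
  have e : ∀ i, dd i (fun y => heatPot N η y t) = fun y => heatPot N (dd i η) y t := fun i => by
    ext y; exact h_fderiv hη hs y _ ht
  have s1 : ∀ i, HasCompactSupport (dd i η) := fun i => hs.fderiv_apply (𝕜 := ℝ) _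
  have e2 : ∀ i, dd i (fun y => heatPot N (dd i η) y t) x = heatPot N (dd i (dd i η)) x t := fun i =>
    h_fderiv (cdd hη i) (s1 i) x _ ht
  rw [lapl_eq]
  simp only [e, e2]
  rw [← heatPot_sum _ _ _ x ht]
  · rfl
  · intro i _
    exact (cdd (cdd hη i) i).continuous.integrable_of_hasCompactSupport ((s1 i).fderiv_apply (𝕜 := ℝ) _)

theorem h_heat (hη : ContDiff ℝ (⊤ : ℕ∞) η) (hs : HasCompactSupport η) (x : Euc N) (ht : 0 < t) :
    deriv (heatPot N η x) t = lapl (fun y => heatPot N η y t) x := by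
  rw [h_t_lapl hη hs x ht, h_lapl hη hs x ht]

theorem h_intg {g : Euc N → ℝ} (hg : Continuous g) {B : ℝ} (hB : ∀ y, |g y| ≤ B) (x : Euc N) (ht : 0 < t) :
    Integrable fun y => kk N (x - y) t * g y := by
  simp only [kk_symm x]
  exact (kk_int' x ht).1.mul_bdd hg.aestronglyMeasurable (Eventually.of_forall hB)

theorem h_abs_le (g : Euc N → ℝ) (x : Euc N) (ht : 0 < t) : |heatPot N g x t| ≤ heatPot N (fun y => |g y|) x t := by
  rw [heatPot_eq, heatPot_eq]
  refine abs_integral_le_integral_abs.trans (le_of_eq ?_)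
  congr 1; ext y; rw [abs_mul, abs_of_pos (kk_pos _ ht)]

theorem h_mono {f g : Euc N → ℝ} (hf : Continuous f) (hg : Continuous g) {B : ℝ} (hfB : ∀ y, |f y| ≤ B) (hgB : ∀ y, |g y| ≤ B) 
    (hle : ∀ y, f y ≤ g y) (x : Euc N) (ht : 0 < t) : heatPot N f x t ≤ heatPot N g x t :=
  integral_mono (h_intg hf hfB x ht) (h_intg hg hgB x ht) fun y => mul_le_mul_of_nonneg_left (hle y) (kk_pos _ ht).le

theorem h_nonneg {g : Euc N → ℝ} (hg : ∀ y, 0 ≤ g y) (x : Euc N) (ht : 0 < t) : 0 ≤ heatPot N g x t :=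
  integral_nonneg fun y => mul_nonneg (kk_pos _ ht).le (hg y)

theorem h_const (c : ℝ) (x : Euc N) (ht : 0 < t) : heatPot N (fun _ => c) x t = c := by
  rw [heatPot_eq, integral_mul_const]
  simp only [kk_symm x]
  rw [(kk_int' x ht).2, one_mul]
end

section
variable {N : ℕ} {t : ℝ} {η : Euc N → ℝ}

theorem h_lip {L : ℝ} (hL : 0 ≤ L) (hc : Continuous η) {B : ℝ} (hB : ∀ y, |η y| ≤ B) (hη : ∀ x y, |η y - η x| ≤ L * ‖y - x‖) (x : Euc N) (ht : 0 < t) :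
    |heatPot N η x t - η x| ≤ L * (cm N * √t) := by
  have h1 : heatPot N η x t - η x = ∫ y, kk N (x - y) t * (η y - η x) := by
    have e := h_const (N := N) (η x) x ht
    rw [heatPot_eq] at e
    rw [heatPot_eq]
    conv_lhs => rw [← e]
    rw [← integral_sub (h_intg hc hB x ht) (h_intg continuous_const (fun _ => le_rfl) x ht)]
    congr 1; ext y; ring
  have i2 := (kk_int' x (by positivity : 0 < 2 * t))
  rw [h1]
  refine abs_integral_le_integral_abs.trans ?_
  calc _ ≤ ∫ y, L * (cm N * √t) * kk N (y - x) (2 * t) := by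
        apply integral_mono_of_nonneg (Eventually.of_forall fun y => abs_nonneg _) (i2.1.const_mul _)
        refine Eventually.of_forall fun y => ?_
        simp only
        rw [abs_mul, abs_of_pos (kk_pos _ ht), kk_symm]
        have := kk_m1 (y - x) ht
        have h0 := kk_pos (y - x) ht
        calc _ ≤ kk N (y - x) t * (L * ‖y - x‖) := by gcongr; exact hη x y
          _ = L * (‖y - x‖ * kk N (y - x) t) := by ring
          _ ≤ L * (cm N * √t * kk N (y - x) (2 * t)) := by gcongr
          _ = _ := by ring
    _ = _ := by rw [integral_const_mul, i2.2, mul_one]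

theorem h_half {s : ℝ} (hc : Continuous η) (h01 : ∀ x, 0 ≤ η x ∧ η x ≤ 1) (hsupp : tsupport η ⊆ ball (0 : Euc N) s)
    (x : Euc N) (hx : s ≤ ‖x‖) (ht : 0 < t) : heatPot N η x t ≤ 1 / 2 := by
  have e1 := heatPot_eq' η x t
  have e2 : heatPot N η x t = ∫ y, η (x + y) * kk N y t := by
    rw [e1, ← integral_neg_eq_self]; simp [kk_neg]
  have i0 := kk_int (N := N) ht
  have I1 : Integrable fun y => η (x - y) * kk N y t :=
    i0.1.bdd_mul (c := 1) (hc.comp (by fun_prop)).aestronglyMeasurable (Eventually.of_forall fun y => by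
      rw [norm_eq_abs, abs_of_nonneg (h01 _).1]; exact (h01 _).2)
  have I2 : Integrable fun y => η (x + y) * kk N y t :=
    i0.1.bdd_mul (c := 1) (hc.comp (by fun_prop)).aestronglyMeasurable (Eventually.of_forall fun y => by
      rw [norm_eq_abs, abs_of_nonneg (h01 _).1]; exact (h01 _).2)
  have hsum : ∀ y, η (x - y) + η (x + y) ≤ 1 := by
    intro y
    by_contra hcon
    push Not at hcon
    have n1 : η (x - y) ≠ 0 := fun h => by linarith [(h01 (x + y)).2]
    have n2 : η (x + y) ≠ 0 := fun h => by linarith [(h01 (x - y)).2]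
    have m1 := hsupp (subset_tsupport _ n1)
    have m2 := hsupp (subset_tsupport _ n2)
    rw [mem_ball_zero_iff] at m1 m2
    have : ‖(2:ℝ) • x‖ ≤ ‖x - y‖ + ‖x + y‖ := by
      refine le_trans (le_of_eq ?_) (norm_add_le _ _)
      congr 1; rw [two_smul]; abel
    rw [norm_smul] at this
    simp at this
    linarith
  have : heatPot N η x t + heatPot N η x t ≤ 1 := by
    nth_rewrite 1 [e1]
    rw [e2, ← integral_add I1 I2, ← i0.2]
    apply integral_mono (I1.add I2) i0.1
    intro y
    have := mul_le_mul_of_nonneg_right (hsum y) (kk_pos y ht).le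
    simp only [Pi.add_apply]
    linarith
  linarith

/-- the density R -/
def Rf (N : ℕ) (η : Euc N → ℝ) (x : Euc N) (t : ℝ) : ℝ :=
  ‖fderiv ℝ (fun y => heatPot N η y t) x‖ ^ 2 + |deriv (fun τ => heatPot N η x τ) t|

theorem Rf_nonneg (x : Euc N) (t : ℝ) : 0 ≤ Rf N η x t := by unfold Rf; positivity

theorem slice_cont_fderiv {f : Euc N → ℝ → ℝ} {p : Euc N × ℝ}
    (h : ContDiffAt ℝ 2 (fun p : Euc N × ℝ => f p.1 p.2) p) :
    ContinuousAt (fun p : Euc N × ℝ => fderiv ℝ (fun y => f y p.2) p.1) p := by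
  have h1 : ContinuousAt (fun p : Euc N × ℝ => (fderiv ℝ (fun p : Euc N × ℝ => f p.1 p.2) p).comp (ContinuousLinearMap.inl ℝ (Euc N) ℝ)) p :=
    ((h.fderiv_right (m := 1) (by norm_num)).continuousAt).clm_comp continuousAt_const
  refine h1.congr ?_
  filter_upwards [h.eventually (by simp)] with p' hp'
  ext v
  exact (slice_fderiv (hp'.differentiableAt (by norm_num)) v).symm

theorem Rf_cont (hη : ContDiff ℝ (⊤ : ℕ∞) η) (hs : HasCompactSupport η) {p : Euc N × ℝ} (hp : 0 < p.2) :
    ContinuousAt (fun p : Euc N × ℝ => Rf N η p.1 p.2) p := by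
  have h := h_cda hη hs p.1 hp
  exact ((slice_cont_fderiv h).norm.pow 2).add (slice_cont_deriv h).abs

theorem h_grad_large (hη : ContDiff ℝ (⊤ : ℕ∞) η) (hs : HasCompactSupport η) (h01 : ∀ x, 0 ≤ η x ∧ η x ≤ 1) (x : Euc N) (ht : 0 < t) :
    ‖fderiv ℝ (fun y => heatPot N η y t) x‖ ≤ cm N / √t * heatPot N η x (2 * t) := by
  have hc := cm_pos N
  have hst : 0 < √t := sqrt_pos.2 ht
  have ht2 : 0 < 2 * t := by positivity
  have hb : ∀ y, |η y| ≤ 1 := fun y => by rw [abs_of_nonneg (h01 y).1]; exact (h01 y).2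
  have hh := h_nonneg (fun y => (h01 y).1) x ht2
  apply ContinuousLinearMap.opNorm_le_bound _ (by positivity)
  intro v
  have hk : ContDiff ℝ 2 fun y : Euc N => kk N (y - x) t := contDiff_iff_contDiffAt.2 fun y => slice_x (f := fun y t => kk N (y - x) t) (kk_cda x y ht)
  have c1 : Continuous fun y => fderiv ℝ η y v := (hη.continuous_fderiv (by simp)).clm_apply continuous_const
  have c2 : Continuous fun y => fderiv ℝ (fun y => kk N (y - x) t) y v := (hk.continuous_fderiv (by norm_num)).clm_apply continuous_const
  have s1 : HasCompactSupport fun y => fderiv ℝ η y v := hs.fderiv_apply (𝕜 := ℝ) v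
  have ibp := integral_mul_fderiv_eq_neg_fderiv_mul_of_integrable (𝕜 := ℝ) (μ := (volume : Measure (Euc N))) (f := fun y => kk N (y - x) t) (g := η) (v := v)
    ((c2.mul hη.continuous).integrable_of_hasCompactSupport hs.mul_left)
    ((hk.continuous.mul c1).integrable_of_hasCompactSupport s1.mul_left)
    ((hk.continuous.mul hη.continuous).integrable_of_hasCompactSupport hs.mul_left)
    (fun y _ => hk.differentiable (by norm_num) y) (fun y _ => hη.differentiable (by simp) y)
  rw [h_fderiv hη hs x v ht, heatPot_eq]
  simp only [kk_symm x]
  rw [ibp, norm_neg]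
  refine (norm_integral_le_integral_norm _).trans ?_
  calc _ ≤ ∫ y, cm N / √t * ‖v‖ * (kk N (x - y) (2 * t) * η y) := by
        apply integral_mono_of_nonneg (Eventually.of_forall fun y => norm_nonneg _) ((h_intg hη.continuous hb x ht2).const_mul _)
        refine Eventually.of_forall fun y => ?_
        simp only
        rw [norm_mul, norm_eq_abs, norm_eq_abs, abs_of_nonneg (h01 y).1, kk_symm]
        have := mul_le_mul_of_nonneg_right (kk_fd_le x y v ht) (h01 y).1
        refine this.trans (le_of_eq (by ring))
    _ = _ := by rw [integral_const_mul, ← heatPot_eq]; ring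

theorem h_t_large (hη : ContDiff ℝ (⊤ : ℕ∞) η) (hs : HasCompactSupport η) (h01 : ∀ x, 0 ≤ η x ∧ η x ≤ 1) (x : Euc N) (ht : 0 < t) :
    |deriv (heatPot N η x) t| ≤ cm N * (N + 1) / t * heatPot N η x (2 * t) := by
  have ht2 : 0 < 2 * t := by positivity
  have hb : ∀ y, |η y| ≤ 1 := fun y => by rw [abs_of_nonneg (h01 y).1]; exact (h01 y).2
  rw [(h_deriv (hη.continuous.integrable_of_hasCompactSupport hs) x ht).deriv]
  refine abs_integral_le_integral_abs.trans ?_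
  calc _ ≤ ∫ y, cm N * (N + 1) / t * (kk N (x - y) (2 * t) * η y) := by
        apply integral_mono_of_nonneg (Eventually.of_forall fun y => abs_nonneg _) ((h_intg hη.continuous hb x ht2).const_mul _)
        refine Eventually.of_forall fun y => ?_
        simp only
        rw [abs_mul, abs_of_nonneg (h01 y).1]
        have := mul_le_mul_of_nonneg_right (kk_td_le (x - y) ht) (h01 y).1
        refine this.trans (le_of_eq (by ring))
    _ = _ := by rw [integral_const_mul, ← heatPot_eq]

theorem h_grad_small (hη : ContDiff ℝ (⊤ : ℕ∞) η) (hs : HasCompactSupport η) (x : Euc N) (ht : 0 < t) :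
    ‖fderiv ℝ (fun y => heatPot N η y t) x‖ ≤ heatPot N (fun y => ‖fderiv ℝ η y‖) x t := by
  have c0 : Continuous fun y => ‖fderiv ℝ η y‖ := (hη.continuous_fderiv (by simp)).norm
  obtain ⟨B, hB⟩ := (hη.continuous_fderiv (by simp)).bounded_above_of_compact_support (hs.fderiv (𝕜 := ℝ))
  have hB' : ∀ y, |‖fderiv ℝ η y‖| ≤ B := fun y => by rw [abs_norm]; exact hB y
  apply ContinuousLinearMap.opNorm_le_bound _ (h_nonneg (fun y => norm_nonneg _) x ht)
  intro v
  rw [h_fderiv hη hs x v ht]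
  refine (h_abs_le _ x ht).trans ?_
  rw [heatPot_eq, heatPot_eq, ← integral_mul_const]
  apply integral_mono_of_nonneg (Eventually.of_forall fun y => mul_nonneg (kk_pos _ ht).le (abs_nonneg _)) ((h_intg c0 hB' x ht).mul_const _)
  refine Eventually.of_forall fun y => ?_
  simp only
  rw [mul_assoc]
  exact mul_le_mul_of_nonneg_left ((fderiv ℝ η y).le_opNorm v) (kk_pos _ ht).le
end

section
variable {N : ℕ} {t : ℝ} {η : Euc N → ℝ}

theorem h_meas {g : Euc N → ℝ} (hg : Continuous g) : Measurable fun p : Euc N × ℝ => heatPot N g p.1 p.2 := by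
  have : StronglyMeasurable (Function.uncurry fun (p : Euc N × ℝ) (y : Euc N) => kk N (p.1 - y) p.2 * g y) := by
    apply Measurable.stronglyMeasurable
    unfold kk Function.uncurry
    have := hg.measurable
    fun_prop
  exact (this.integral_prod_right (ν := volume)).measurable

theorem h_total {g : Euc N → ℝ} (hg : Integrable g) (ht : 0 < t) :
    Integrable (fun x => heatPot N g x t) ∧ ∫ x, heatPot N g x t = ∫ y, g y := by
  have e : (fun x => heatPot N g x t) = MeasureTheory.convolution g (fun y => kk N y t) (ContinuousLinearMap.mul ℝ ℝ) volume := by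
    ext x; simp [MeasureTheory.convolution, heatPot_eq, mul_comm]
  have k := kk_int (N := N) ht
  rw [e]
  refine ⟨hg.integrable_convolution _ k.1, ?_⟩
  rw [integral_convolution _ hg k.1, k.2]
  simp

theorem h_dbl {g : Euc N → ℝ} (hg : Continuous g) {B : ℝ} (hB : ∀ y, |g y| ≤ B) (h0 : ∀ y, 0 ≤ g y) (x : Euc N) (ht : 0 < t) :
    heatPot N g x t ≤ cm N * heatPot N g x (2 * t) := by
  rw [heatPot_eq, heatPot_eq, ← integral_const_mul]
  apply integral_mono (h_intg hg hB x ht) ((h_intg hg hB x (by positivity)).const_mul _)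
  intro y
  simp only
  rw [← mul_assoc]
  apply mul_le_mul_of_nonneg_right _ (h0 y)
  refine (kk_m0 _ ht).trans ?_
  have := kk_pos (x - y) (by positivity : 0 < 2 * t)
  unfold cm
  have : 0 ≤ 2 ^ ((N : ℝ) / 2) * kk N (x - y) (2 * t) := by positivity
  linarith

theorem R_bound (hη : ContDiff ℝ (⊤ : ℕ∞) η) (hs : HasCompactSupport η) (h01 : ∀ x, 0 ≤ η x ∧ η x ≤ 1) :
    ∃ (g : Euc N → ℝ) (D B : ℝ), 0 < D ∧ 0 < B ∧ Continuous g ∧ Integrable g ∧ (∀ y, 0 ≤ g y ∧ g y ≤ B) ∧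
      ∀ x t, 0 < t → Rf N η x t ≤ D / (1 + t) * heatPot N g x (2 * t) := by
  have c0 : Continuous fun y => ‖fderiv ℝ η y‖ := (hη.continuous_fderiv (by simp)).norm
  have s0 : HasCompactSupport fun y => ‖fderiv ℝ η y‖ := (hs.fderiv (𝕜 := ℝ)).norm
  have c1 : Continuous (lapl η) := by
    have : lapl η = fun y => ∑ i, dd i (dd i η) y := rfl
    rw [this]
    exact continuous_finsetSum _ fun i _ => (cdd (cdd hη i) i).continuous
  have s1 : HasCompactSupport (lapl η) := by
    apply HasCompactSupport.intro hs.isCompact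
    intro y hy
    have : η =ᶠ[nhds y] fun _ => 0 := notMem_tsupport_iff_eventuallyEq.1 hy
    rw [lapl_congr this]; simp [lapl]
  have s1' : HasCompactSupport fun y => |lapl η y| := s1.norm
  set g : Euc N → ℝ := fun y => η y + ‖fderiv ℝ η y‖ + |lapl η y| with hg
  have cg : Continuous g := (hη.continuous.add c0).add c1.abs
  have sg : HasCompactSupport g := (hs.add s0).add s1'
  obtain ⟨B0, hB0⟩ := cg.bounded_above_of_compact_support sg
  set B := max B0 1 with hBdef
  have hB : ∀ y, |g y| ≤ B := fun y => (hB0 y).trans (le_max_left _ _)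
  have hB1 : 0 < B := by positivity
  have g1 : ∀ y, η y ≤ g y := fun y => by simp only [hg]; linarith [norm_nonneg (fderiv ℝ η y), abs_nonneg (lapl η y)]
  have g2 : ∀ y, ‖fderiv ℝ η y‖ ≤ g y := fun y => by simp only [hg]; linarith [(h01 y).1, abs_nonneg (lapl η y)]
  have g3 : ∀ y, |lapl η y| ≤ g y := fun y => by simp only [hg]; linarith [(h01 y).1, norm_nonneg (fderiv ℝ η y)]
  have gnn : ∀ y, 0 ≤ g y := fun y => (h01 y).1.trans (g1 y)
  have gB : ∀ y, g y ≤ B := fun y => (le_abs_self _).trans (hB y)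
  have mono : ∀ {f : Euc N → ℝ}, Continuous f → (∀ y, 0 ≤ f y) → (∀ y, f y ≤ g y) → ∀ x s, 0 < s → heatPot N f x s ≤ heatPot N g x s :=
    fun hf h0 h1 x s hs => h_mono hf cg (B := B) (fun y => by rw [abs_of_nonneg (h0 y)]; exact (h1 y).trans (gB y)) hB h1 x hs
  have hWB : ∀ x s, 0 < s → heatPot N g x s ≤ B := fun x s hs => by
    rw [← h_const (N := N) B x hs]
    exact h_mono cg continuous_const hB (fun _ => by rw [abs_of_pos hB1]) gB x hs
  have hc := cm_pos N
  set D1 := cm N ^ 2 * B + cm N * (N + 1) with hD1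
  set D2 := cm N ^ 2 * B + cm N with hD2
  have hD1p : 0 < D1 := by positivity
  have hD2p : 0 < D2 := by positivity
  refine ⟨g, 2 * (D1 + D2), B, by positivity, hB1, cg, cg.integrable_of_hasCompactSupport sg, fun y => ⟨gnn y, gB y⟩, ?_⟩
  intro x t ht
  have ht2 : 0 < 2 * t := by positivity
  have hst : 0 < √t := sqrt_pos.2 ht
  set W := heatPot N g x (2 * t) with hW
  have hW0 : 0 ≤ W := h_nonneg gnn x ht2
  have hWB' : W ≤ B := hWB x _ ht2
  have r1 : Rf N η x t ≤ D1 / t * W := by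
    have a1 := h_grad_large hη hs h01 x ht
    have a2 := h_t_large hη hs h01 x ht
    have a3 : heatPot N η x (2 * t) ≤ W := mono hη.continuous (fun y => (h01 y).1) g1 x _ ht2
    unfold Rf
    calc _ ≤ (cm N / √t * W) ^ 2 + cm N * (N + 1) / t * W := by
          refine add_le_add ?_ (a2.trans (by gcongr))
          exact pow_le_pow_left₀ (norm_nonneg _) (a1.trans (by gcongr)) 2
      _ = (cm N ^ 2 * W + cm N * (N + 1)) / t * W := by
          rw [mul_pow, div_pow, sq_sqrt ht.le]; ring
      _ ≤ D1 / t * W := by gcongr; rw [hD1]; gcongr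
  have r2 : Rf N η x t ≤ D2 * W := by
    have dbl := h_dbl cg hB gnn x ht
    have a1 := (h_grad_small hη hs x ht).trans ((mono c0 (fun y => norm_nonneg _) g2 x t ht).trans dbl)
    have a2 : |deriv (heatPot N η x) t| ≤ cm N * W := by
      rw [h_t_lapl hη hs x ht]
      exact (h_abs_le _ x ht).trans ((mono c1.abs (fun y => abs_nonneg _) g3 x t ht).trans dbl)
    unfold Rf
    calc _ ≤ (cm N * W) ^ 2 + cm N * W := by
          refine add_le_add ?_ a2
          exact pow_le_pow_left₀ (norm_nonneg _) a1 2
      _ = (cm N ^ 2 * W + cm N) * W := by ring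
      _ ≤ D2 * W := by gcongr; rw [hD2]; gcongr
  rcases le_total t 1 with h1 | h1
  · refine r2.trans ?_
    gcongr
    rw [le_div_iff₀ (by positivity)]
    nlinarith
  · refine r1.trans ?_
    apply mul_le_mul_of_nonneg_right _ hW0
    rw [div_le_div_iff₀ ht (by positivity)]
    nlinarith

theorem R_int {q : ℝ} (hq : 1 < q) (hη : ContDiff ℝ (⊤ : ℕ∞) η) (hs : HasCompactSupport η) (h01 : ∀ x, 0 ≤ η x ∧ η x ≤ 1) :
    Integrable (fun p : Euc N × ℝ => Rf N η p.1 p.2 ^ (q / (q - 1))) ((volume : Measure (Euc N)).prod (volume.restrict (Ioi (0:ℝ)))) := by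
  obtain ⟨g, D, B, hD, hB, cg, ig, gB, hR⟩ := R_bound hη hs h01
  set m := q / (q - 1) with hm
  have hm1 : 1 < m := by rw [hm, lt_div_iff₀ (by linarith)]; linarith
  have hae : ∀ᵐ p ∂((volume : Measure (Euc N)).prod (volume.restrict (Ioi (0:ℝ)))), 0 < p.2 := by
    have : (volume : Measure (Euc N)).prod (volume.restrict (Ioi (0:ℝ))) = volume.restrict (univ ×ˢ Ioi 0) := by
      rw [Measure.volume_eq_prod, ← Measure.prod_restrict, Measure.restrict_univ]
    rw [this]
    filter_upwards [ae_restrict_mem (MeasurableSet.univ.prod measurableSet_Ioi)] with p hp using hp.2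
  have haesm : AEStronglyMeasurable (fun p : Euc N × ℝ => Rf N η p.1 p.2 ^ m) ((volume : Measure (Euc N)).prod (volume.restrict (Ioi (0:ℝ)))) := by
    have : (volume : Measure (Euc N)).prod (volume.restrict (Ioi (0:ℝ))) = volume.restrict (univ ×ˢ Ioi 0) := by
      rw [Measure.volume_eq_prod, ← Measure.prod_restrict, Measure.restrict_univ]
    rw [this]
    apply ContinuousOn.aestronglyMeasurable _ (MeasurableSet.univ.prod measurableSet_Ioi)
    intro p hp
    exact ((Rf_cont hη hs hp.2).rpow_const (Or.inr (by linarith))).continuousWithinAt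
  have hWB : ∀ x s, 0 < s → heatPot N g x s ≤ B := fun x s hs => by
    rw [← h_const (N := N) B x hs]
    exact h_mono cg continuous_const (B := B) (fun y => by rw [abs_of_nonneg (gB y).1]; exact (gB y).2) (fun _ => by rw [abs_of_pos hB]) (fun y => (gB y).2) x hs
  have hW0 : ∀ x s, 0 < s → 0 ≤ heatPot N g x s := fun x s hs => h_nonneg (fun y => (gB y).1) x hs
  refine Integrable.mono' (g := fun p : Euc N × ℝ => (D ^ m * B ^ (m - 1)) * ((1 + p.2) ^ (-m) * heatPot N g p.1 (2 * p.2))) ?_ haesm ?_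
  · apply Integrable.const_mul
    have hmeas : Measurable (fun p : Euc N × ℝ => (1 + p.2) ^ (-m) * heatPot N g p.1 (2 * p.2)) := by
      have h1 : Measurable (fun p : Euc N × ℝ => heatPot N g p.1 (2 * p.2)) :=
        (h_meas cg).comp (g := fun p : Euc N × ℝ => heatPot N g p.1 p.2) (f := fun p : Euc N × ℝ => (p.1, 2 * p.2)) (by fun_prop)
      exact Measurable.mul (by fun_prop) h1
    rw [integrable_prod_iff' hmeas.aestronglyMeasurable]
    constructor
    · filter_upwards [ae_restrict_mem measurableSet_Ioi] with s hs
      exact (h_total ig (by simpa using hs)).1.const_mul _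
    · have : IntegrableOn (fun s : ℝ => (1 + s) ^ (-m) * ∫ y, g y) (Ioi 0) := by
        apply Integrable.mul_const
        have := (integrableOn_add_rpow_Ioi_of_lt (a := -m) (c := 0) (m := 1) (by linarith) (by norm_num))
        show IntegrableOn (fun s : ℝ => (1 + s) ^ (-m)) (Ioi 0)
        simpa only [add_comm (1:ℝ)] using this
      refine this.congr_fun ?_ measurableSet_Ioi
      intro s hs
      have hs' : 0 < 2 * s := by simpa using hs
      have hs0 : 0 < s := hs
      simp only
      rw [← (h_total ig hs').2, ← integral_const_mul]
      congr 1; ext x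
      rw [norm_of_nonneg (mul_nonneg (by positivity) (hW0 _ _ hs'))]
  · filter_upwards [hae] with p hp
    have hp2 : 0 < 2 * p.2 := by positivity
    have h0 := hW0 p.1 _ hp2
    have h1 := hWB p.1 _ hp2
    rw [norm_of_nonneg (rpow_nonneg (Rf_nonneg _ _) _)]
    calc _ ≤ (D / (1 + p.2) * heatPot N g p.1 (2 * p.2)) ^ m := rpow_le_rpow (Rf_nonneg _ _) (hR _ _ hp) (by linarith)
      _ = D ^ m * (1 + p.2) ^ (-m) * heatPot N g p.1 (2 * p.2) ^ m := by
        rw [mul_rpow (by positivity) h0, div_rpow hD.le (by positivity), rpow_neg (by positivity)]; ring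
      _ = D ^ m * (1 + p.2) ^ (-m) * (heatPot N g p.1 (2 * p.2) ^ (m - 1) * heatPot N g p.1 (2 * p.2)) := by
        congr 1
        rcases h0.eq_or_lt with h | h
        · rw [← h, zero_rpow (by linarith)]; simp
        · rw [← rpow_add_one h.ne']; simp
      _ ≤ D ^ m * (1 + p.2) ^ (-m) * (B ^ (m - 1) * heatPot N g p.1 (2 * p.2)) := by
        gcongr
      _ = _ := by ring

theorem R_slab {q : ℝ} (hq : 1 < q) (hη : ContDiff ℝ (⊤ : ℕ∞) η) (hs : HasCompactSupport η) (h01 : ∀ x, 0 ≤ η x ∧ η x ≤ 1)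
    {τ : ℝ} (hτ : 0 < τ) (T : ℝ) :
    Integrable (fun p : Euc N × ℝ => Rf N η p.1 p.2 ^ (q / (q - 1))) (slab N τ T) ∧
    ∫ p, Rf N η p.1 p.2 ^ (q / (q - 1)) ∂(slab N τ T) ≤ Rnorm N q η := by
  have I := R_int hq hη hs h01
  have hle : slab N τ T ≤ (volume : Measure (Euc N)).prod (volume.restrict (Ioi (0:ℝ))) := by
    unfold slab
    apply Measure.prod_mono le_rfl
    exact Measure.restrict_mono (fun s hs => lt_trans hτ hs.1) le_rfl
  refine ⟨I.mono_measure hle, ?_⟩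
  have e : Rnorm N q η = ∫ p, Rf N η p.1 p.2 ^ (q / (q - 1)) ∂((volume : Measure (Euc N)).prod (volume.restrict (Ioi (0:ℝ)))) := by
    rw [integral_prod_symm _ I]; rfl
  rw [e]
  exact integral_mono_measure hle (Eventually.of_forall fun p => rpow_nonneg (Rf_nonneg _ _) _) I
end

theorem c2_of {P P1 P2 : ℝ → ℝ} (h1 : ∀ w, HasDerivAt P (P1 w) w) (h2 : ∀ w, HasDerivAt P1 (P2 w) w) (c : Continuous P2) :
    ContDiff ℝ 2 P := by
  have e1 : deriv P = P1 := funext fun w => (h1 w).deriv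
  have e2 : deriv P1 = P2 := funext fun w => (h2 w).deriv
  rw [show (2 : WithTop ℕ∞) = 1 + 1 by norm_num, contDiff_succ_iff_deriv]
  refine ⟨fun w => (h1 w).differentiableAt, by simp, ?_⟩
  rw [e1, contDiff_one_iff_deriv, e2]
  exact ⟨fun w => (h2 w).differentiableAt, c⟩

theorem pp_deriv {s : ℝ} (hs : 1 < s) (w : ℝ) : HasDerivAt (fun w : ℝ => (max w 0) ^ s) (s * (max w 0) ^ (s - 1)) w := by
  have key : ∀ w : ℝ, w ≠ 0 → HasDerivAt (fun w : ℝ => (max w 0) ^ s) (s * (max w 0) ^ (s - 1)) w := by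
    intro w hw
    rcases lt_or_gt_of_ne hw with h | h
    · rw [max_eq_right h.le, zero_rpow (by linarith), mul_zero]
      apply (hasDerivAt_const w (0:ℝ)).congr_of_eventuallyEq
      filter_upwards [gt_mem_nhds h] with z hz
      rw [max_eq_right hz.le, zero_rpow (by linarith)]
    · rw [max_eq_left h.le]
      apply (Real.hasDerivAt_rpow_const (Or.inl hw)).congr_of_eventuallyEq
      filter_upwards [lt_mem_nhds h] with z hz
      rw [max_eq_left hz.le]
  by_cases hw : w = 0
  · subst hw
    refine hasDerivAt_of_hasDerivAt_of_ne (f := fun w : ℝ => (max w 0) ^ s) (g := fun w : ℝ => s * (max w 0) ^ (s - 1)) (x := 0) (fun y hy => key y hy) ?_ ?_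
    · exact ContinuousAt.rpow_const (by fun_prop) (Or.inr (by linarith))
    · exact ContinuousAt.mul continuousAt_const (ContinuousAt.rpow_const (by fun_prop) (Or.inr (by linarith)))
  · exact key w hw

/-- truncated power of `3/4 - w` -/
def pq (s w : ℝ) : ℝ := (max (3 / 4 - w) 0) ^ s

theorem pq_deriv {s : ℝ} (hs : 1 < s) (w : ℝ) : HasDerivAt (pq s) (-(s * pq (s - 1) w)) w := by
  have := (pp_deriv hs (3 / 4 - w)).comp w ((hasDerivAt_id w).const_sub (3/4))
  refine this.congr_deriv ?_
  unfold pq; ring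

theorem pq_deriv2 {s : ℝ} (hs : 2 < s) (w : ℝ) : HasDerivAt (fun w => -(s * pq (s - 1) w)) (s * (s - 1) * pq (s - 2) w) w := by
  have := ((pq_deriv (s := s - 1) (by linarith) w).const_mul s).fun_neg
  refine this.congr_deriv ?_
  rw [show s - 1 - 1 = s - 2 by ring]; ring

theorem pq_cont {s : ℝ} (hs : 0 < s) : Continuous (pq s) := by
  unfold pq
  exact Continuous.rpow_const (by fun_prop) (fun _ => Or.inr hs.le)

theorem pq_nn (s w : ℝ) : 0 ≤ pq s w := rpow_nonneg (le_max_right _ _) _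

theorem pq_le {s w : ℝ} (hs : 0 ≤ s) (hw : 0 ≤ w) : pq s w ≤ 1 :=
  rpow_le_one (le_max_right _ _) (max_le (by linarith) (by norm_num)) hs

theorem pq_anti {s s' w : ℝ} (hs : 0 < s) (hss : s ≤ s') (hw : 0 ≤ w) : pq s' w ≤ pq s w := by
  unfold pq
  rcases (le_max_right (3 / 4 - w) 0).eq_or_lt with h | h
  · rw [← h, zero_rpow (by linarith), zero_rpow (by linarith)]
  · exact rpow_le_rpow_of_exponent_ge h (max_le (by linarith) (by norm_num)) hss

theorem pq_ge {s w : ℝ} (hs : 0 ≤ s) (hw : w ≤ 1 / 2) : (1/4 : ℝ) ^ s ≤ pq s w :=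
  rpow_le_rpow (by norm_num) (le_max_of_le_left (by linarith)) hs

theorem pq_zero {s w : ℝ} (hs : 0 < s) (hw : 3 / 4 ≤ w) : pq s w = 0 := by
  unfold pq
  rw [max_eq_right (by linarith), zero_rpow hs.ne']

section
variable {N : ℕ} {q : ℝ} {η : Euc N → ℝ}

theorem h_le_one (hη : Continuous η) (h01 : ∀ x, 0 ≤ η x ∧ η x ≤ 1) (x : Euc N) {t : ℝ} (ht : 0 < t) : heatPot N η x t ≤ 1 := by
  rw [← h_const (N := N) 1 x ht]
  exact h_mono hη continuous_const (B := 1) (fun y => by rw [abs_of_nonneg (h01 y).1]; exact (h01 y).2) (fun _ => by simp) (fun y => (h01 y).2) x ht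

theorem Rf_bdd (hη : ContDiff ℝ (⊤ : ℕ∞) η) (hs : HasCompactSupport η) (h01 : ∀ x, 0 ≤ η x ∧ η x ≤ 1) {τ : ℝ} (hτ : 0 < τ) (x : Euc N) {t : ℝ} (ht : τ ≤ t) :
    ‖fderiv ℝ (fun y => heatPot N η y t) x‖ ≤ cm N / √τ ∧ Rf N η x t ≤ (cm N / √τ) ^ 2 + cm N * (N + 1) / τ := by
  have ht0 : 0 < t := hτ.trans_le ht
  have hc := cm_pos N
  have l1 := h_le_one hη.continuous h01 x (t := 2 * t) (by positivity)
  have l0 : 0 ≤ heatPot N η x (2 * t) := h_nonneg (fun y => (h01 y).1) x (by positivity)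
  have hst : 0 < √τ := sqrt_pos.2 hτ
  have a1 : ‖fderiv ℝ (fun y => heatPot N η y t) x‖ ≤ cm N / √τ := by
    calc _ ≤ _ := h_grad_large hη hs h01 x ht0
      _ ≤ cm N / √τ * 1 := by gcongr
      _ = _ := mul_one _
  refine ⟨a1, ?_⟩
  unfold Rf
  refine add_le_add (pow_le_pow_left₀ (norm_nonneg _) a1 2) ?_
  calc _ ≤ _ := h_t_large hη hs h01 x ht0
    _ ≤ cm N * (N + 1) / τ * 1 := by gcongr
    _ = _ := mul_one _

theorem energy_pt (hq : 1 < q) (hη : ContDiff ℝ (⊤ : ℕ∞) η) (hs : HasCompactSupport η) (h01 : ∀ x, 0 ≤ η x ∧ η x ≤ 1)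
    {s C1 : ℝ} (hsd : s = 2 * (q / (q - 1))) (hC1 : C1 = s * (s - 1) * N + 2 * s) (x : Euc N) {t : ℝ} (ht : 0 < t) :
    ContDiffAt ℝ 2 (fun p : Euc N × ℝ => pq s (heatPot N η p.1 p.2)) (x, t) ∧
    (∀ i, |dd i (fun y => pq s (heatPot N η y t)) x| ≤ s * ‖fderiv ℝ (fun y => heatPot N η y t) x‖) ∧
    |deriv (fun t => pq s (heatPot N η x t)) t + lapl (fun y => pq s (heatPot N η y t)) x| ≤ C1 * (pq (s - 2) (heatPot N η x t) * Rf N η x t) := by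
  have hm1 : 1 < q / (q - 1) := by rw [lt_div_iff₀ (by linarith)]; linarith
  have hs2 : 2 < s := by linarith
  have hc := h_cda hη hs x ht
  have hcx := slice_x (f := fun y s => heatPot N η y s) hc
  have hct := slice_t (f := fun y s => heatPot N η y s) hc
  have h0 : 0 ≤ heatPot N η x t := h_nonneg (fun y => (h01 y).1) x ht
  have hP : ContDiff ℝ 2 (pq s) := c2_of (pq_deriv (by linarith)) (pq_deriv2 hs2) (by have := pq_cont (s := s - 2) (by linarith); fun_prop)
  refine ⟨hP.contDiffAt.comp (x, t) hc, fun i => ?_, ?_⟩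
  · rw [dd_comp i (hcx.differentiableAt (by norm_num)) (pq_deriv (by linarith) _), abs_mul, abs_neg, abs_mul, abs_of_pos (by linarith : 0 < s), abs_of_nonneg (pq_nn _ _)]
    have h1 := pq_le (s := s - 1) (by linarith) h0
    have h2 := pq_nn (s - 1) (heatPot N η x t)
    have h3 := dd_le i (fun y => heatPot N η y t) x
    calc _ ≤ s * 1 * ‖fderiv ℝ (fun y => heatPot N η y t) x‖ := by gcongr
      _ = _ := by ring
  · have e1 : deriv (fun t => pq s (heatPot N η x t)) t = -(s * pq (s - 1) (heatPot N η x t)) * deriv (heatPot N η x) t :=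
      ((pq_deriv (s := s) (by linarith) (heatPot N η x t)).comp t (hct.differentiableAt (by norm_num)).hasDerivAt).deriv
    rw [e1, lapl_comp hcx (Eventually.of_forall fun w => pq_deriv (by linarith) w) (pq_deriv2 hs2 _), ← h_heat hη hs x ht]
    set v := heatPot N η x t
    have h1 := pq_anti (s := s - 2) (s' := s - 1) (by linarith) (by linarith) h0
    have h2 := pq_nn (s - 1) v
    have h3 := pq_nn (s - 2) v
    have hsum : ∑ i, dd i (fun y => heatPot N η y t) x ^ 2 ≤ N * ‖fderiv ℝ (fun y => heatPot N η y t) x‖ ^ 2 := by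
      calc _ ≤ ∑ i : Fin N, ‖fderiv ℝ (fun y => heatPot N η y t) x‖ ^ 2 := Finset.sum_le_sum fun i _ => by
            rw [← sq_abs]; exact pow_le_pow_left₀ (abs_nonneg _) (dd_le i _ x) 2
        _ = _ := by simp
    have hsum0 : 0 ≤ ∑ i, dd i (fun y => heatPot N η y t) x ^ 2 := Finset.sum_nonneg fun i _ => sq_nonneg _
    set S := ∑ i, dd i (fun y => heatPot N η y t) x ^ 2
    have hR : Rf N η x t = ‖fderiv ℝ (fun y => heatPot N η y t) x‖ ^ 2 + |deriv (heatPot N η x) t| := rfl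
    rw [hR, hC1]
    set G := ‖fderiv ℝ (fun y => heatPot N η y t) x‖ ^ 2 with hG
    have hG0 : 0 ≤ G := sq_nonneg _
    set D := deriv (heatPot N η x) t
    have hD := abs_nonneg D
    have hN : (0:ℝ) ≤ N := by positivity
    have hss : 0 < s * (s - 1) := mul_pos (by linarith) (by linarith)
    have hs0 : 0 < s := by linarith
    calc _ = |s * (s - 1) * pq (s - 2) v * S + -(2 * s * pq (s - 1) v) * D| := by congr 1; ring
      _ ≤ s * (s - 1) * pq (s - 2) v * S + 2 * s * pq (s - 1) v * |D| := by
        refine (abs_add_le _ _).trans (le_of_eq ?_)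
        rw [abs_mul, abs_mul (-(2 * s * pq (s - 1) v)), abs_neg, abs_of_nonneg (by positivity : 0 ≤ s * (s - 1) * pq (s - 2) v), abs_of_nonneg hsum0, abs_of_nonneg (by positivity : 0 ≤ 2 * s * pq (s - 1) v)]
      _ ≤ s * (s - 1) * pq (s - 2) v * (N * G) + 2 * s * pq (s - 2) v * |D| := by gcongr
      _ ≤ _ := by
        have k1 : 0 ≤ s * (s - 1) * N * pq (s - 2) v * |D| := by positivity
        have k2 : 0 ≤ 2 * s * pq (s - 2) v * G := by positivity
        linarith [mul_comm 1 (1:ℝ), show (s * (s - 1) * ↑N + 2 * s) * (pq (s - 2) v * (G + |D|)) = s * (s - 1) * pq (s - 2) v * (N * G) + s * (s - 1) * N * pq (s - 2) v * |D| + 2 * s * pq (s - 2) v * G + 2 * s * pq (s - 2) v * |D| by ring]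

theorem young_pt (hq : 1 < q) {s : ℝ} (hsd : s = 2 * (q / (q - 1))) {u v a C1 E : ℝ} (hu : 0 < u) (ha : 0 ≤ a) (hC1 : 0 ≤ C1)
    (hE : |E| ≤ C1 * (pq (s - 2) v * a)) :
    u * E - u ^ q * pq s v ≤ C1 ^ (q / (q - 1)) * a ^ (q / (q - 1)) - (1 - 1 / q) * (u ^ q * pq s v) := by
  have hm1 : 1 < q / (q - 1) := by rw [lt_div_iff₀ (by linarith)]; linarith
  have hcj : q.HolderConjugate (q / (q - 1)) := Real.HolderConjugate.conjExponent hq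
  have hv := pq_nn (s - 2) v
  have y := Real.young_inequality_of_nonneg (a := u * pq (s - 2) v) (b := C1 * a) (by positivity) (by positivity) hcj
  have e : pq (s - 2) v ^ q = pq s v := by
    unfold pq
    rw [← rpow_mul (le_max_right _ _)]
    congr 1
    have : q - 1 ≠ 0 := by linarith
    rw [hsd]; field_simp; ring
  rw [mul_rpow hu.le hv, e, mul_rpow hC1 ha] at y
  have h1 : u * E ≤ u * pq (s - 2) v * (C1 * a) := by
    calc u * E ≤ u * (C1 * (pq (s - 2) v * a)) := by gcongr; exact (le_abs_self _).trans hE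
      _ = _ := by ring
  have h2 : C1 ^ (q / (q - 1)) * a ^ (q / (q - 1)) / (q / (q - 1)) ≤ C1 ^ (q / (q - 1)) * a ^ (q / (q - 1)) :=
    div_le_self (by positivity) hm1.le
  have h3 : (1 - 1 / q) * (u ^ q * pq s v) = u ^ q * pq s v - u ^ q * pq s v / q := by ring
  linarith

end

section
variable {N : ℕ} {q r ρ : ℝ} {η : Euc N → ℝ} {u : Euc N → ℝ → ℝ} {K : Set (Euc N)}

theorem slab_mono {τ τ' T : ℝ} (h : τ ≤ τ') : slab N τ' T ≤ slab N τ T := by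
  unfold slab
  apply Measure.prod_mono le_rfl
  exact Measure.restrict_mono (Ioc_subset_Ioc_left h) le_rfl

theorem energy1 (hq : 1 < q) (h : IsSol N q u K) (hr : 0 < r) (hK : K ⊆ ball 0 r) (hη : TestFun N r ρ K η)
    {s C1 : ℝ} (hsd : s = 2 * (q / (q - 1))) (hC1 : C1 = s * (s - 1) * N + 2 * s) {τ T : ℝ} (hτ : 0 < τ) (hT : τ ≤ T) :
    (∫ y, u y T * pq s (heatPot N η y T)) + (1 - 1 / q) * ∫ p, u p.1 p.2 ^ q * pq s (heatPot N η p.1 p.2) ∂(slab N τ T) ≤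
      C1 ^ (q / (q - 1)) * Rnorm N q η + ∫ y, u y τ * pq s (heatPot N η y τ) := by
  obtain ⟨h1, h2, h3, h4, h5⟩ := hη
  have hm1 : 1 < q / (q - 1) := by rw [lt_div_iff₀ (by linarith)]; linarith
  have hs2 : 2 < s := by linarith
  have hC0 : 0 ≤ C1 := by rw [hC1]; have : 0 < s * (s - 1) := mul_pos (by linarith) (by linarith); positivity
  have pt := fun x t (ht : 0 < t) => energy_pt hq h1 h2 h4 hsd hC1 x (t := t) ht
  have bd := fun x t (ht : τ ≤ t) => Rf_bdd h1 h2 h4 hτ x (t := t) ht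
  have nn : ∀ x t, 0 < t → 0 ≤ heatPot N η x t := fun x t ht => h_nonneg (fun y => (h4 y).1) x ht
  have hc := cm_pos N
  set B := max 1 (max (s * (cm N / √τ)) (C1 * (1 * ((cm N / √τ) ^ 2 + cm N * (N + 1) / τ)))) with hB
  have hΦ1 : ∀ y t, 0 < t → |pq s (heatPot N η y t)| ≤ 1 := fun y t ht => by
    rw [abs_of_nonneg (pq_nn _ _)]; exact pq_le (by linarith) (nn _ _ ht)
  have w := weak hq h hr hK hτ hT (Φ := fun y t => pq s (heatPot N η y t)) (B := B)
    (fun y t ht => (pt y t (hτ.trans_le ht.1)).1)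
    (fun y t ht => (hΦ1 y t (hτ.trans_le ht.1)).trans (le_max_left _ _))
    (fun y t ht i => ((pt y t (hτ.trans_le ht.1)).2.1 i).trans <| by
      refine le_trans ?_ ((le_max_left _ _).trans (le_max_right _ _))
      exact mul_le_mul_of_nonneg_left (bd y t ht.1).1 (by linarith))
    (fun y t ht => ((pt y t (hτ.trans_le ht.1)).2.2).trans <| by
      refine le_trans ?_ ((le_max_right _ _).trans (le_max_right _ _))
      refine mul_le_mul_of_nonneg_left (mul_le_mul (pq_le (by linarith) (nn _ _ (hτ.trans_le ht.1))) (bd y t ht.1).2 (Rf_nonneg _ _) zero_le_one) hC0)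
  have R := R_slab hq h1 h2 h4 hτ T
  have cΦ : ∀ p : Euc N × ℝ, p.2 ∈ Icc τ T → ContinuousAt (fun p : Euc N × ℝ => pq s (heatPot N η p.1 p.2)) p := fun p hp =>
    (pt p.1 p.2 (hτ.trans_le hp.1)).1.continuousAt
  have iq := (u_int hq h hr hK hτ (T := T) cΦ (fun p hp => hΦ1 p.1 p.2 (hτ.trans_le hp.1))).2
  have iE := (u_int hq h hr hK hτ (T := T) (G := fun p => deriv (fun t => pq s (heatPot N η p.1 t)) p.2 + lapl (fun y => pq s (heatPot N η y p.2)) p.1) (B := C1 * (1 * ((cm N / √τ) ^ 2 + cm N * (N + 1) / τ))) 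
    (fun p hp => by
      have c := (pt p.1 p.2 (hτ.trans_le hp.1)).1
      exact (slice_cont_deriv (f := fun y t => pq s (heatPot N η y t)) c).add (slice_cont_lapl (f := fun y t => pq s (heatPot N η y t)) c))
    (fun p hp => ((pt p.1 p.2 (hτ.trans_le hp.1)).2.2).trans <| by
      refine mul_le_mul_of_nonneg_left (mul_le_mul (pq_le (by linarith) (nn _ _ (hτ.trans_le hp.1))) (bd p.1 p.2 hp.1).2 (Rf_nonneg _ _) zero_le_one) hC0)).1
  have le : ∫ p, (u p.1 p.2 * (deriv (fun t => pq s (heatPot N η p.1 t)) p.2 + lapl (fun y => pq s (heatPot N η y p.2)) p.1) - u p.1 p.2 ^ q * pq s (heatPot N η p.1 p.2)) ∂(slab N τ T) ≤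
      ∫ p, (C1 ^ (q / (q - 1)) * Rf N η p.1 p.2 ^ (q / (q - 1)) - (1 - 1 / q) * (u p.1 p.2 ^ q * pq s (heatPot N η p.1 p.2))) ∂(slab N τ T) := by
    apply integral_mono_ae (iE.sub iq) ((R.1.const_mul _).sub (iq.const_mul _))
    filter_upwards [slab_ae] with p hp
    have hp0 : 0 < p.2 := hτ.trans hp.1
    exact young_pt hq hsd (h.2.1 p.1 p.2 hp0) (Rf_nonneg _ _) hC0 (pt p.1 p.2 hp0).2.2
  rw [integral_sub (R.1.const_mul _) (iq.const_mul _), integral_const_mul, integral_const_mul] at le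
  rw [← w] at le
  have := mul_le_mul_of_nonneg_left R.2 (rpow_nonneg hC0 (q / (q - 1)))
  linarith

theorem energy_init (hq : 1 < q) (h : IsSol N q u K) (hr : 0 < r) (hK : K ⊆ ball 0 r) (hη : TestFun N r ρ K η)
    {s : ℝ} (hs : 0 < s) :
    Tendsto (fun t => ∫ y, u y t * pq s (heatPot N η y t)) (nhdsWithin 0 (Ioi 0)) (nhds 0) := by
  obtain ⟨h1, h2, h3, h4, h5⟩ := hη
  obtain ⟨L, hL⟩ := (h1.of_le (WithTop.coe_le_coe.2 (le_top : (1:ℕ∞) ≤ ⊤))).lipschitzWith_of_hasCompactSupport h2 (by norm_num)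
  have hc := cm_pos N
  have hL' : ∀ x y : Euc N, |η y - η x| ≤ L * ‖y - x‖ := fun x y => by
    have := hL.dist_le_mul y x
    rwa [Real.dist_eq, dist_eq_norm] at this
  set κ : ℝ := (1 / (8 * (L * cm N + 1))) ^ 2 with hκ
  have hL0 : (0:ℝ) ≤ L := L.2
  have hκ0 : 0 < κ := by positivity
  refine init_lim hq h hr hK (U := {y | 15 / 16 < η y}) (isOpen_lt continuous_const h1.continuous) (fun y hy => by
    show 15 / 16 < η y
    rw [h5 y hy]; norm_num) (B := 1) hκ0 ?_ ?_ ?_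
  · intro t ht
    exact (pq_cont hs).comp (continuous_iff_continuousAt.2 fun y => (slice_x (f := fun y t => heatPot N η y t) (h_cda h1 h2 y ht.1)).continuousAt)
  · intro t ht y
    rw [abs_of_nonneg (pq_nn _ _)]; exact pq_le hs.le (h_nonneg (fun y => (h4 y).1) y ht.1)
  · intro t ht y hy
    apply pq_zero hs
    have hl := h_lip hL0 h1.continuous (B := 1) (fun y => by rw [abs_of_nonneg (h4 y).1]; exact (h4 y).2) hL' y ht.1
    have hy' : 15 / 16 < η y := hy
    have hst : √t ≤ 1 / (8 * (L * cm N + 1)) := by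
      rw [← sqrt_sq (by positivity : (0:ℝ) ≤ 1 / (8 * (L * cm N + 1)))]
      exact sqrt_le_sqrt ht.2.le
    have : L * (cm N * √t) ≤ 1 / 8 := by
      calc L * (cm N * √t) = (L * cm N) * √t := by ring
        _ ≤ (L * cm N + 1) * (1 / (8 * (L * cm N + 1))) := by gcongr; linarith
        _ = 1 / 8 := by field_simp
    have := abs_le.1 (hl.trans this)
    linarith

theorem energy (N : ℕ) (hq : 1 < q) : ∃ C : ℝ, 0 < C ∧ ∀ {r ρ : ℝ} {K : Set (Euc N)} {η : Euc N → ℝ} {u : Euc N → ℝ → ℝ},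
    IsSol N q u K → 0 < r → K ⊆ ball 0 r → TestFun N r ρ K η → 
    ∀ {G : Euc N → ℝ} {B : ℝ}, Continuous G → (∀ y, 0 ≤ G y ∧ G y ≤ B) → (∀ y, ‖y‖ < r + ρ → G y = 0) →
    (∀ T, 0 < T → ∫ y, u y T * G y ≤ C * B * Rnorm N q η) ∧
    (∀ τ T, 0 < τ → τ ≤ T → ∫ p, u p.1 p.2 ^ q * G p.1 ∂(slab N τ T) ≤ C * B * Rnorm N q η) := by
  set s := 2 * (q / (q - 1)) with hsd
  set C1 := s * (s - 1) * N + 2 * s with hC1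
  have hm1 : 1 < q / (q - 1) := by rw [lt_div_iff₀ (by linarith)]; linarith
  have hs2 : 2 < s := by linarith
  have hC0 : 0 < C1 := by rw [hC1]; have : 0 < s * (s - 1) := mul_pos (by linarith) (by linarith); positivity
  have hq1 : 0 < 1 - 1 / q := by rw [sub_pos, div_lt_one (by linarith)]; exact hq
  have hq2 : 1 - 1 / q ≤ 1 := by have : 0 < 1 / q := by positivity
                                 linarith
  set C2 := C1 ^ (q / (q - 1)) with hC2
  have hC2p : 0 < C2 := by positivity
  have h4s : (0:ℝ) < (1/4) ^ s := by positivity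
  refine ⟨C2 / (1 - 1 / q) / (1 / 4) ^ s, by positivity, ?_⟩
  intro r ρ K η u h hr hK hη G B hG hGB hG0
  have hB0 : 0 ≤ B := (hGB 0).1.trans (hGB 0).2
  have e0 := energy_init hq h hr hK hη (s := s) (by linarith)
  have e1 := fun {τ T : ℝ} (hτ : 0 < τ) (hT : τ ≤ T) => energy1 hq h hr hK hη hsd hC1 hτ hT
  obtain ⟨h1, h2, h3, h4, h5⟩ := hη
  have nn : ∀ x t, 0 < t → 0 ≤ heatPot N η x t := fun x t ht => h_nonneg (fun y => (h4 y).1) x ht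
  have hΦ1 : ∀ y t, 0 < t → |pq s (heatPot N η y t)| ≤ 1 := fun y t ht => by
    rw [abs_of_nonneg (pq_nn _ _)]; exact pq_le (by linarith) (nn _ _ ht)
  have cΦ : ∀ p : Euc N × ℝ, 0 < p.2 → ContinuousAt (fun p : Euc N × ℝ => pq s (heatPot N η p.1 p.2)) p := fun p hp =>
    (energy_pt hq h1 h2 h4 hsd hC1 p.1 hp).1.continuousAt
  have iq := fun {τ T : ℝ} (hτ : 0 < τ) => (u_int hq h hr hK hτ (T := T) (fun p hp => cΦ p (hτ.trans_le hp.1)) (fun p hp => hΦ1 p.1 p.2 (hτ.trans_le hp.1))).2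
  have GΦ : ∀ y t, 0 < t → G y ≤ B / (1 / 4) ^ s * pq s (heatPot N η y t) := by
    intro y t ht
    rcases lt_or_ge ‖y‖ (r + ρ) with hy | hy
    · rw [hG0 y hy]; exact mul_nonneg (by positivity) (pq_nn _ _)
    · calc G y ≤ B := (hGB y).2
        _ = B / (1 / 4) ^ s * (1 / 4) ^ s := by field_simp
        _ ≤ _ := by gcongr; exact pq_ge (by linarith) (h_half h1.continuous h4 h3 y hy ht)
  have key : ∀ {τ T : ℝ}, 0 < τ → τ ≤ T → (∫ y, u y T * pq s (heatPot N η y T)) + (1 - 1 / q) * ∫ p, u p.1 p.2 ^ q * pq s (heatPot N η p.1 p.2) ∂(slab N τ T) ≤ C2 * Rnorm N q η := by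
    intro τ T hτ hT
    have l : Tendsto (fun t => C2 * Rnorm N q η + ∫ y, u y t * pq s (heatPot N η y t)) (nhdsWithin 0 (Ioi 0)) (nhds (C2 * Rnorm N q η + 0)) :=
      tendsto_const_nhds.add e0
    rw [add_zero] at l
    apply ge_of_tendsto l
    filter_upwards [Ioo_mem_nhdsGT hτ] with t ht
    refine le_trans ?_ (e1 ht.1 (ht.2.le.trans hT))
    have hmono : ∫ p, u p.1 p.2 ^ q * pq s (heatPot N η p.1 p.2) ∂(slab N τ T) ≤ ∫ p, u p.1 p.2 ^ q * pq s (heatPot N η p.1 p.2) ∂(slab N t T) := by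
      apply integral_mono_measure (slab_mono ht.2.le) _ (iq ht.1)
      filter_upwards [slab_ae] with p hp
      exact mul_nonneg (rpow_nonneg (h.2.1 p.1 p.2 (ht.1.trans hp.1)).le _) (pq_nn _ _)
    have := mul_le_mul_of_nonneg_left hmono hq1.le
    linarith
  have key1 : ∀ T, 0 < T → ∫ y, u y T * pq s (heatPot N η y T) ≤ C2 * Rnorm N q η := by
    intro T hT
    have := key hT le_rfl
    have h0 : 0 ≤ ∫ p, u p.1 p.2 ^ q * pq s (heatPot N η p.1 p.2) ∂(slab N T T) := by
      apply integral_nonneg_of_ae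
      filter_upwards [slab_ae] with p hp
      exact mul_nonneg (rpow_nonneg (h.2.1 p.1 p.2 (hT.trans hp.1)).le _) (pq_nn _ _)
    have := mul_nonneg hq1.le h0
    linarith
  have key2 : ∀ τ T, 0 < τ → τ ≤ T → ∫ p, u p.1 p.2 ^ q * pq s (heatPot N η p.1 p.2) ∂(slab N τ T) ≤ C2 / (1 - 1 / q) * Rnorm N q η := by
    intro τ T hτ hT
    have := key hτ hT
    have h0 : 0 ≤ ∫ y, u y T * pq s (heatPot N η y T) := 
      integral_nonneg fun y => mul_nonneg (h.2.1 y T (hτ.trans_le hT)).le (pq_nn _ _)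
    rw [div_mul_eq_mul_div, le_div_iff₀ hq1]
    linarith
  have hM : 0 ≤ C2 * Rnorm N q η := le_trans (integral_nonneg fun y => mul_nonneg (h.2.1 y 1 one_pos).le (pq_nn _ _)) (key1 1 one_pos)
  have hM' : 0 ≤ Rnorm N q η := nonneg_of_mul_nonneg_right hM hC2p
  have hCC : C2 ≤ C2 / (1 - 1 / q) := le_div_self hC2p.le hq1 hq2
  constructor
  · intro T hT
    calc ∫ y, u y T * G y ≤ ∫ y, B / (1 / 4) ^ s * (u y T * pq s (heatPot N η y T)) := by
          apply integral_mono
          · exact u_int_slice hq h hr hK hT hG (B := B) fun y => by rw [abs_of_nonneg (hGB y).1]; exact (hGB y).2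
          · apply Integrable.const_mul
            refine u_int_slice hq h hr hK hT (B := 1) ?_ (fun y => hΦ1 y T hT)
            exact (pq_cont (by linarith)).comp (continuous_iff_continuousAt.2 fun y => (slice_x (f := fun y t => heatPot N η y t) (h_cda h1 h2 y hT)).continuousAt)
          · intro y
            have := mul_le_mul_of_nonneg_left (GΦ y T hT) (h.2.1 y T hT).le
            simp only; linarith
      _ = B / (1 / 4) ^ s * ∫ y, u y T * pq s (heatPot N η y T) := integral_const_mul _ _
      _ ≤ B / (1 / 4) ^ s * (C2 / (1 - 1 / q) * Rnorm N q η) := by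
          gcongr
          exact (key1 T hT).trans (by gcongr)
      _ = _ := by ring
  · intro τ T hτ hT
    calc ∫ p, u p.1 p.2 ^ q * G p.1 ∂(slab N τ T) ≤ ∫ p, B / (1 / 4) ^ s * (u p.1 p.2 ^ q * pq s (heatPot N η p.1 p.2)) ∂(slab N τ T) := by
          apply integral_mono_ae
          · exact (u_int hq h hr hK hτ (T := T) (G := fun p => G p.1) (B := B) (fun p _ => (hG.comp continuous_fst).continuousAt) fun p _ => by rw [abs_of_nonneg (hGB _).1]; exact (hGB _).2).2
          · exact (iq hτ).const_mul _
          · filter_upwards [slab_ae] with p hp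
            have hp0 := hτ.trans hp.1
            have := mul_le_mul_of_nonneg_left (GΦ p.1 p.2 hp0) (rpow_nonneg (h.2.1 p.1 p.2 hp0).le q)
            linarith
      _ = B / (1 / 4) ^ s * ∫ p, (u p.1 p.2 ^ q * pq s (heatPot N η p.1 p.2)) ∂(slab N τ T) := integral_const_mul _ _
      _ ≤ B / (1 / 4) ^ s * (C2 / (1 - 1 / q) * Rnorm N q η) := by
          gcongr
          exact key2 τ T hτ hT
      _ = _ := by ring
end

theorem posp_deriv {f g : ℝ → ℝ} (hf0 : f 0 = 0) (hg0 : g 0 = 0) (hd : ∀ z, 0 < z → HasDerivAt f (g z) z)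
    (cf : ContinuousOn f (Ici 0)) (cg : ContinuousOn g (Ici 0)) (z : ℝ) : HasDerivAt (fun z => f (max z 0)) (g (max z 0)) z := by
  have key : ∀ z : ℝ, z ≠ 0 → HasDerivAt (fun z => f (max z 0)) (g (max z 0)) z := by
    intro w hw
    rcases lt_or_gt_of_ne hw with h | h
    · rw [max_eq_right h.le, hg0]
      apply (hasDerivAt_const w (0:ℝ)).congr_of_eventuallyEq
      filter_upwards [gt_mem_nhds h] with z hz
      rw [max_eq_right hz.le, hf0]
    · rw [max_eq_left h.le]
      apply (hd w h).congr_of_eventuallyEq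
      filter_upwards [lt_mem_nhds h] with z hz
      rw [max_eq_left hz.le]
  have cc : ∀ {f : ℝ → ℝ}, ContinuousOn f (Ici 0) → Continuous fun z : ℝ => f (max z 0) := fun hf =>
    hf.comp_continuous (by fun_prop) (fun z => le_max_right z 0)
  by_cases hw : z = 0
  · subst hw
    exact hasDerivAt_of_hasDerivAt_of_ne (f := fun z : ℝ => f (max z 0)) (g := fun z : ℝ => g (max z 0)) (x := 0) (fun y hy => key y hy) (cc cf).continuousAt (cc cg).continuousAt
  · exact key z hw

/-- profile -/
def pf (z : ℝ) : ℝ := z ^ 3 / (1 + z) ^ 2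
def pf1 (z : ℝ) : ℝ := z ^ 2 * (z + 3) / (1 + z) ^ 3
def pf2 (z : ℝ) : ℝ := 6 * z / (1 + z) ^ 4

theorem pf_cont : ContinuousOn pf (Ici 0) ∧ ContinuousOn pf1 (Ici 0) ∧ ContinuousOn pf2 (Ici 0) := by
  refine ⟨?_, ?_, ?_⟩
  all_goals
    refine ContinuousOn.div (by fun_prop) (by fun_prop) ?_
    intro z hz
    have : (0:ℝ) ≤ z := hz
    positivity

theorem pf_d1 (z : ℝ) : HasDerivAt (fun z => pf (max z 0)) (pf1 (max z 0)) z := by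
  refine posp_deriv (by norm_num [pf]) (by norm_num [pf1]) ?_ pf_cont.1 pf_cont.2.1 z
  intro z hz
  have h1 : (1 + z) ^ 2 ≠ 0 := by positivity
  have := (hasDerivAt_pow 3 z).div (((hasDerivAt_id z).const_add 1).pow 2) h1
  refine this.congr_deriv ?_
  unfold pf1
  simp
  field_simp
  ring

theorem pf_d2 (z : ℝ) : HasDerivAt (fun z => pf1 (max z 0)) (pf2 (max z 0)) z := by
  refine posp_deriv (by norm_num [pf1]) (by norm_num [pf2]) ?_ pf_cont.2.1 pf_cont.2.2 z
  intro z hz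
  have h1 : (1 + z) ^ 3 ≠ 0 := by positivity
  have := ((hasDerivAt_pow 2 z).mul ((hasDerivAt_id z).add_const 3)).div (((hasDerivAt_id z).const_add 1).pow 3) h1
  refine this.congr_deriv ?_
  unfold pf2
  simp
  field_simp
  ring

theorem pf_bd {z : ℝ} (hz : 0 ≤ z) : 0 ≤ pf z ∧ z - 2 ≤ pf z ∧ pf z ≤ z ∧ 0 ≤ pf1 z ∧ pf1 z ≤ 1 ∧ 0 ≤ pf2 z ∧ pf2 z ≤ 6 := by
  refine ⟨by unfold pf; positivity, ?_, ?_, by unfold pf1; positivity, ?_, by unfold pf2; positivity, ?_⟩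
  · unfold pf; rw [le_div_iff₀ (by positivity)]; nlinarith
  · unfold pf; rw [div_le_iff₀ (by positivity)]; nlinarith [sq_nonneg z]
  · unfold pf1; rw [div_le_one (by positivity)]; nlinarith [sq_nonneg z]
  · unfold pf2; rw [div_le_iff₀ (by positivity)]
    have : 1 + z ≤ (1 + z) ^ 4 := le_self_pow₀ (by linarith) (by norm_num)
    linarith

theorem pf2_lb {z : ℝ} (hz : 1 / 2 ≤ z) (hz1 : z ≤ 1) : 3 / 16 ≤ pf2 z := by
  unfold pf2
  rw [le_div_iff₀ (by positivity)]
  have : (1 + z) ^ 4 ≤ 2 ^ 4 := pow_le_pow_left₀ (by linarith) (by linarith) 4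
  linarith

theorem shell_fun {N : ℕ} {R δ : ℝ} (hR : 0 < R) (hδ : 0 < δ) (hδR : δ ≤ R) :
    ∃ (ψ : Euc N → ℝ) (B : ℝ), ContDiff ℝ 2 ψ ∧ (∀ y, 0 ≤ ψ y ∧ ψ y ≤ δ * R) ∧ (∀ y, ‖y‖ ≤ R → ψ y = 0) ∧
      (∀ y, (∀ i, |dd i ψ y| ≤ B) ∧ |lapl ψ y| ≤ B) ∧ (∀ y, ‖y‖ ≤ R → 0 ≤ lapl ψ y) ∧ (∀ y, -(24 * (δ / R)) ≤ lapl ψ y) ∧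
      ∀ y, 1 / 2 ≤ (‖y‖ ^ 2 - R ^ 2) / (R * δ) → (‖y‖ ^ 2 - R ^ 2) / (R * δ) ≤ 1 → 3 / 16 - 24 * (δ / R) ≤ lapl ψ y := by
  set a := δ / R with ha
  have ha0 : 0 < a := by positivity
  have ha1 : a ≤ 1 := by rw [ha, div_le_one hR]; exact hδR
  set Z : ℝ → ℝ := fun w => (w - R ^ 2) / (R * δ) with hZ
  set M : ℝ → ℝ := fun w => max (Z w) 0 with hM
  set D : ℝ → ℝ := fun w => 1 + a * pf (M w) with hD
  have M0 : ∀ w, 0 ≤ M w := fun w => le_max_right _ _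
  have D1 : ∀ w, 1 ≤ D w := fun w => by simp only [hD]; have := (pf_bd (M0 w)).1; nlinarith
  have D0 : ∀ w, 0 < D w := fun w => by linarith [D1 w]
  set F : ℝ → ℝ := fun w => δ * R * (1 - 1 / D w) with hF
  set F1 : ℝ → ℝ := fun w => a * pf1 (M w) / D w ^ 2 with hF1
  set F2 : ℝ → ℝ := fun w => (a * pf2 (M w) / D w ^ 2 - 2 * a ^ 2 * pf1 (M w) ^ 2 / D w ^ 3) / (R * δ) with hF2
  have dZ : ∀ w, HasDerivAt Z (1 / (R * δ)) w := fun w => by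
    exact ((hasDerivAt_id w).sub_const _).div_const _
  have dp : ∀ w, HasDerivAt (fun w => pf (M w)) (pf1 (M w) * (1 / (R * δ))) w := fun w => (pf_d1 (Z w)).comp w (dZ w)
  have dp1 : ∀ w, HasDerivAt (fun w => pf1 (M w)) (pf2 (M w) * (1 / (R * δ))) w := fun w => (pf_d2 (Z w)).comp w (dZ w)
  have dD : ∀ w, HasDerivAt D (a * (pf1 (M w) * (1 / (R * δ)))) w := fun w => ((dp w).const_mul a).const_add 1
  have dF : ∀ w, HasDerivAt F (F1 w) w := fun w => by
    have := (((hasDerivAt_const w (1:ℝ)).div (dD w) (D0 w).ne').const_sub 1).const_mul (δ * R)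
    refine this.congr_deriv ?_
    simp only [hF1]
    have := (D0 w).ne'
    field_simp
    ring
  have dF1 : ∀ w, HasDerivAt F1 (F2 w) w := fun w => by
    have hn := (D0 w).ne'
    have := ((dp1 w).const_mul a).div ((dD w).pow 2) (pow_ne_zero 2 hn)
    refine this.congr_deriv ?_
    simp only [hF2]
    simp
    field_simp
  have cM : Continuous M := by simp only [hM, hZ]; fun_prop
  have c0 : Continuous fun w => pf (M w) := pf_cont.1.comp_continuous cM M0
  have c1 : Continuous fun w => pf1 (M w) := pf_cont.2.1.comp_continuous cM M0
  have c2 : Continuous fun w => pf2 (M w) := pf_cont.2.2.comp_continuous cM M0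
  have cD : Continuous D := by simp only [hD]; fun_prop
  have cF2 : Continuous F2 := by
    simp only [hF2]
    refine ((Continuous.div (by fun_prop) (by fun_prop) fun w => ?_).sub (Continuous.div (by fun_prop) (by fun_prop) fun w => ?_)).div_const _
    · exact pow_ne_zero 2 (D0 w).ne'
    · exact pow_ne_zero 3 (D0 w).ne'
  have CF : ContDiff ℝ 2 F := c2_of dF dF1 cF2
  have lap : ∀ y : Euc N, lapl (fun y => F (‖y‖ ^ 2)) y = F2 (‖y‖ ^ 2) * (4 * ‖y‖ ^ 2) + F1 (‖y‖ ^ 2) * (2 * N) := fun y =>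
    lapl_rad0 y (Eventually.of_forall dF) (dF1 _)
  have Ms : ∀ w, w ≤ R ^ 2 → M w = 0 := fun w hw => by
    simp only [hM, hZ]
    exact max_eq_right (div_nonpos_of_nonpos_of_nonneg (by linarith) (by positivity))
  have z0 : pf 0 = 0 ∧ pf1 0 = 0 ∧ pf2 0 = 0 := ⟨by norm_num [pf], by norm_num [pf1], by norm_num [pf2]⟩
  have ins : ∀ y : Euc N, ‖y‖ ≤ R → M (‖y‖ ^ 2) = 0 := fun y hy => Ms _ (by gcongr)
  have lap0 : ∀ y : Euc N, ‖y‖ ≤ R → lapl (fun y => F (‖y‖ ^ 2)) y = 0 := fun y hy => by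
    rw [lap]; simp only [hF2, hF1]; rw [ins y hy, z0.2.1, z0.2.2]; simp
  have wle : ∀ w, w ≤ 3 * R ^ 2 * D w := fun w => by
    rcases le_total w (R ^ 2) with h | h
    · nlinarith [D1 w, sq_nonneg R, mul_pos hR hR]
    · have e : M w = Z w := by simp only [hM, hZ]; exact max_eq_left (div_nonneg (by linarith) (by positivity))
      have e2 : w = R ^ 2 * (1 + a * M w) := by
        rw [e]; simp only [hZ, ha]; field_simp; ring
      have := (pf_bd (M0 w)).2.1
      have k : 1 + a * M w ≤ 3 * D w := by
        simp only [hD]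
        nlinarith [mul_le_mul_of_nonneg_left this ha0.le, mul_nonneg ha0.le (pf_bd (M0 w)).1]
      calc w = R ^ 2 * (1 + a * M w) := e2
        _ ≤ R ^ 2 * (3 * D w) := by gcongr
        _ = _ := by ring
  have aR : a * R ^ 2 = R * δ := by rw [ha]; field_simp
  -- the three parts
  have part1 : ∀ w, 0 ≤ w → 2 * a ^ 2 * pf1 (M w) ^ 2 / D w ^ 3 / (R * δ) * (4 * w) ≤ 24 * a := fun w hw => by
    obtain ⟨-, -, -, b1, b2, -, -⟩ := pf_bd (M0 w)
    have hD0 := D0 w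
    have hp1 : pf1 (M w) ^ 2 ≤ 1 := pow_le_one₀ b1 b2
    calc _ ≤ 2 * a ^ 2 * 1 / D w ^ 3 / (R * δ) * (4 * (3 * R ^ 2 * D w)) := by
          gcongr; exact wle w
      _ = 24 * a * (a * R ^ 2) / (R * δ) / D w ^ 2 := by field_simp; ring
      _ = 24 * a / D w ^ 2 := by rw [aR]; field_simp
      _ ≤ 24 * a := div_le_self (by positivity) (one_le_pow₀ (D1 w))
  have part1' : ∀ w, 0 ≤ w → 0 ≤ 2 * a ^ 2 * pf1 (M w) ^ 2 / D w ^ 3 / (R * δ) * (4 * w) := fun w hw => by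
    have hD0 := D0 w
    positivity
  have part2 : ∀ w, 0 ≤ w → a * pf2 (M w) / D w ^ 2 / (R * δ) * (4 * w) ≤ 72 := fun w hw => by
    obtain ⟨-, -, -, -, -, b1, b2⟩ := pf_bd (M0 w)
    have hD0 := D0 w
    calc _ ≤ a * 6 / D w ^ 2 / (R * δ) * (4 * (3 * R ^ 2 * D w)) := by
          gcongr; exact wle w
      _ = 72 * (a * R ^ 2) / (R * δ) / D w := by field_simp; ring
      _ = 72 / D w := by rw [aR]; field_simp
      _ ≤ 72 := div_le_self (by positivity) (D1 w)
  have part2' : ∀ w, 0 ≤ w → 0 ≤ a * pf2 (M w) / D w ^ 2 / (R * δ) * (4 * w) := fun w hw => by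
    have hD0 := D0 w
    have := (pf_bd (M0 w)).2.2.2.2.2.1
    positivity
  have part3' : ∀ w, 0 ≤ F1 w := fun w => by
    have hD0 := D0 w
    have := (pf_bd (M0 w)).2.2.2.1
    simp only [hF1]; positivity
  have part3 : ∀ w, F1 w ≤ a / D w ^ 2 := fun w => by
    have hD0 := D0 w
    obtain ⟨-, -, -, b1, b2, -, -⟩ := pf_bd (M0 w)
    simp only [hF1]
    gcongr
    nlinarith
  have part4 : ∀ w, F1 w ≤ 1 := fun w => (part3 w).trans ((div_le_self ha0.le (one_le_pow₀ (D1 w))).trans ha1)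
  have dec : ∀ y : Euc N, lapl (fun y => F (‖y‖ ^ 2)) y = a * pf2 (M (‖y‖ ^ 2)) / D (‖y‖ ^ 2) ^ 2 / (R * δ) * (4 * ‖y‖ ^ 2)
      - 2 * a ^ 2 * pf1 (M (‖y‖ ^ 2)) ^ 2 / D (‖y‖ ^ 2) ^ 3 / (R * δ) * (4 * ‖y‖ ^ 2) + F1 (‖y‖ ^ 2) * (2 * N) := fun y => by
    rw [lap]; simp only [hF2]; ring
  have hN : (0:ℝ) ≤ N := by positivity
  refine ⟨fun y => F (‖y‖ ^ 2), 72 + 24 + 2 * N + 2 + 6 * R ^ 2, CF.comp (contDiff_norm_sq ℝ), ?_, ?_, ?_, ?_, ?_, ?_⟩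
  · intro y
    have h1 : 0 < 1 / D (‖y‖ ^ 2) := one_div_pos.2 (D0 _)
    have h2 : 1 / D (‖y‖ ^ 2) ≤ 1 := by rw [div_le_one (D0 _)]; exact D1 _
    have : 0 < δ * R := by positivity
    simp only [hF]
    constructor
    · exact mul_nonneg this.le (by linarith)
    · nlinarith
  · intro y hy
    simp only [hF, hD]
    rw [ins y hy, z0.1]; simp
  · intro y
    set w := ‖y‖ ^ 2 with hw
    have hw0 : 0 ≤ w := by positivity
    have q1 := part1 w hw0
    have q2 := part1' w hw0
    have q3 := part2 w hw0
    have q4 := part2' w hw0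
    have q5 := part3' w
    have q6 := part4 w
    have q7 : F1 w * (2 * N) ≤ 1 * (2 * N) := by gcongr
    have q8 : 0 ≤ F1 w * (2 * N) := by positivity
    constructor
    · intro i
      rw [dd_rad0 i y (dF _), ← hw, abs_mul, abs_of_nonneg q5, abs_mul, abs_two]
      have hi : |y i| ≤ ‖y‖ := PiLp.norm_apply_le y i
      have hy : ‖y‖ ≤ 1 + w := by rw [hw]; nlinarith [sq_nonneg (‖y‖ - 1), norm_nonneg y]
      have hf : F1 w * w ≤ 3 * R ^ 2 := by
        have hD0 := D0 w
        calc F1 w * w ≤ a / D w ^ 2 * (3 * R ^ 2 * D w) := mul_le_mul (part3 w) (wle w) hw0 (by positivity)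
          _ = a * (3 * R ^ 2) / D w := by field_simp
          _ ≤ a * (3 * R ^ 2) := div_le_self (by positivity) (D1 w)
          _ ≤ 1 * (3 * R ^ 2) := by gcongr
          _ = _ := one_mul _
      calc F1 w * (2 * |y i|) ≤ F1 w * (2 * (1 + w)) := by gcongr; exact hi.trans hy
        _ ≤ _ := by nlinarith [sq_nonneg R]
    · rw [dec, ← hw, abs_le]
      constructor <;> nlinarith [sq_nonneg R]
  · intro y hy; rw [lap0 y hy]
  · intro y
    rw [dec]
    have hw0 : 0 ≤ ‖y‖ ^ 2 := by positivity
    have q1 := part1 _ hw0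
    have q4 := part2' _ hw0
    have q8 : 0 ≤ F1 (‖y‖ ^ 2) * (2 * N) := mul_nonneg (part3' _) (by positivity)
    linarith
  · intro y hy1 hy2
    rw [dec]
    have hw0 : 0 ≤ ‖y‖ ^ 2 := by positivity
    have q1 := part1 _ hw0
    have q8 : 0 ≤ F1 (‖y‖ ^ 2) * (2 * N) := mul_nonneg (part3' _) (by positivity)
    have eM : M (‖y‖ ^ 2) = (‖y‖ ^ 2 - R ^ 2) / (R * δ) := by simp only [hM, hZ]; exact max_eq_left (by linarith)
    have m1 : 1 / 2 ≤ M (‖y‖ ^ 2) := by rw [eM]; exact hy1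
    have m2 : M (‖y‖ ^ 2) ≤ 1 := by rw [eM]; exact hy2
    have hw1 : R ^ 2 ≤ ‖y‖ ^ 2 := by
      have : 0 ≤ (‖y‖ ^ 2 - R ^ 2) / (R * δ) := by linarith
      have := (le_div_iff₀ (by positivity : 0 < R * δ)).1 this
      linarith
    set w := ‖y‖ ^ 2
    have hD2 : D w ≤ 2 := by
      simp only [hD]
      have b := (pf_bd (M0 w)).2.2.1
      have b0 := (pf_bd (M0 w)).1
      nlinarith
    have hD0 := D0 w
    have hp2 := pf2_lb m1 m2
    have : 3 / 16 ≤ a * pf2 (M w) / D w ^ 2 / (R * δ) * (4 * w) := by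
      calc (3 / 16 : ℝ) = a * (3 / 16) / 2 ^ 2 / (R * δ) * (4 * R ^ 2) := by
            rw [← aR]; field_simp; norm_num
        _ ≤ _ := by gcongr
    linarith

/-- radial variable -/
def zz {N : ℕ} (R δ : ℝ) (y : Euc N) : ℝ := (‖y‖ ^ 2 - R ^ 2) / (R * δ)

theorem zz_cont {N : ℕ} (R δ : ℝ) : Continuous (zz (N := N) R δ) := by unfold zz; fun_prop

/-- shell indicator -/
def sh {N : ℕ} (R δ : ℝ) : Set (Euc N × ℝ) := {p | 1 / 2 ≤ zz R δ p.1 ∧ zz R δ p.1 ≤ 1}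

theorem sh_meas {N : ℕ} (R δ : ℝ) : MeasurableSet (sh (N := N) R δ) := by
  have c : Continuous fun p : Euc N × ℝ => zz R δ p.1 := (zz_cont R δ).comp continuous_fst
  exact (isClosed_le continuous_const c).measurableSet.inter (isClosed_le c continuous_const).measurableSet

theorem Rnorm_nonneg {N : ℕ} {q : ℝ} {η : Euc N → ℝ} : 0 ≤ Rnorm N q η := by
  unfold Rnorm
  refine integral_nonneg fun t => integral_nonneg fun x => ?_
  positivity

theorem u_int_sh {N : ℕ} {q : ℝ} {u : Euc N → ℝ → ℝ} {K : Set (Euc N)} {r τ T : ℝ} 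
    (hq : 1 < q) (h : IsSol N q u K) (hr : 0 < r) (hK : K ⊆ ball 0 r) (hτ : 0 < τ) (R δ : ℝ) :
    Integrable (fun p : Euc N × ℝ => (sh R δ).indicator (fun p => u p.1 p.2) p) (slab N τ T) := by
  have := (u_int hq h hr hK hτ (T := T) (G := fun _ => 1) (B := 1) (fun p _ => continuousAt_const) (by simp)).1
  simp only [mul_one] at this
  exact this.indicator (sh_meas R δ)

theorem shell_est (N : ℕ) {q : ℝ} (hq : 1 < q) : ∃ C : ℝ, 0 < C ∧ ∀ {r ρ : ℝ} {K : Set (Euc N)} {η : Euc N → ℝ} {u : Euc N → ℝ → ℝ},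
    IsSol N q u K → 0 < r → 0 < ρ → K ⊆ ball 0 r → TestFun N r ρ K η → 
    ∀ {δ τ T : ℝ}, 0 < δ → δ ≤ r + 2 * ρ → 0 < τ → τ ≤ T → T ≤ (r + 2 * ρ) ^ 2 →
    ∫ p, (sh (r + 2 * ρ) δ).indicator (fun p : Euc N × ℝ => u p.1 p.2) p ∂(slab N τ T) ≤ C * (δ * (r + 2 * ρ)) * Rnorm N q η := by
  obtain ⟨C, hC, hE⟩ := energy N hq
  refine ⟨26 * C * (16 / 3), by positivity, ?_⟩
  intro r ρ K η u h hr hρ hK hη δ τ T hδ hδR hτ hT hTR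
  set R := r + 2 * ρ with hR
  have hR0 : 0 < R := by positivity
  obtain ⟨ψ, B, cψ, ψb, ψ0, ψd, ψin, ψlow, ψsh⟩ := shell_fun (N := N) hR0 hδ hδR
  set M := Rnorm N q η with hM
  have hM0 : 0 ≤ M := Rnorm_nonneg
  have hT0 := hτ.trans_le hT
  have hδR0 : 0 < δ * R := by positivity
  -- majorant
  set g : Euc N → ℝ := fun y => min 1 (max 0 ((‖y‖ - (r + ρ)) / ρ)) with hg
  have gc : Continuous g := by simp only [hg]; fun_prop
  have g01 : ∀ y, 0 ≤ g y ∧ g y ≤ 1 := fun y => ⟨le_min zero_le_one (le_max_left _ _), min_le_left _ _⟩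
  have g0 : ∀ y, ‖y‖ < r + ρ → g y = 0 := fun y hy => by
    simp only [hg]
    rw [max_eq_left (div_nonpos_of_nonpos_of_nonneg (by linarith) hρ.le), min_eq_right zero_le_one]
  have g1 : ∀ y, R ≤ ‖y‖ → g y = 1 := fun y hy => by
    simp only [hg]
    apply min_eq_left
    apply le_max_of_le_right
    rw [le_div_iff₀ hρ]; linarith
  have Eψ := hE h hr hK hη (G := ψ) (B := δ * R) cψ.continuous ψb (fun y hy => ψ0 y (by linarith))
  have Eg := hE h hr hK hη (G := g) (B := 1) gc g01 g0
  have cψ2 : ∀ p : Euc N × ℝ, ContDiffAt ℝ 2 (fun p : Euc N × ℝ => ψ p.1) p := fun p => cψ.contDiffAt.comp p contDiffAt_fst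
  have w := weak hq h hr hK hτ hT (Φ := fun y _ => ψ y) (B := max (δ * R) B)
    (fun y s _ => cψ2 (y, s)) (fun y s _ => by rw [abs_of_nonneg (ψb y).1]; exact (ψb y).2.trans (le_max_left _ _))
    (fun y s _ i => ((ψd y).1 i).trans (le_max_right _ _)) (fun y s _ => by
      simp only [deriv_const, zero_add]
      exact (ψd y).2.trans (le_max_right _ _))
  simp only [deriv_const, zero_add] at w
  have iψ := (u_int hq h hr hK hτ (T := T) (G := fun p => ψ p.1) (B := δ * R) (fun p _ => (cψ2 p).continuousAt) (fun p _ => by rw [abs_of_nonneg (ψb _).1]; exact (ψb _).2)).2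
  have iL := (u_int hq h hr hK hτ (T := T) (G := fun p => lapl ψ p.1) (B := B) (fun p _ => slice_cont_lapl (f := fun y _ => ψ y) (cψ2 p)) (fun p _ => (ψd p.1).2)).1
  have ig := (u_int hq h hr hK hτ (T := T) (G := fun p => g p.1) (B := 1) (fun p _ => (gc.comp continuous_fst).continuousAt) (fun p _ => by rw [abs_of_nonneg (g01 _).1]; exact (g01 _).2)).1
  have iS := u_int_sh hq h hr hK hτ (T := T) R δ
  have ugle : ∫ p, u p.1 p.2 * g p.1 ∂(slab N τ T) ≤ R ^ 2 * (C * M) := by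
    have e : ∫ p, u p.1 p.2 * g p.1 ∂(slab N τ T) = ∫ s in Ioc τ T, ∫ y, u y s * g y := integral_prod_symm _ ig
    have ii : Integrable (fun s => ∫ y, u y s * g y) (volume.restrict (Ioc τ T)) := ig.integral_prod_right
    rw [e]
    calc _ ≤ ∫ s in Ioc τ T, C * M := by
          apply setIntegral_mono_on ii (integrable_const _) measurableSet_Ioc
          intro s hs
          have := Eg.1 s (hτ.trans hs.1)
          linarith
      _ = (T - τ) * (C * M) := by simp [hT]
      _ ≤ _ := by gcongr; linarith
  have le : (3 / 16) * ∫ p, (sh R δ).indicator (fun p : Euc N × ℝ => u p.1 p.2) p ∂(slab N τ T) ≤ 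
      ∫ p, (u p.1 p.2 * lapl ψ p.1 + (24 * (δ / R)) * (u p.1 p.2 * g p.1)) ∂(slab N τ T) := by
    rw [← integral_const_mul]
    apply integral_mono_ae (iS.const_mul _) (iL.add (ig.const_mul _))
    filter_upwards [slab_ae] with p hp
    have hu := h.2.1 p.1 p.2 (hτ.trans hp.1)
    show 3 / 16 * (sh R δ).indicator (fun p : Euc N × ℝ => u p.1 p.2) p ≤ u p.1 p.2 * lapl ψ p.1 + (24 * (δ / R)) * (u p.1 p.2 * g p.1)
    have ha : 0 < 24 * (δ / R) := by positivity
    rw [show u p.1 p.2 * lapl ψ p.1 + (24 * (δ / R)) * (u p.1 p.2 * g p.1) = u p.1 p.2 * (lapl ψ p.1 + (24 * (δ / R)) * g p.1) by ring]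
    by_cases hps : p ∈ sh R δ
    · rw [indicator_of_mem hps]
      have h1 := ψsh p.1 hps.1 hps.2
      have hy : R ≤ ‖p.1‖ := by
        have h2 : 0 ≤ zz R δ p.1 := by linarith [hps.1]
        unfold zz at h2
        have := (le_div_iff₀ (by positivity : 0 < R * δ)).1 h2
        exact le_of_sq_le_sq (by linarith) (norm_nonneg _)
      rw [g1 _ hy]
      nlinarith
    · rw [indicator_of_notMem hps, mul_zero]
      apply mul_nonneg hu.le
      rcases le_total ‖p.1‖ R with hy | hy
      · exact add_nonneg (ψin _ hy) (mul_nonneg ha.le (g01 _).1)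
      · rw [g1 _ hy]; linarith [ψlow p.1]
  rw [integral_add iL (ig.const_mul _), integral_const_mul] at le
  rw [integral_sub iL iψ] at w
  have l1 := Eψ.1 T hT0
  have l2 := Eψ.2 τ T hτ hT
  have l3 : 0 ≤ ∫ y, u y τ * ψ y := integral_nonneg fun y => mul_nonneg (h.2.1 y τ hτ).le (ψb y).1
  have l4 : 24 * (δ / R) * ∫ p, u p.1 p.2 * g p.1 ∂(slab N τ T) ≤ 24 * (δ / R) * (R ^ 2 * (C * M)) := by gcongr
  have e4 : 24 * (δ / R) * (R ^ 2 * (C * M)) = 24 * C * (δ * R) * M := by field_simp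
  rw [← hM] at l1 l2
  linarith

theorem sh_cut (N : ℕ) : ∃ C : ℝ, 0 < C ∧ ∀ {R δ : ℝ}, 0 < δ → δ ≤ R → ∃ χ : Euc N → ℝ, ContDiff ℝ 2 χ ∧
    (∀ y, 0 ≤ χ y ∧ χ y ≤ 1) ∧ (∀ y, zz R δ y ≤ 1 / 2 → χ y = 0) ∧ (∀ y, 1 ≤ zz R δ y → χ y = 1) ∧
    (∀ y, ¬ (1 / 2 ≤ zz R δ y ∧ zz R δ y ≤ 1) → lapl χ y = 0 ∧ ∀ i, dd i χ y = 0) ∧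
    ∀ y, |lapl χ y| ≤ C / δ ^ 2 ∧ ∀ i, |dd i χ y| ≤ C / δ := by
  obtain ⟨S1, S2, C, hC, h1, h2, hb, hz, -, -⟩ := strans_facts
  refine ⟨(32 + 4 * N) * C, by positivity, ?_⟩
  intro R δ hδ hδR
  have hR : 0 < R := hδ.trans_le hδR
  set Z : ℝ → ℝ := fun w => 2 * ((w - R ^ 2) / (R * δ)) - 1 with hZ
  have dZ : ∀ w, HasDerivAt Z (2 / (R * δ)) w := fun w => by
    have := ((((hasDerivAt_id w).sub_const (R ^ 2)).div_const (R * δ)).const_mul 2).sub_const 1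
    refine this.congr_deriv (by ring)
  have dF : ∀ w, HasDerivAt (fun w => smoothTransition (Z w)) (S1 (Z w) * (2 / (R * δ))) w := fun w => (h1 (Z w)).comp w (dZ w)
  have dF1 : ∀ w, HasDerivAt (fun w => S1 (Z w) * (2 / (R * δ))) (S2 (Z w) * (2 / (R * δ)) * (2 / (R * δ))) w := fun w =>
    ((h2 (Z w)).comp w (dZ w)).mul_const _
  have lap : ∀ y : Euc N, lapl (fun y => smoothTransition (Z (‖y‖ ^ 2))) y = _ := fun y => lapl_rad0 y (Eventually.of_forall dF) (dF1 _)
  have hdd : ∀ (i : Fin N) (y : Euc N), dd i (fun y => smoothTransition (Z (‖y‖ ^ 2))) y = _ := fun i y => dd_rad0 i y (dF _)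
  have eZ : ∀ y : Euc N, Z (‖y‖ ^ 2) = 2 * zz R δ y - 1 := fun y => rfl
  have out : ∀ y : Euc N, ¬ (1 / 2 ≤ zz R δ y ∧ zz R δ y ≤ 1) → lapl (fun y => smoothTransition (Z (‖y‖ ^ 2))) y = 0 ∧ ∀ i, dd i (fun y => smoothTransition (Z (‖y‖ ^ 2))) y = 0 := by
    intro y hy
    have hn : Z (‖y‖ ^ 2) ∉ Icc (0:ℝ) 1 := by
      rw [eZ]; intro hh; exact hy ⟨by linarith [hh.1], by linarith [hh.2]⟩
    refine ⟨?_, fun i => ?_⟩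
    · rw [lap, (hz _ hn).1, (hz _ hn).2]; simp
    · rw [hdd, (hz _ hn).1]; simp
  have cZ : ContDiff ℝ 2 Z := by simp only [hZ]; fun_prop
  refine ⟨fun y => smoothTransition (Z (‖y‖ ^ 2)), smoothTransition.contDiff.comp (cZ.comp (contDiff_norm_sq ℝ)), fun y => ⟨smoothTransition.nonneg _, smoothTransition.le_one _⟩, ?_, ?_, out, ?_⟩
  · intro y hy
    exact smoothTransition.zero_of_nonpos (by rw [eZ]; linarith)
  · intro y hy
    exact smoothTransition.one_of_one_le (by rw [eZ]; linarith)
  · intro y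
    by_cases hy : 1 / 2 ≤ zz R δ y ∧ zz R δ y ≤ 1
    · have hw : ‖y‖ ^ 2 ≤ 2 * R ^ 2 := by
        have := hy.2
        unfold zz at this
        rw [div_le_one (by positivity)] at this
        nlinarith
      have hy2 : ‖y‖ ≤ 2 * R := by
        apply le_of_sq_le_sq _ (by positivity); nlinarith
      have b1 := (hb (Z (‖y‖ ^ 2))).1
      have b2 := (hb (Z (‖y‖ ^ 2))).2
      constructor
      · rw [lap]
        refine (abs_add_le _ _).trans ?_
        rw [abs_mul _ (4 * ‖y‖ ^ 2), abs_mul _ (2 / (R * δ)), abs_mul (S2 _), abs_mul _ (2 * (N:ℝ)), abs_mul (S1 _), abs_of_pos (by positivity : 0 < 2 / (R * δ)), abs_of_nonneg (by positivity : 0 ≤ 4 * ‖y‖ ^ 2), abs_of_nonneg (by positivity : (0:ℝ) ≤ 2 * N)]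
        calc _ ≤ C * (2 / (R * δ)) * (2 / (R * δ)) * (4 * (2 * R ^ 2)) + C * (2 / (R * δ)) * (2 * N) := by gcongr
          _ = 32 * C / δ ^ 2 + 4 * N * C / (R * δ) := by field_simp; ring
          _ ≤ 32 * C / δ ^ 2 + 4 * N * C / (δ * δ) := by gcongr
          _ = _ := by field_simp
      · intro i
        have hi : |y i| ≤ ‖y‖ := PiLp.norm_apply_le y i
        rw [hdd, abs_mul, abs_mul, abs_of_pos (by positivity : 0 < 2 / (R * δ)), abs_mul, abs_two]
        calc _ ≤ C * (2 / (R * δ)) * (2 * (2 * R)) := by gcongr; exact hi.trans hy2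
          _ = 8 * C / δ := by field_simp; ring
          _ ≤ _ := by
            gcongr
            have : (0:ℝ) ≤ N := by positivity
            linarith
    · have := out y hy
      rw [this.1]
      refine ⟨by simp; positivity, fun i => ?_⟩
      rw [this.2 i]; simp; positivity

theorem kk_dd_le {N : ℕ} (x y : Euc N) {t : ℝ} (ht : 0 < t) (i : Fin N) : |dd i (fun y => kk N (y - x) t) y| ≤ ‖y - x‖ / (2 * t) * kk N (y - x) t := by
  unfold dd
  rw [kk_fderiv, abs_mul, abs_neg, abs_of_pos (by have := kk_pos (y - x) ht; positivity)]
  have hi := abs_real_inner_le_norm (y - x) (EuclideanSpace.single i (1:ℝ))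
  simp only [EuclideanSpace.norm_single, norm_one, mul_one] at hi
  have := kk_pos (y - x) ht
  calc _ ≤ kk N (y - x) t / (2 * t) * ‖y - x‖ := by gcongr
    _ = _ := by ring

theorem kk_glob {N : ℕ} {σ : ℝ} (hσ : 0 < σ) : ∃ A : ℝ, 0 < A ∧ ∀ (x y : Euc N) (t : ℝ), σ ≤ t → kk N (y - x) t ≤ A ∧ ∀ i, |dd i (fun y => kk N (y - x) t) y| ≤ A := by
  have hc := cm_pos N
  set B := (4 * π * σ) ^ (-(N : ℝ) / 2) with hB
  have hB0 : 0 < B := by positivity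
  have hN : -(N : ℝ) / 2 ≤ 0 := by
    have : (0:ℝ) ≤ N := by positivity
    linarith
  have hsup : ∀ (z : Euc N) t, σ ≤ t → kk N z t ≤ B := fun z t ht =>
    (kk_le_sup z (hσ.trans_le ht)).trans (rpow_le_rpow_of_nonpos (by positivity) (by gcongr) hN)
  have hs : 0 < √σ := sqrt_pos.2 hσ
  have hpos : 0 < cm N / √σ * B := by positivity
  refine ⟨B + cm N / √σ * B, by positivity, fun x y t ht => ⟨(hsup _ _ ht).trans (by linarith), fun i => ?_⟩⟩
  have h1 := kk_fd_le x y (EuclideanSpace.single i (1:ℝ)) (hσ.trans_le ht)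
  simp only [EuclideanSpace.norm_single, norm_one, mul_one] at h1
  have h2 := kk_pos (y - x) (by linarith : 0 < 2 * t)
  calc _ ≤ _ := h1
    _ ≤ cm N / √σ * B := by gcongr; exact hsup _ _ (by linarith)
    _ ≤ _ := by linarith

theorem kernel_step (N : ℕ) {q : ℝ} (hq : 1 < q) : ∃ C : ℝ, 0 < C ∧ ∀ {r ρ : ℝ} {K : Set (Euc N)} {η : Euc N → ℝ} {u : Euc N → ℝ → ℝ},
    IsSol N q u K → 0 < r → 0 < ρ → K ⊆ ball 0 r → TestFun N r ρ K η → 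
    ∀ {δ T : ℝ} (x : Euc N), 0 < δ → δ ≤ r + 2 * ρ → 0 < T → T ≤ (r + 2 * ρ) ^ 2 → ∃ χ : Euc N → ℝ, Continuous χ ∧ (∀ y, 0 ≤ χ y ∧ χ y ≤ 1) ∧ (∀ y, 1 ≤ zz (r + 2 * ρ) δ y → χ y = 1) ∧
    ∀ {S σ : ℝ}, 0 < σ → (∀ (y : Euc N) (θ : ℝ), zz (r + 2 * ρ) δ y ≤ 1 → 0 < θ → θ ≤ T + σ → (‖y - x‖ / (2 * θ) + 1 / δ) * kk N (y - x) θ ≤ S) →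
    ∫ y, (u y T * χ y) * kk N (y - x) σ ≤ C * (r + 2 * ρ) * Rnorm N q η * S := by
  obtain ⟨C, hC, hE⟩ := shell_est N hq
  obtain ⟨D, hD, hcut⟩ := sh_cut N
  refine ⟨C * ((2 * N + 1) * D), by positivity, ?_⟩
  intro r ρ K η u h hr hρ hK hη δ T x hδ hδR hT hTR
  set R := r + 2 * ρ with hR
  have hR0 : 0 < R := by positivity
  obtain ⟨χ, cχ, χ01, χ0, χ1, χout, χb⟩ := hcut hδ hδR
  refine ⟨χ, cχ.continuous, χ01, χ1, ?_⟩
  intro S σ hσ hS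
  obtain ⟨A, hA, hk⟩ := kk_glob (N := N) hσ
  set M := Rnorm N q η with hM
  have hM0 : 0 ≤ M := Rnorm_nonneg
  set Φ : Euc N → ℝ → ℝ := fun y s => kk N (y - x) (T + σ - s) * χ y with hΦ
  have hθ : ∀ {s}, s ≤ T → σ ≤ T + σ - s := fun hs => by linarith
  have hθ0 : ∀ {s}, s ≤ T → 0 < T + σ - s := fun hs => by linarith
  have ckk : ∀ y s, s ≤ T → ContDiffAt ℝ 2 (fun p : Euc N × ℝ => kk N (p.1 - x) (T + σ - p.2)) (y, s) := fun y s hs =>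
    ContDiffAt.comp (y, s) (g := fun p : Euc N × ℝ => kk N (p.1 - x) p.2) (f := fun p : Euc N × ℝ => (p.1, T + σ - p.2)) (kk_cda x y (hθ0 hs)) (by fun_prop)
  have cΦ : ∀ y s, s ≤ T → ContDiffAt ℝ 2 (fun p : Euc N × ℝ => Φ p.1 p.2) (y, s) := fun y s hs =>
    (ckk y s hs).mul (cχ.contDiffAt.comp (y, s) contDiffAt_fst)
  have kp : ∀ y s, s ≤ T → 0 < kk N (y - x) (T + σ - s) := fun y s hs => kk_pos _ (hθ0 hs)
  have Φnn : ∀ y s, s ≤ T → 0 ≤ Φ y s := fun y s hs => mul_nonneg (kp y s hs).le (χ01 y).1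
  have Φb : ∀ y s, s ≤ T → |Φ y s| ≤ A := fun y s hs => by
    rw [abs_of_nonneg (Φnn y s hs)]
    calc Φ y s ≤ A * 1 := mul_le_mul (hk x y _ (hθ hs)).1 (χ01 y).2 (χ01 y).1 hA.le
      _ = A := mul_one A
  have eE : ∀ y s, s ≤ T → deriv (Φ y) s + lapl (fun y => Φ y s) y = 
      kk N (y - x) (T + σ - s) * lapl χ y + 2 * ∑ i, dd i (fun y => kk N (y - x) (T + σ - s)) y * dd i χ y := by
    intro y s hs
    have d1 : HasDerivAt (Φ y) (kk N (y - x) (T + σ - s) * (‖y - x‖ ^ 2 / (4 * (T + σ - s) ^ 2) - N / (2 * (T + σ - s))) * (-1) * χ y) s :=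
      ((kk_deriv (y - x) (hθ0 hs)).comp s ((hasDerivAt_id s).const_sub (T + σ))).mul_const _
    rw [d1.deriv]
    simp only [hΦ]
    rw [lapl_mul (slice_x (f := fun y s => kk N (y - x) (T + σ - s)) (ckk y s hs)) cχ.contDiffAt, kk_lapl x y (hθ0 hs)]
    ring
  have Eb : ∀ y s, s ≤ T → |deriv (Φ y) s + lapl (fun y => Φ y s) y| ≤ A * (D / δ ^ 2) + 2 * (N * (A * (D / δ))) := by
    intro y s hs
    rw [eE y s hs]
    have k1 := hk x y _ (hθ hs)
    refine (abs_add_le _ _).trans (add_le_add ?_ ?_)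
    · rw [abs_mul, abs_of_pos (kp y s hs)]
      exact mul_le_mul k1.1 (χb y).1 (abs_nonneg _) hA.le
    · rw [abs_mul, abs_two]
      gcongr
      refine (Finset.abs_sum_le_sum_abs _ _).trans ?_
      calc _ ≤ ∑ i : Fin N, A * (D / δ) := Finset.sum_le_sum fun i _ => by
            rw [abs_mul]; exact mul_le_mul (k1.2 i) ((χb y).2 i) (abs_nonneg _) hA.le
        _ = _ := by simp
  have Es : ∀ y s, 0 < s → s ≤ T → zz R δ y ≤ 1 → deriv (Φ y) s + lapl (fun y => Φ y s) y ≤ (2 * N + 1) * D / δ * S := by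
    intro y s hs0 hs hz
    have hSy := hS y (T + σ - s) hz (hθ0 hs) (by linarith)
    rw [eE y s hs]
    have k0 := kp y s hs
    have kd := fun i => kk_dd_le x y (hθ0 hs) i
    set k := kk N (y - x) (T + σ - s)
    set l := ‖y - x‖ / (2 * (T + σ - s)) with hl
    have l0 : 0 ≤ l := div_nonneg (norm_nonneg _) (by have := hθ0 hs; positivity)
    have a1 : k * lapl χ y ≤ k * (D / δ ^ 2) := by gcongr; exact (le_abs_self _).trans (χb y).1
    have a2 : ∑ i, dd i (fun y => kk N (y - x) (T + σ - s)) y * dd i χ y ≤ N * (l * k * (D / δ)) := by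
      calc _ ≤ ∑ i : Fin N, l * k * (D / δ) := Finset.sum_le_sum fun i _ => by
            refine (le_abs_self _).trans ?_
            rw [abs_mul]; exact mul_le_mul (kd i) ((χb y).2 i) (abs_nonneg _) (by positivity)
        _ = _ := by simp
    have b1 : 0 ≤ l * k := by positivity
    have b2 : 0 ≤ 1 / δ * k := by positivity
    have hN : (0:ℝ) ≤ N := by positivity
    have s1 : l * k ≤ S := by nlinarith
    have s2 : 1 / δ * k ≤ S := by nlinarith
    calc _ ≤ k * (D / δ ^ 2) + 2 * (N * (l * k * (D / δ))) := by linarith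
      _ = (1 / δ * k) * (D / δ) + 2 * (N * ((l * k) * (D / δ))) := by field_simp
      _ ≤ S * (D / δ) + 2 * (N * (S * (D / δ))) := by gcongr
      _ = _ := by ring
  have Eo : ∀ y s, s ≤ T → ¬ (1 / 2 ≤ zz R δ y ∧ zz R δ y ≤ 1) → deriv (Φ y) s + lapl (fun y => Φ y s) y = 0 := by
    intro y s hs hz
    rw [eE y s hs, (χout y hz).1]
    simp [(χout y hz).2]
  have ddb : ∀ y s, s ≤ T → ∀ i, |dd i (fun y => Φ y s) y| ≤ A * (D / δ) + A := by
    intro y s hs i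
    have k1 := hk x y _ (hθ hs)
    simp only [hΦ]
    rw [dd_mul i ((slice_x (f := fun y s => kk N (y - x) (T + σ - s)) (ckk y s hs)).differentiableAt (by norm_num)) (cχ.contDiffAt.differentiableAt (by norm_num))]
    refine (abs_add_le _ _).trans ?_
    rw [abs_mul, abs_mul, abs_of_pos (kp y s hs), abs_of_nonneg (χ01 y).1]
    have := mul_le_mul k1.1 ((χb y).2 i) (abs_nonneg _) hA.le
    have := mul_le_mul (χ01 y).2 (k1.2 i) (abs_nonneg _) zero_le_one
    linarith
  have hS0 : 0 ≤ S := by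
    have h0 : zz R δ (0 : Euc N) ≤ 1 := by
      unfold zz
      have : (0 ^ 2 - R ^ 2) / (R * δ) ≤ 0 := div_nonpos_of_nonpos_of_nonneg (by nlinarith) (by positivity)
      simp at this ⊢; linarith
    refine le_trans ?_ (hS 0 (T + σ) h0 (by linarith) le_rfl)
    have := kk_pos ((0 : Euc N) - x) (by linarith : 0 < T + σ)
    positivity
  have main : ∀ τ ∈ Ioo 0 T, ∫ y, u y T * Φ y T ≤ (∫ y, u y τ * Φ y τ) + C * ((2 * N + 1) * D) * R * M * S := by
    intro τ hτ
    have w := weak hq h hr hK hτ.1 hτ.2.le (Φ := Φ) (B := max A (max (A * (D / δ) + A) (A * (D / δ ^ 2) + 2 * (N * (A * (D / δ))))))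
      (fun y s hs => cΦ y s hs.2) (fun y s hs => (Φb y s hs.2).trans (le_max_left _ _))
      (fun y s hs i => (ddb y s hs.2 i).trans ((le_max_left _ _).trans (le_max_right _ _)))
      (fun y s hs => (Eb y s hs.2).trans ((le_max_right _ _).trans (le_max_right _ _)))
    have iΦ := (u_int hq h hr hK hτ.1 (T := T) (G := fun p => Φ p.1 p.2) (B := A) (fun p hp => (cΦ p.1 p.2 hp.2).continuousAt) (fun p hp => Φb p.1 p.2 hp.2)).2
    have iE := (u_int hq h hr hK hτ.1 (T := T) (G := fun p => deriv (Φ p.1) p.2 + lapl (fun y => Φ y p.2) p.1) (B := A * (D / δ ^ 2) + 2 * (N * (A * (D / δ))))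
      (fun p hp => (slice_cont_deriv (cΦ p.1 p.2 hp.2)).add (slice_cont_lapl (cΦ p.1 p.2 hp.2))) (fun p hp => Eb p.1 p.2 hp.2)).1
    have iS := u_int_sh hq h hr hK hτ.1 (T := T) R δ
    have le : ∫ p, (u p.1 p.2 * (deriv (Φ p.1) p.2 + lapl (fun y => Φ y p.2) p.1) - u p.1 p.2 ^ q * Φ p.1 p.2) ∂(slab N τ T) ≤
        ∫ p, ((2 * N + 1) * D / δ * S) * (sh R δ).indicator (fun p : Euc N × ℝ => u p.1 p.2) p ∂(slab N τ T) := by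
      apply integral_mono_ae (iE.sub iΦ) (iS.const_mul _)
      filter_upwards [slab_ae] with p hp
      have hp0 := hτ.1.trans hp.1
      have hu := h.2.1 p.1 p.2 hp0
      have n1 : 0 ≤ u p.1 p.2 ^ q * Φ p.1 p.2 := mul_nonneg (by positivity) (Φnn _ _ hp.2)
      show u p.1 p.2 * (deriv (Φ p.1) p.2 + lapl (fun y => Φ y p.2) p.1) - u p.1 p.2 ^ q * Φ p.1 p.2 ≤ _
      by_cases hps : p ∈ sh R δ
      · rw [indicator_of_mem hps]
        have := mul_le_mul_of_nonneg_left (Es p.1 p.2 hp0 hp.2 hps.2) hu.le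
        linarith
      · rw [indicator_of_notMem hps, Eo p.1 p.2 hp.2 hps]
        simp; exact n1
    rw [← w, integral_const_mul] at le
    have e := hE h hr hρ hK hη hδ hδR hτ.1 hτ.2.le hTR
    have e2 : (2 * N + 1) * D / δ * S * ∫ p, (sh R δ).indicator (fun p : Euc N × ℝ => u p.1 p.2) p ∂(slab N τ T) ≤ (2 * N + 1) * D / δ * S * (C * (δ * R) * M) := by
      gcongr
    have e3 : (2 * N + 1) * D / δ * S * (C * (δ * R) * M) = C * ((2 * N + 1) * D) * R * M * S := by field_simp
    linarith
  have lim := init_lim hq h hr hK (U := ball 0 R) isOpen_ball (hK.trans (ball_subset_ball (by linarith))) (Ψ := Φ) (τ := T) (B := A) hT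
    (fun s hs => continuous_iff_continuousAt.2 fun y => (slice_x (cΦ y s hs.2.le)).continuousAt) (fun s hs y => Φb y s hs.2.le)
    (fun s hs y hy => by
      have hy' : ‖y‖ < R := by simpa using hy
      have : zz R δ y ≤ 1 / 2 := by
        unfold zz
        have : (‖y‖ ^ 2 - R ^ 2) / (R * δ) ≤ 0 := div_nonpos_of_nonpos_of_nonneg (by nlinarith [norm_nonneg y]) (by positivity)
        linarith
      simp only [hΦ, χ0 y this, mul_zero])
  have lim2 := lim.add_const (C * ((2 * N + 1) * D) * R * M * S)
  rw [zero_add] at lim2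
  have fin := ge_of_tendsto lim2 (by filter_upwards [Ioo_mem_nhdsGT hT] with τ hτ using main τ hτ)
  have e : ∀ y, (u y T * χ y) * kk N (y - x) σ = u y T * Φ y T := fun y => by
    simp only [hΦ]; rw [show T + σ - T = σ by ring]; ring
  simp only [e]
  exact fin

theorem approx_id {N : ℕ} {f : Euc N → ℝ} (x : Euc N) (hf : Continuous f) (h0 : ∀ y, 0 ≤ f y)
    (hi : ∀ σ, 0 < σ → Integrable (fun y => f y * kk N (y - x) σ)) {b : ℝ → ℝ} {b0 : ℝ}
    (hb : ∀ᶠ σ in nhdsWithin 0 (Ioi 0), ∫ y, f y * kk N (y - x) σ ≤ b σ) (hlim : Tendsto b (nhdsWithin 0 (Ioi 0)) (nhds b0)) : f x ≤ b0 := by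
  have key : ∀ c, 0 < c → c < f x → c ≤ b0 := by
    intro c hc hcf
    obtain ⟨κ, hκ, hball⟩ := Metric.eventually_nhds_iff.1 (hf.continuousAt.eventually (lt_mem_nhds hcf))
    have low : ∀ y, c * (1 - ‖y - x‖ / κ) ≤ f y := by
      intro y
      by_cases hy : dist y x < κ
      · have := hball hy
        have h2 : 0 ≤ ‖y - x‖ / κ := by positivity
        nlinarith
      · rw [dist_eq_norm] at hy
        push Not at hy
        have h2 : 1 ≤ ‖y - x‖ / κ := by rwa [le_div_iff₀ hκ, one_mul]
        have := h0 y
        nlinarith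
    have lb : ∀ σ, 0 < σ → c - c / κ * cm N * √σ ≤ ∫ y, f y * kk N (y - x) σ := by
      intro σ hσ
      have i1 := kk_int' x hσ
      have i2 := kk_int' x (by positivity : 0 < 2 * σ)
      have e : ∫ y : Euc N, (c * kk N (y - x) σ - c / κ * cm N * √σ * kk N (y - x) (2 * σ)) = c - c / κ * cm N * √σ := by
        rw [integral_sub (i1.1.const_mul _) (i2.1.const_mul _), integral_const_mul, integral_const_mul, i1.2, i2.2]; ring
      rw [← e]
      refine integral_mono ((i1.1.const_mul _).sub (i2.1.const_mul _)) (hi σ hσ) fun y => ?_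
      have m := kk_m1 (y - x) hσ
      have kp := kk_pos (y - x) hσ
      have l1 := mul_le_mul_of_nonneg_right (low y) kp.le
      have l2 := mul_le_mul_of_nonneg_left m (by positivity : 0 ≤ c / κ)
      have e3 : c * (1 - ‖y - x‖ / κ) * kk N (y - x) σ = c * kk N (y - x) σ - c / κ * (‖y - x‖ * kk N (y - x) σ) := by ring
      show c * kk N (y - x) σ - c / κ * cm N * √σ * kk N (y - x) (2 * σ) ≤ f y * kk N (y - x) σ
      linarith
    have cl : Continuous fun σ : ℝ => c - c / κ * cm N * √σ := by fun_prop
    have tl : Tendsto (fun σ : ℝ => c - c / κ * cm N * √σ) (nhdsWithin 0 (Ioi 0)) (nhds c) := by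
      have := (cl.tendsto 0).mono_left (nhdsWithin_le_nhds (s := Ioi 0))
      simpa using this
    refine le_of_tendsto_of_tendsto tl hlim ?_
    filter_upwards [hb, self_mem_nhdsWithin] with σ h1 h2
    exact (lb σ h2).trans h1
  by_contra hcon
  push Not at hcon
  by_cases hx : 0 < f x
  · have h1 := key (max (f x / 2) ((f x + b0) / 2)) (lt_max_of_lt_left (by linarith)) (max_lt (by linarith) (by linarith))
    have := le_max_right (f x / 2) ((f x + b0) / 2)
    linarith
  · have h2 : f x = 0 := le_antisymm (not_lt.1 hx) (h0 x)
    have : 0 ≤ b0 := by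
      refine ge_of_tendsto hlim ?_
      filter_upwards [hb, self_mem_nhdsWithin] with σ h1 h2
      exact (integral_nonneg fun y => mul_nonneg (h0 y) (kk_pos (y - x) h2).le).trans h1
    linarith

theorem rpow_exp {N : ℕ} (hN : 1 ≤ N) {k X : ℝ} (hk : 0 < k) (hX : 0 ≤ X) :
    X ^ ((N : ℝ) / 2) ≤ (k * N) ^ ((N : ℝ) / 2) * rexp (X / (2 * k)) := by
  have hN0 : (0:ℝ) < N := by exact_mod_cast hN
  have h1 : X ≤ k * N * rexp (X / (k * N)) := by
    have := add_one_le_exp (X / (k * N))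
    calc X = k * N * (X / (k * N)) := by field_simp
      _ ≤ _ := by gcongr; linarith
  calc _ ≤ (k * N * rexp (X / (k * N))) ^ ((N : ℝ) / 2) := by gcongr
    _ = _ := by
      rw [mul_rpow (by positivity) (by positivity), ← exp_mul]
      congr 2
      field_simp

theorem pre_le {N : ℕ} {θ : ℝ} (hθ : 0 < θ) : (4 * π * θ) ^ (-(N : ℝ) / 2) ≤ θ ^ (-(N : ℝ) / 2) := by
  apply rpow_le_rpow_of_nonpos hθ
  · nlinarith [pi_gt_three]
  · have : (0:ℝ) ≤ N := by positivity
    linarith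

theorem pow_split {N : ℕ} {θ T : ℝ} (hθ : 0 < θ) (hT : 0 < T) : θ ^ (-(N : ℝ) / 2) = T ^ (-(N : ℝ) / 2) * (T / θ) ^ ((N : ℝ) / 2) := by
  rw [div_rpow hT.le hθ.le, neg_div, rpow_neg hT.le, rpow_neg hθ.le]
  have : 0 < T ^ ((N : ℝ) / 2) := by positivity
  field_simp

theorem capA {N : ℕ} (hN : 1 ≤ N) {ρ d L θ T : ℝ} (hρ : 0 < ρ) (hd : ρ ≤ d) (hL : d - ρ / 2 ≤ L) (hθ : 0 < θ) (hθT : θ ≤ T) (hT : T ≤ d ^ 2) :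
    (L / (2 * θ) + 1 / ρ) * ((4 * π * θ) ^ (-(N : ℝ) / 2) * rexp (-L ^ 2 / (4 * θ))) ≤
      9 * (32 * N) ^ ((N : ℝ) / 2) * rexp (1 / 64) * (ρ⁻¹ * T ^ (-(N : ℝ) / 2) * rexp (-(d - ρ) ^ 2 / (4 * T))) := by
  have hT0 : 0 < T := hθ.trans_le hθT
  have hd0 : 0 < d := hρ.trans_le hd
  have hL0 : 0 < L := by linarith
  set w := ρ * L / (16 * θ) with hw
  have hw0 : 0 < w := by positivity
  set b := (d - ρ) ^ 2 / 4 + ρ * d / 32 with hb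
  have hb64 : d ^ 2 / 64 ≤ b := by nlinarith [sq_nonneg (d - ρ), sq_nonneg ρ]
  have e1 : rexp (-L ^ 2 / (4 * θ)) ≤ rexp (-w) * rexp (-b / θ) := by
    rw [← exp_add]
    apply exp_le_exp.2
    rw [hw, hb, show -(ρ * L / (16 * θ)) + -((d - ρ) ^ 2 / 4 + ρ * d / 32) / θ = (-(ρ * L / 4) - (d - ρ) ^ 2 - ρ * d / 8) / (4 * θ) by field_simp; ring]
    apply div_le_div_of_nonneg_right _ (by positivity)
    nlinarith [mul_nonneg (by linarith : 0 ≤ L - (d - ρ) - ρ / 2) (by linarith : 0 ≤ L + (d - ρ))]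
  have e2 : (L / (2 * θ) + 1 / ρ) * rexp (-w) ≤ 9 * ρ⁻¹ := by
    have h1 := exp_mul_le w
    have h2 : rexp (-w) ≤ 1 := exp_le_one_iff.2 (by linarith)
    calc _ = (8 * (w * rexp (-w)) + rexp (-w)) * ρ⁻¹ := by rw [hw]; field_simp; ring
      _ ≤ (8 * 1 + 1) * ρ⁻¹ := by gcongr
      _ = _ := by norm_num
  have e3 : rexp (-b / θ) ≤ rexp (-(d - ρ) ^ 2 / (4 * T)) * rexp (1 / 64) * rexp (-(T / θ / (2 * 32))) := by
    rw [← exp_add, ← exp_add]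
    apply exp_le_exp.2
    have hX : 1 ≤ T / θ := by rwa [le_div_iff₀ hθ, one_mul]
    have hbT : 1 / 64 ≤ b / T := by rw [le_div_iff₀ hT0]; linarith
    have e : -b / θ = -(b / T) - (b / T) * (T / θ - 1) := by field_simp; ring
    have e' : (d - ρ) ^ 2 / (4 * T) ≤ b / T := by
      rw [← div_div]; gcongr
      have : 0 < ρ * d := by positivity
      linarith
    have e'' : -(d - ρ) ^ 2 / (4 * T) = -((d - ρ) ^ 2 / (4 * T)) := by ring
    rw [e, e'']
    nlinarith
  have e4 := rpow_exp hN (by norm_num : (0:ℝ) < 32) (by positivity : 0 ≤ T / θ)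
  calc _ ≤ (L / (2 * θ) + 1 / ρ) * (θ ^ (-(N : ℝ) / 2) * (rexp (-w) * rexp (-b / θ))) := by
        exact mul_le_mul_of_nonneg_left (mul_le_mul (pre_le hθ) e1 (exp_pos _).le (by positivity)) (by positivity)
    _ = ((L / (2 * θ) + 1 / ρ) * rexp (-w)) * (θ ^ (-(N : ℝ) / 2) * rexp (-b / θ)) := by ring
    _ ≤ (9 * ρ⁻¹) * (T ^ (-(N : ℝ) / 2) * ((32 * N) ^ ((N : ℝ) / 2) * rexp (T / θ / (2 * 32))) * (rexp (-(d - ρ) ^ 2 / (4 * T)) * rexp (1 / 64) * rexp (-(T / θ / (2 * 32))))) := by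
        rw [pow_split hθ hT0]
        gcongr
    _ = 9 * (32 * N) ^ ((N : ℝ) / 2) * rexp (1 / 64) * (ρ⁻¹ * T ^ (-(N : ℝ) / 2) * rexp (-(d - ρ) ^ 2 / (4 * T))) * (rexp (T / θ / (2 * 32)) * rexp (-(T / θ / (2 * 32)))) := by ring
    _ = _ := by rw [← exp_add, add_neg_cancel, exp_zero, mul_one]

theorem capB {N : ℕ} (hN : 1 ≤ N) {d L θ : ℝ} (hd : 0 < d) (hL : d / 2 ≤ L) (hθ : 0 < θ) :
    (L / (2 * θ) + 1 / d) * ((4 * π * θ) ^ (-(N : ℝ) / 2) * rexp (-L ^ 2 / (4 * θ))) ≤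
      9 * (16 * N) ^ ((N : ℝ) / 2) * d ^ (-((N : ℝ) + 1)) := by
  have hL0 : 0 < L := by linarith
  set w := L ^ 2 / (8 * θ) with hw
  have hw0 : 0 < w := by positivity
  have e1 : rexp (-L ^ 2 / (4 * θ)) = rexp (-w) * rexp (-w) := by
    rw [← exp_add, hw]; congr 1; field_simp; ring
  have e2 : (L / (2 * θ) + 1 / d) * rexp (-w) ≤ 9 * d⁻¹ := by
    have h1 := exp_mul_le w
    have h2 : rexp (-w) ≤ 1 := exp_le_one_iff.2 (by linarith)
    have h3 : L / (2 * θ) + 1 / d ≤ (8 * w + 1) * d⁻¹ := by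
      rw [hw, div_add_div _ _ (by positivity) hd.ne', ← div_eq_mul_inv, div_le_div_iff₀ (by positivity) hd]
      rw [show (8 * (L ^ 2 / (8 * θ)) + 1) * (2 * θ * d) = (2 * L ^ 2 + 2 * θ) * d by field_simp]
      apply mul_le_mul_of_nonneg_right _ hd.le; nlinarith
    calc _ ≤ (8 * w + 1) * d⁻¹ * rexp (-w) := by gcongr
      _ = (8 * (w * rexp (-w)) + rexp (-w)) * d⁻¹ := by ring
      _ ≤ (8 * 1 + 1) * d⁻¹ := by gcongr
      _ = _ := by norm_num
  have e3 : rexp (-w) ≤ rexp (-(d ^ 2 / θ / (2 * 16))) := by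
    apply exp_le_exp.2
    rw [hw, neg_le_neg_iff, div_div, div_le_div_iff₀ (by positivity) (by positivity)]
    have : d ^ 2 ≤ 4 * L ^ 2 := by nlinarith
    nlinarith
  have e4 := rpow_exp hN (by norm_num : (0:ℝ) < 16) (by positivity : 0 ≤ d ^ 2 / θ)
  have e5 : d ^ (-((N : ℝ) + 1)) = d⁻¹ * (d ^ 2) ^ (-(N : ℝ) / 2) := by
    rw [← rpow_natCast d 2, ← rpow_mul hd.le, ← rpow_neg_one, ← rpow_add hd]
    congr 1; push_cast; ring
  calc _ ≤ (L / (2 * θ) + 1 / d) * (θ ^ (-(N : ℝ) / 2) * (rexp (-w) * rexp (-w))) := by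
        exact mul_le_mul_of_nonneg_left (mul_le_mul (pre_le hθ) e1.le (exp_pos _).le (by positivity)) (by positivity)
    _ = ((L / (2 * θ) + 1 / d) * rexp (-w)) * (θ ^ (-(N : ℝ) / 2) * rexp (-w)) := by ring
    _ ≤ (9 * d⁻¹) * ((d ^ 2) ^ (-(N : ℝ) / 2) * ((16 * N) ^ ((N : ℝ) / 2) * rexp (d ^ 2 / θ / (2 * 16))) * rexp (-(d ^ 2 / θ / (2 * 16)))) := by
        rw [pow_split hθ (by positivity : 0 < d ^ 2)]
        gcongr
    _ = 9 * (16 * N) ^ ((N : ℝ) / 2) * (d⁻¹ * (d ^ 2) ^ (-(N : ℝ) / 2)) * (rexp (d ^ 2 / θ / (2 * 16)) * rexp (-(d ^ 2 / θ / (2 * 16)))) := by ring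
    _ = _ := by rw [← exp_add, add_neg_cancel, exp_zero, mul_one, e5]

theorem zz_far {N : ℕ} {R δ : ℝ} (hR : 0 < R) (hδ : 0 < δ) (x : Euc N) (hx : R + δ ≤ ‖x‖) : 1 ≤ zz R δ x := by
  unfold zz
  rw [le_div_iff₀ (by positivity)]
  nlinarith [norm_nonneg x]

theorem zz_near {N : ℕ} {R δ : ℝ} (hR : 0 < R) (hδ : 0 < δ) (x y : Euc N) (hy : zz R δ y ≤ 1) : (‖x‖ - R) - δ / 2 ≤ ‖y - x‖ := by
  unfold zz at hy
  rw [div_le_one (by positivity)] at hy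
  have h1 : ‖y‖ ≤ R + δ / 2 := by
    apply le_of_sq_le_sq _ (by positivity); nlinarith
  have h2 := norm_sub_norm_le x y
  rw [norm_sub_rev] at h2
  linarith

theorem main_step (N : ℕ) (hN : 1 ≤ N) {q : ℝ} (hq : 1 < q) : ∃ C : ℝ, 0 < C ∧ ∀ {r ρ : ℝ} {K : Set (Euc N)} {η : Euc N → ℝ} {u : Euc N → ℝ → ℝ},
    IsSol N q u K → 0 < r → 0 < ρ → K ⊆ ball 0 r → TestFun N r ρ K η →
    ∀ (x : Euc N) (t : ℝ), r + 3 * ρ ≤ ‖x‖ → 0 < t → t ≤ (r + 2 * ρ) ^ 2 →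
    u x t ≤ C * (r + 2 * ρ) * Rnorm N q η * (max ((‖x‖ - r - 2 * ρ) ^ (-((N : ℝ) + 1))) (ρ⁻¹ * t ^ (-(N : ℝ) / 2)) *
                    rexp (-(‖x‖ - r - 3 * ρ) ^ 2 / (4 * t))) := by
  obtain ⟨C, hC, hk⟩ := kernel_step N hq
  have hN0 : (0:ℝ) < N := by exact_mod_cast hN
  set A := 9 * (32 * (N:ℝ)) ^ ((N : ℝ) / 2) * rexp (1 / 64) with hA
  set B := 9 * (16 * (N:ℝ)) ^ ((N : ℝ) / 2) with hB
  have hA0 : 0 < A := by positivity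
  have hB0 : 0 < B := by positivity
  refine ⟨C * (A + B * rexp (1 / 4)), by positivity, ?_⟩
  intro r ρ K η u h hr hρ hK hη x t hx ht htR
  set R := r + 2 * ρ with hR
  have hR0 : 0 < R := by positivity
  set M := Rnorm N q η with hM
  have hM0 : 0 ≤ M := Rnorm_nonneg
  set d := ‖x‖ - R with hd
  have hdρ : ρ ≤ d := by linarith
  have hd0 : 0 < d := hρ.trans_le hdρ
  rw [show ‖x‖ - r - 2 * ρ = d by rw [hd, hR]; ring, show ‖x‖ - r - 3 * ρ = d - ρ by rw [hd, hR]; ring]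
  have cu : Continuous fun y => u y t := continuous_iff_continuousAt.2 fun y => (slice_x (sol_cda h y ht)).continuousAt
  have conc : ∀ {χ : Euc N → ℝ}, Continuous χ → (∀ y, 0 ≤ χ y ∧ χ y ≤ 1) → χ x = 1 → ∀ {b : ℝ → ℝ} {b0 : ℝ},
      (∀ᶠ σ in nhdsWithin 0 (Ioi 0), ∫ y, (u y t * χ y) * kk N (y - x) σ ≤ b σ) → Tendsto b (nhdsWithin 0 (Ioi 0)) (nhds b0) → u x t ≤ b0 := by
    intro χ cχ χ01 χx b b0 hb hl
    have := approx_id x (f := fun y => u y t * χ y) (cu.mul cχ) (fun y => mul_nonneg (h.2.1 y t ht).le (χ01 y).1) (fun σ hσ => by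
      have i := u_int_slice hq h hr hK ht (G := fun y => χ y * kk N (y - x) σ) (B := (4 * π * σ) ^ (-(N : ℝ) / 2)) (cχ.mul (kk_cont x hσ)) (fun y => by
        have k0 := kk_pos (y - x) hσ
        have k1 := kk_le_sup (y - x) hσ
        rw [abs_of_nonneg (mul_nonneg (χ01 y).1 k0.le)]
        have := mul_le_mul_of_nonneg_right (χ01 y).2 k0.le
        linarith)
      refine i.congr (Eventually.of_forall fun y => ?_)
      show u y t * (χ y * kk N (y - x) σ) = u y t * χ y * kk N (y - x) σ
      ring) hb hl
    simpa [χx] using this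
  rcases lt_or_ge t (d ^ 2) with hlt | hge
  · obtain ⟨χ, cχ, χ01, χ1, hχ⟩ := hk h hr hρ hK hη x hρ (by linarith) ht htR
    have fin : u x t ≤ C * R * M * (A * (ρ⁻¹ * t ^ (-(N : ℝ) / 2) * rexp (-(d - ρ) ^ 2 / (4 * t)))) := by
      refine conc cχ χ01 (χ1 x (zz_far hR0 hρ x (by linarith)))
        (b := fun σ => C * R * M * (A * (ρ⁻¹ * (t + σ) ^ (-(N : ℝ) / 2) * rexp (-(d - ρ) ^ 2 / (4 * (t + σ)))))) ?_ ?_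
      · filter_upwards [Ioo_mem_nhdsGT (sub_pos.2 hlt)] with σ hσ
        refine hχ hσ.1 fun y θ hy hθ hθT => ?_
        exact capA hN hρ hdρ (zz_near hR0 hρ x y hy) hθ hθT (by linarith [hσ.2])
      · have ca : ContinuousAt (fun σ => C * R * M * (A * (ρ⁻¹ * (t + σ) ^ (-(N : ℝ) / 2) * rexp (-(d - ρ) ^ 2 / (4 * (t + σ)))))) 0 := by
          have c1 : ContinuousAt (fun σ : ℝ => (t + σ) ^ (-(N : ℝ) / 2)) 0 :=
            ContinuousAt.rpow_const (by fun_prop) (Or.inl (by simp; exact ht.ne'))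
          have c2 : ContinuousAt (fun σ : ℝ => rexp (-(d - ρ) ^ 2 / (4 * (t + σ)))) 0 :=
            (ContinuousAt.div (by fun_prop) (by fun_prop) (by simp; exact ht.ne')).rexp
          fun_prop
        have := ca.tendsto.mono_left (nhdsWithin_le_nhds (s := Ioi 0))
        simpa using this
    refine fin.trans ?_
    have hm := le_max_right (d ^ (-((N : ℝ) + 1))) (ρ⁻¹ * t ^ (-(N : ℝ) / 2))
    have m0 : 0 ≤ ρ⁻¹ * t ^ (-(N : ℝ) / 2) := by positivity
    set m := max (d ^ (-((N : ℝ) + 1))) (ρ⁻¹ * t ^ (-(N : ℝ) / 2))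
    have hm0 : 0 ≤ m := m0.trans hm
    calc _ ≤ C * R * M * ((A + B * rexp (1 / 4)) * (m * rexp (-(d - ρ) ^ 2 / (4 * t)))) := by
          have : 0 < B * rexp (1 / 4) := by positivity
          gcongr; linarith
      _ = _ := by ring
  · have hdR : d ≤ R := by
      apply le_of_sq_le_sq _ hR0.le; linarith
    obtain ⟨χ, cχ, χ01, χ1, hχ⟩ := hk h hr hρ hK hη x hd0 hdR ht htR
    have fin : u x t ≤ C * R * M * (B * d ^ (-((N : ℝ) + 1))) := by
      refine conc cχ χ01 (χ1 x (zz_far hR0 hd0 x (by linarith)))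
        (b := fun σ => C * R * M * (B * d ^ (-((N : ℝ) + 1)))) ?_ tendsto_const_nhds
      filter_upwards [self_mem_nhdsWithin] with σ hσ
      refine hχ hσ fun y θ hy hθ hθT => ?_
      have := zz_near hR0 hd0 x y hy
      exact capB hN hd0 (by linarith) hθ
    refine fin.trans ?_
    have hm := le_max_left (d ^ (-((N : ℝ) + 1))) (ρ⁻¹ * t ^ (-(N : ℝ) / 2))
    have m0 : 0 ≤ d ^ (-((N : ℝ) + 1)) := by positivity
    set m := max (d ^ (-((N : ℝ) + 1))) (ρ⁻¹ * t ^ (-(N : ℝ) / 2))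
    have hm0 : 0 ≤ m := m0.trans hm
    have he : 1 ≤ rexp (1 / 4) * rexp (-(d - ρ) ^ 2 / (4 * t)) := by
      rw [← exp_add]
      apply one_le_exp
      have : (d - ρ) ^ 2 / (4 * t) ≤ 1 / 4 := by
        rw [div_le_div_iff₀ (by positivity) (by norm_num)]
        nlinarith
      rw [neg_div]; linarith
    calc _ ≤ C * R * M * (B * (m * 1)) := by rw [mul_one]; gcongr
      _ ≤ C * R * M * (B * (m * (rexp (1 / 4) * rexp (-(d - ρ) ^ 2 / (4 * t))))) := by gcongr
      _ = C * R * M * ((B * rexp (1 / 4)) * (m * rexp (-(d - ρ) ^ 2 / (4 * t)))) := by ring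
      _ ≤ C * R * M * ((A + B * rexp (1 / 4)) * (m * rexp (-(d - ρ) ^ 2 / (4 * t)))) := by
          gcongr; linarith
      _ = _ := by ring

/-- Lemma 2.20: exterior pointwise estimate for small times. -/
theorem stmt14 (N : ℕ) (hN : 1 ≤ N) (q : ℝ) (hq : 1 < q) :
    ∃ C : ℝ, 0 < C ∧
      ∀ r ρ : ℝ, 0 < r → 0 < ρ →
        ∀ K : Set (Euc N), IsCompact K → K ⊆ Metric.ball (0 : Euc N) r →
          ∀ η : Euc N → ℝ, TestFun N r ρ K η →
            ∀ u : Euc N → ℝ → ℝ, IsSol N q u K →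
              ∀ (x : Euc N) (t : ℝ), r + 3 * ρ ≤ ‖x‖ → 0 < t → t ≤ (r + 2 * ρ) ^ 2 →
                u x t ≤
                  C * (r + ρ) *
                    max ((‖x‖ - r - 2 * ρ) ^ (-((N : ℝ) + 1))) (ρ⁻¹ * t ^ (-(N : ℝ) / 2)) *
                    Real.exp (-(‖x‖ - r - 3 * ρ) ^ 2 / (4 * t)) * Rnorm N q η := by
  obtain ⟨C, hC, hm⟩ := main_step N hN hq
  refine ⟨2 * C, by positivity, ?_⟩
  intro r ρ hr hρ K _ hK η hη u h x t hx ht htR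
  refine (hm h hr hρ hK hη x t hx ht htR).trans ?_
  have hM0 : 0 ≤ Rnorm N q η := Rnorm_nonneg
  have hm0 : 0 ≤ max ((‖x‖ - r - 2 * ρ) ^ (-((N : ℝ) + 1))) (ρ⁻¹ * t ^ (-(N : ℝ) / 2)) := le_max_of_le_right (by positivity)
  calc _ ≤ C * (2 * (r + ρ)) * Rnorm N q η * (max ((‖x‖ - r - 2 * ρ) ^ (-((N : ℝ) + 1))) (ρ⁻¹ * t ^ (-(N : ℝ) / 2)) *
                    rexp (-(‖x‖ - r - 3 * ρ) ^ 2 / (4 * t))) := by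
        gcongr; linarith
    _ = _ := by ring

end
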